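/- arXiv:1404.3155 — 2 statements merged into one kernel-verified Lean document; each statement's English description precedes it below -/
import Mathlib

section
/- For every finite simple graph G, the following are equivalent: (1) G is a forest; (2) G has treewidth at most one; (3) G has spaghetti treewidth at most one; (4) G has strongly chordal treewidth at most one; (5) G has directed spaghetti treewidth at most one; (6) G has special treewidth at most one. -/
open SimpleGraph

/-- The cycle graph on `ZMod n` (for `3 ≤ n` this is a cycle of length `n`). -/
def cycGraph (n : ℕ) : SimpleGraph (ZMod n) :=
  SimpleGraph.fromRel (fun x y => x = y + 1)

/-- The set `s` of nodes induces a path in the graph `H`. -/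
def IsPathSet {ι : Type} (H : SimpleGraph ι) (s : Set ι) : Prop :=
  (H.induce s).Connected ∧ ∀ x ∈ s, {y | y ∈ s ∧ H.Adj x y}.ncard ≤ 2

/-- The set `s` of nodes induces a directed path in `H` with respect to the
orientation `o` of the edges of `H`. -/
def IsDirPathSet {ι : Type} (H : SimpleGraph ι) (o : ι → ι → Prop) (s : Set ι) : Prop :=
  IsPathSet H s ∧ (∀ x ∈ s, {y | y ∈ s ∧ o x y}.ncard ≤ 1) ∧
    (∀ x ∈ s, {y | y ∈ s ∧ o y x}.ncard ≤ 1)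

/-- A tree decomposition of a finite simple graph `G`. -/
structure TreeDecomp {V : Type} (G : SimpleGraph V) where
  ι : Type
  finι : Finite ι
  tree : SimpleGraph ι
  isTree : tree.IsTree
  bag : ι → Set V
  bag_cover : ∀ v : V, ∃ x, v ∈ bag x
  bag_edge : ∀ ⦃u v : V⦄, G.Adj u v → ∃ x, u ∈ bag x ∧ v ∈ bag x
  bag_conn : ∀ v : V, (tree.induce {x | v ∈ bag x}).Connected

/-- A spaghetti tree decomposition: for every vertex `v` of `G`, the nodes whose
bags contain `v` induce a path in the tree. -/
structure SpaghettiTD {V : Type} (G : SimpleGraph V) extends TreeDecomp G where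
  bag_path : ∀ v : V, IsPathSet tree {x | v ∈ bag x}

/-- A directed spaghetti tree decomposition: the tree edges are oriented, and for
every vertex `v` of `G` the nodes whose bags contain `v` induce a directed path. -/
structure DirSpaghettiTD {V : Type} (G : SimpleGraph V) extends TreeDecomp G where
  orient : ι → ι → Prop
  orient_iff : ∀ x y : ι, tree.Adj x y ↔ (orient x y ∨ orient y x)
  orient_asymm : ∀ x y : ι, orient x y → ¬ orient y x
  bag_dirpath : ∀ v : V, IsDirPathSet tree orient {x | v ∈ bag x}

/-- A special tree decomposition: the tree is rooted, and for every vertex `v` of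
`G` the nodes whose bags contain `v` induce a vertical path, i.e. a directed path
with respect to the orientation of every tree edge towards the root. -/
structure SpecialTD {V : Type} (G : SimpleGraph V) extends TreeDecomp G where
  root : ι
  bag_vertical : ∀ v : V,
    IsDirPathSet tree (fun x y => tree.Adj x y ∧ tree.dist y root < tree.dist x root)
      {x | v ∈ bag x}

/-- A path decomposition of a finite simple graph `G`. -/
structure PathDecomp {V : Type} (G : SimpleGraph V) where
  m : ℕ
  hm : 0 < m
  bag : Fin m → Set V
  bag_cover : ∀ v : V, ∃ i, v ∈ bag i
  bag_edge : ∀ ⦃u v : V⦄, G.Adj u v → ∃ i, u ∈ bag i ∧ v ∈ bag i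
  bag_convex : ∀ (v : V) (i j k : Fin m), i ≤ j → j ≤ k → v ∈ bag i → v ∈ bag k → v ∈ bag j

/-- Treewidth: minimal width of a tree decomposition. -/
noncomputable def treewidth {V : Type} (G : SimpleGraph V) : ℕ :=
  sInf {k | ∃ td : TreeDecomp G, ∀ x, (td.bag x).ncard ≤ k + 1}

/-- Spaghetti treewidth: minimal width of a spaghetti tree decomposition. -/
noncomputable def sptw {V : Type} (G : SimpleGraph V) : ℕ :=
  sInf {k | ∃ td : SpaghettiTD G, ∀ x, (td.bag x).ncard ≤ k + 1}

/-- Directed spaghetti treewidth: minimal width of a directed spaghetti tree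
decomposition. -/
noncomputable def dptw {V : Type} (G : SimpleGraph V) : ℕ :=
  sInf {k | ∃ td : DirSpaghettiTD G, ∀ x, (td.bag x).ncard ≤ k + 1}

/-- Special treewidth: minimal width of a special tree decomposition. -/
noncomputable def spctw {V : Type} (G : SimpleGraph V) : ℕ :=
  sInf {k | ∃ td : SpecialTD G, ∀ x, (td.bag x).ncard ≤ k + 1}

/-- Pathwidth: minimal width of a path decomposition. -/
noncomputable def pw {V : Type} (G : SimpleGraph V) : ℕ :=
  sInf {k | ∃ pd : PathDecomp G, ∀ i, (pd.bag i).ncard ≤ k + 1}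

/-- A graph is chordal iff it has no induced (i.e. chordless) cycle of length at
least four. -/
def IsChordal {V : Type} (G : SimpleGraph V) : Prop :=
  ∀ (S : Set V) (n : ℕ), 4 ≤ n → ¬ Nonempty ((G.induce S) ≃g cycGraph n)

/-- A graph is strongly chordal if it is chordal and every even cycle of length at
least six has an odd chord: a chord splitting the cycle into two odd paths of
length at least three. -/
def IsStronglyChordal {V : Type} (G : SimpleGraph V) : Prop :=
  IsChordal G ∧ ∀ n : ℕ, 6 ≤ n → Even n → ∀ f : ZMod n → V,
    Function.Injective f → (∀ i : ZMod n, G.Adj (f i) (f (i + 1))) →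
      ∃ (i : ZMod n) (d : ℕ), Odd d ∧ 3 ≤ d ∧ d + 3 ≤ n ∧ G.Adj (f i) (f (i + (d : ZMod n)))

/-- Strongly chordal treewidth: the minimum of `ω(H) - 1` over all strongly chordal
supergraphs `H` of `G` (on the same vertex set; here `ω(H) ≤ k + 1` is expressed as
`H.CliqueFree (k + 2)`). -/
noncomputable def sctw {V : Type} (G : SimpleGraph V) : ℕ :=
  sInf {k | ∃ H : SimpleGraph V, G ≤ H ∧ IsStronglyChordal H ∧ H.CliqueFree (k + 2)}

/-- `H` is a minor of `G`: there is a family of nonempty, pairwise disjoint,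
connected branch sets in `G`, one for each vertex of `H`, such that every edge of
`H` is realized by an edge of `G` between the corresponding branch sets. -/
def IsMinorOf {W V : Type} (H : SimpleGraph W) (G : SimpleGraph V) : Prop :=
  ∃ f : W → Set V,
    (∀ w, (f w).Nonempty) ∧ (∀ w, (G.induce (f w)).Connected) ∧
    (Pairwise fun w w' => Disjoint (f w) (f w')) ∧
    ∀ ⦃w w'⦄, H.Adj w w' → ∃ u ∈ f w, ∃ v ∈ f w', G.Adj u v

/-- The complete graph on four vertices. -/
def K4 : SimpleGraph (Fin 4) := ⊤

/-- `D₃`: two vertices (`0` and `1`) joined by three internally vertex-disjoint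
paths of length three. -/
def D3 : SimpleGraph (Fin 8) := SimpleGraph.fromRel (fun x y =>
  (x = 0 ∧ y = 2) ∨ (x = 2 ∧ y = 3) ∨ (x = 3 ∧ y = 1) ∨
  (x = 0 ∧ y = 4) ∨ (x = 4 ∧ y = 5) ∨ (x = 5 ∧ y = 1) ∨
  (x = 0 ∧ y = 6) ∨ (x = 6 ∧ y = 7) ∨ (x = 7 ∧ y = 1))

/-- `S₃` (the 3-sun): a 6-cycle `0 1 2 3 4 5` together with the triangle `1 3 5`. -/
def S3 : SimpleGraph (Fin 6) := SimpleGraph.fromRel (fun x y =>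
  (x = 0 ∧ y = 1) ∨ (x = 1 ∧ y = 2) ∨ (x = 2 ∧ y = 3) ∨ (x = 3 ∧ y = 4) ∨
  (x = 4 ∧ y = 5) ∨ (x = 5 ∧ y = 0) ∨ (x = 1 ∧ y = 3) ∨ (x = 3 ∧ y = 5) ∨ (x = 5 ∧ y = 1))

/-- A graph is 2-connected if it has at least three vertices and deleting any one
vertex leaves it connected. -/
def TwoConnected {V : Type} (G : SimpleGraph V) : Prop :=
  3 ≤ Nat.card V ∧ ∀ v : V, (G.induce {x | x ≠ v}).Connected

/-- The cell completion of `G`: add an edge `vw` for every pair of (nonadjacent)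
vertices `v, w` such that deleting `v` and `w` leaves at least three connected
components. -/
def cellCompletion {V : Type} (G : SimpleGraph V) : SimpleGraph V :=
  SimpleGraph.fromRel (fun v w => G.Adj v w ∨
    3 ≤ Nat.card ((G.induce {x | x ≠ v ∧ x ≠ w}).ConnectedComponent))

/-- The induced subgraph of `G` on `S` has no cut vertex. -/
def NoCutVertex {V : Type} (G : SimpleGraph V) (S : Set V) : Prop :=
  ∀ v ∈ S, (S \ {v}).Nonempty → (G.induce (S \ {v})).Connected

/-- `S` carries a block of `G`: a maximal connected (induced) subgraph without a
cut vertex. -/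
def IsBlock {V : Type} (G : SimpleGraph V) (S : Set V) : Prop :=
  S.Nonempty ∧ (G.induce S).Connected ∧ NoCutVertex G S ∧
    ∀ S' : Set V, S ⊆ S' → (G.induce S').Connected → NoCutVertex G S' → S' = S

/-- Glue a cycle of length `n` onto the graph `G` by identifying the cycle edge
`{0, 1}` (with its end vertices) with the edge `{a, b}` of `G`. -/
def glueCycle {V : Type} (G : SimpleGraph V) (n : ℕ) (a b : V) :
    SimpleGraph (V ⊕ {x : ZMod n // x ≠ 0 ∧ x ≠ 1}) :=
  SimpleGraph.fromRel (fun p q =>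
    match p, q with
    | Sum.inl u, Sum.inl v => G.Adj u v
    | Sum.inl u, Sum.inr x => (u = a ∧ (cycGraph n).Adj 0 x.1) ∨ (u = b ∧ (cycGraph n).Adj 1 x.1)
    | Sum.inr x, Sum.inr y => (cycGraph n).Adj x.1 y.1
    | Sum.inr _, Sum.inl _ => False)

/-- The class of trees of cycles: every cycle is a tree of cycles, and gluing a
cycle onto a tree of cycles along an edge yields a tree of cycles (up to
isomorphism). -/
inductive IsTreeOfCycles : {V : Type} → SimpleGraph V → Prop
  | cycle {V : Type} (G : SimpleGraph V) (n : ℕ) (hn : 3 ≤ n)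
      (e : Nonempty (G ≃g cycGraph n)) : IsTreeOfCycles G
  | glue {V W : Type} (G : SimpleGraph V) (hG : IsTreeOfCycles G)
      (n : ℕ) (hn : 3 ≤ n) (a b : V) (hab : G.Adj a b)
      (H : SimpleGraph W) (e : Nonempty (H ≃g glueCycle G n a b)) : IsTreeOfCycles H

/-- `S` is the vertex set of a chordless cycle of `G`, i.e. it induces a cycle. -/
def IsChordlessCycle {V : Type} (G : SimpleGraph V) (S : Set V) : Prop :=
  ∃ n : ℕ, 3 ≤ n ∧ Nonempty ((G.induce S) ≃g cycGraph n)

/-- The edge `uv` is an edge separator: it lies in at least two distinct chordless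
cycles of `G`. -/
def IsEdgeSeparator {V : Type} (G : SimpleGraph V) (u v : V) : Prop :=
  G.Adj u v ∧ ∃ S₁ S₂ : Set V, S₁ ≠ S₂ ∧ IsChordlessCycle G S₁ ∧ IsChordlessCycle G S₂ ∧
    u ∈ S₁ ∧ v ∈ S₁ ∧ u ∈ S₂ ∧ v ∈ S₂

/-- `S` is a simplicial triangle of `G`: a chordless cycle on three vertices
containing a simplicial vertex of `G`. -/
def IsSimplicialTriangle {V : Type} (G : SimpleGraph V) (S : Set V) : Prop :=
  IsChordlessCycle G S ∧ S.ncard = 3 ∧ ∃ v ∈ S, G.IsClique (G.neighborSet v)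

/-- A chain tree of cycles: a tree of cycles in which every edge lies in at most two
chordless cycles that are not simplicial triangles (equivalently, if an edge lies in
`m ≥ 3` chordless cycles then at least `m - 2` of them are simplicial triangles). -/
def IsChainTreeOfCycles {V : Type} (G : SimpleGraph V) : Prop :=
  IsTreeOfCycles G ∧ ∀ u v : V, G.Adj u v →
    {S : Set V | IsChordlessCycle G S ∧ u ∈ S ∧ v ∈ S ∧ ¬ IsSimplicialTriangle G S}.ncard ≤ 2

/-- A tree of two-boundaried cycles: a tree of cycles in which every chordless
cycle contains at most two edge separators. -/
def IsTreeOfTwoBoundariedCycles {V : Type} (G : SimpleGraph V) : Prop :=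
  IsTreeOfCycles G ∧ ∀ S : Set V, IsChordlessCycle G S →
    {e : Sym2 V | ∃ u v : V, e = s(u, v) ∧ u ∈ S ∧ v ∈ S ∧ IsEdgeSeparator G u v}.ncard ≤ 2

/-- A path of cycles: a tree of cycles in which every chordless cycle contains at
most two edge separators and every edge lies in at most two chordless cycles that
are not simplicial triangles. -/
def IsPathOfCycles {V : Type} (G : SimpleGraph V) : Prop :=
  IsTreeOfCycles G ∧
    (∀ S : Set V, IsChordlessCycle G S →
      {e : Sym2 V | ∃ u v : V, e = s(u, v) ∧ u ∈ S ∧ v ∈ S ∧ IsEdgeSeparator G u v}.ncard ≤ 2) ∧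
    ∀ u v : V, G.Adj u v →
      {S : Set V | IsChordlessCycle G S ∧ u ∈ S ∧ v ∈ S ∧ ¬ IsSimplicialTriangle G S}.ncard ≤ 2

/-- The graph is a single edge. -/
def IsSingleEdgeGraph {V : Type} (G : SimpleGraph V) : Prop :=
  Nat.card V = 2 ∧ ∀ a b : V, a ≠ b → G.Adj a b

/-- A mamba: a 2-connected graph of pathwidth two, a single edge, or an isolated
vertex. -/
def IsMamba {V : Type} (G : SimpleGraph V) : Prop :=
  (TwoConnected G ∧ pw G = 2) ∨ IsSingleEdgeGraph G ∨ Nat.card V = 1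

/-- `v` is a head vertex of the mamba `G`: some path decomposition of `G` of width
at most two has `v` in its first bag. -/
def IsHeadVertex {V : Type} (G : SimpleGraph V) (v : V) : Prop :=
  ∃ pd : PathDecomp G, (∀ i, (pd.bag i).ncard ≤ 3) ∧ v ∈ pd.bag ⟨0, pd.hm⟩

/-- Glue the graph `M` onto the graph `G` by identifying the vertex `h` of `M` with
the vertex `x` of `G`. -/
def glueAtVertex {V W : Type} (G : SimpleGraph V) (x : V) (M : SimpleGraph W) (h : W) :
    SimpleGraph (V ⊕ {w : W // w ≠ h}) :=
  SimpleGraph.fromRel (fun p q =>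
    match p, q with
    | Sum.inl u, Sum.inl u' => G.Adj u u'
    | Sum.inl u, Sum.inr w => u = x ∧ M.Adj h w.1
    | Sum.inr w, Sum.inr w' => M.Adj w.1 w'.1
    | Sum.inr _, Sum.inl _ => False)

/-- The class of mamba trees: every mamba is a mamba tree, and gluing a mamba onto
a mamba tree by identifying a vertex of the mamba tree with a head vertex of the
mamba yields a mamba tree (up to isomorphism). -/
inductive IsMambaTree : {V : Type} → SimpleGraph V → Prop
  | mamba {V : Type} (G : SimpleGraph V) (hG : IsMamba G) : IsMambaTree G
  | glue {V W U : Type} (G : SimpleGraph V) (hG : IsMambaTree G)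
      (M : SimpleGraph W) (hM : IsMamba M) (x : V) (h : W) (hh : IsHeadVertex M h)
      (K : SimpleGraph U) (e : Nonempty (K ≃g glueAtVertex G x M h)) : IsMambaTree K

/-- Subdivide the edge `{a, b}` of `G` by a new vertex. -/
def subdivideEdge {V : Type} (G : SimpleGraph V) (a b : V) : SimpleGraph (V ⊕ Unit) :=
  SimpleGraph.fromRel (fun p q =>
    match p, q with
    | Sum.inl u, Sum.inl v => G.Adj u v ∧ ¬(u = a ∧ v = b) ∧ ¬(u = b ∧ v = a)
    | Sum.inl u, Sum.inr _ => u = a ∨ u = b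
    | Sum.inr _, _ => False)

/-- `H` is a subdivision of `G`: `H` is obtained from (an isomorphic copy of) `G`
by repeatedly subdividing edges. -/
inductive IsSubdivisionOf : {W V : Type} → SimpleGraph W → SimpleGraph V → Prop
  | base {V W : Type} {G : SimpleGraph V} {H : SimpleGraph W}
      (e : Nonempty (H ≃g G)) : IsSubdivisionOf H G
  | step {V W U : Type} {G : SimpleGraph V} {H : SimpleGraph W} (a b : W) (hab : H.Adj a b)
      (h : IsSubdivisionOf H G) {K : SimpleGraph U}
      (e : Nonempty (K ≃g subdivideEdge H a b)) : IsSubdivisionOf K G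

/-- Contract the edge `{a, b}` of `G` (the contracted vertex is `a`, `b` is removed). -/
def contractEdge {V : Type} (G : SimpleGraph V) (a b : V) : SimpleGraph {x : V // x ≠ b} :=
  SimpleGraph.fromRel (fun x y =>
    G.Adj x.1 y.1 ∨ (x.1 = a ∧ G.Adj b y.1) ∨ (y.1 = a ∧ G.Adj b x.1))

/-- Every vertex has at most one neighbour whose `r`-value does not exceed its own. -/
def UniqueLowerNeighbor {V : Type} (G : SimpleGraph V) (r : V → ℕ) : Prop :=
  ∀ ⦃v u w : V⦄, G.Adj v u → G.Adj v w → r u ≤ r v → r w ≤ r v → u = w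

lemma UniqueLowerNeighbor.isAcyclic {V : Type} {G : SimpleGraph V} {r : V → ℕ}
    (h : UniqueLowerNeighbor G r) : G.IsAcyclic := by
  classical
  intro v₀ c hc
  obtain ⟨v, hv, hmax⟩ := c.support.toFinset.exists_max_image r ⟨v₀, by simp⟩
  rw [List.mem_toFinset] at hv
  have hc' := hc.rotate hv
  have hle : ∀ w ∈ (c.rotate v hv).support, r w ≤ r v := fun w hw =>
    hmax w (by rw [List.mem_toFinset]; exact (Walk.mem_support_rotate_iff ..).1 hw)
  exact hc'.snd_ne_penultimate <| h (Walk.adj_snd hc'.not_nil)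
    (Walk.adj_penultimate hc'.not_nil).symm (hle _ (Walk.getVert_mem_support _ _))
    (hle _ (Walk.getVert_mem_support _ _))

lemma SimpleGraph.IsAcyclic.eq_of_adj_of_dist_lt {V : Type} {G : SimpleGraph V}
    (hG : G.IsAcyclic) {c v u w : V} (hr : G.Reachable v c) (hu : G.Adj v u) (hw : G.Adj v w)
    (hud : G.dist u c < G.dist v c) (hwd : G.dist w c < G.dist v c) : u = w := by
  have key : ∀ u, G.Adj v u → G.dist u c < G.dist v c →
      ∃ p : G.Walk v c, p.IsPath ∧ p.snd = u := by
    intro u hu hud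
    obtain ⟨p, hp⟩ := (hu.symm.reachable.trans hr).exists_walk_length_eq_dist
    have h1 := dist_le (Walk.cons hu p)
    refine ⟨Walk.cons hu p, Walk.isPath_of_length_eq_dist _ ?_, by simp⟩
    simp only [Walk.length_cons] at h1 ⊢
    omega
  obtain ⟨p, hp, rfl⟩ := key u hu hud
  obtain ⟨q, hq, rfl⟩ := key w hw hwd
  have := congrArg Subtype.val ((hG.subsingleton_path _ _).elim ⟨p, hp⟩ ⟨q, hq⟩)
  simp only at this
  rw [this]

lemma SimpleGraph.IsAcyclic.exists_uniqueLowerNeighbor {V : Type} [Finite V] {G : SimpleGraph V}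
    (hG : G.IsAcyclic) : ∃ r : V → ℕ, Function.Injective r ∧ UniqueLowerNeighbor G r := by
  obtain ⟨n, ⟨e⟩⟩ := Finite.exists_equiv_fin V
  let c : V → V := fun v => (G.connectedComponentMk v).out
  have hc : ∀ v, G.Reachable v (c v) := fun v =>
    (ConnectedComponent.exact (Quot.out_eq (G.connectedComponentMk v))).symm
  have hcc : ∀ {u v}, G.Adj u v → c u = c v := fun {u v} h => by
    simp only [c, ConnectedComponent.sound h.reachable]
  have hlt : ∀ {v u}, G.Adj v u →
      G.dist u (c u) * n + e u ≤ G.dist v (c v) * n + e v → G.dist u (c v) < G.dist v (c v) := by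
    intro v u h hle
    rw [← hcc h] at hle
    have hne : G.dist (c v) v ≠ G.dist (c v) u := hG.dist_ne_of_adj h (hc v).symm
    rw [dist_comm, dist_comm (v := u)] at hne
    by_contra hcon
    have h1 : (G.dist v (c v) + 1) * n ≤ G.dist u (c v) * n := Nat.mul_le_mul_right _ (by omega)
    have := (e v).2
    rw [add_mul] at h1
    omega
  refine ⟨fun v => G.dist v (c v) * n + e v, fun u v h => ?_, fun v u w hu hw h1 h2 => ?_⟩
  · have := congrArg (· % n) h
    simp only [Nat.mul_add_mod_self_right, Nat.mod_eq_of_lt (e u).2, Nat.mod_eq_of_lt (e v).2] at this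
    exact e.injective (Fin.ext this)
  · exact hG.eq_of_adj_of_dist_lt (hc v) hu hw (hlt hu h1) (hlt hw h2)

/-- The graph joining every element to its image under `par`. -/
def parentGraph {ι : Type} (par : ι → ι) : SimpleGraph ι :=
  SimpleGraph.fromRel (fun x y => par x = y)

section ParentGraph

variable {ι : Type} {par : ι → ι} {root : ι} {r : ι → ℕ}

lemma parentGraph_adj_par (hr : ∀ x, x ≠ root → r (par x) < r x) {x : ι} (hx : x ≠ root) :
    (parentGraph par).Adj x (par x) := by
  refine (SimpleGraph.fromRel_adj _ _ _).2 ⟨fun h => ?_, Or.inl rfl⟩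
  have := hr x hx
  rw [← h] at this
  exact this.false

lemma parentGraph_isTree (hroot : par root = root) (hr : ∀ x, x ≠ root → r (par x) < r x) :
    (parentGraph par).IsTree := by
  have : Nonempty ι := ⟨root⟩
  refine ⟨⟨?_⟩, UniqueLowerNeighbor.isAcyclic (r := r) ?_⟩
  · have key : ∀ n x, r x = n → (parentGraph par).Reachable x root := by
      intro n
      induction n using Nat.strong_induction_on with
      | _ n ih =>
        rintro x rfl
        by_cases hx : x = root
        · rw [hx]
        · exact (parentGraph_adj_par hr hx).reachable.trans (ih _ (hr x hx) _ rfl)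
    exact fun x y => (key _ x rfl).trans (key _ y rfl).symm
  · have key : ∀ x y, (parentGraph par).Adj x y → r y ≤ r x → par x = y := by
      intro x y h hle
      obtain ⟨hne, h | h⟩ := (SimpleGraph.fromRel_adj _ _ _).1 h
      · exact h
      · have hy : y ≠ root := fun hy => by
          rw [hy, hroot] at h
          exact hne (h.symm.trans hy.symm)
        have := hr y hy
        rw [h] at this
        omega
    exact fun v u w hu hw h1 h2 => (key v u hu h1).symm.trans (key v w hw h2)

lemma parentGraph_par_eq_of_dist_lt (hroot : par root = root)
    (hr : ∀ x, x ≠ root → r (par x) < r x) {x y : ι} (h : (parentGraph par).Adj x y)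
    (hd : (parentGraph par).dist y root < (parentGraph par).dist x root) : par x = y := by
  have key : ∀ n x, x ≠ root → (parentGraph par).dist x root = n →
      (parentGraph par).dist (par x) root < (parentGraph par).dist x root := by
    intro n
    induction n using Nat.strong_induction_on with
    | _ n ih =>
      rintro x hx rfl
      obtain ⟨p, hp⟩ :=
        (parentGraph_isTree hroot hr).1.exists_walk_length_eq_dist x root
      cases p with
      | nil => exact absurd rfl hx
      | @cons _ z _ hz q =>
        have hq := dist_le q
        rw [Walk.length_cons] at hp
        obtain ⟨hne, h | h⟩ := (SimpleGraph.fromRel_adj _ _ _).1 hz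
        · rw [h]; omega
        · have hz' : z ≠ root := fun hy => by
            rw [hy, hroot] at h
            exact hx h.symm
          have := ih _ (by omega) z hz' rfl
          rw [h] at this
          omega
  obtain ⟨hne, h | h⟩ := (SimpleGraph.fromRel_adj _ _ _).1 h
  · exact h
  · have hy : y ≠ root := fun hy => by
      rw [hy, hroot] at h
      exact hne (h.symm.trans hy.symm)
    have := key _ y hy rfl
    rw [h] at this
    omega

end ParentGraph

lemma SimpleGraph.IsAcyclic.exists_specialTD {V : Type} [Finite V] {G : SimpleGraph V}
    (hG : G.IsAcyclic) : ∃ td : SpecialTD G, ∀ x, (td.bag x).ncard ≤ 2 := by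
  classical
  obtain ⟨r, hinj, hlow⟩ := hG.exists_uniqueLowerNeighbor
  let C : V → V → Prop := fun u w => w = u ∨ (G.Adj w u ∧ r u < r w)
  let rk : Option V → ℕ := fun x => x.elim 0 (fun v => r v + 1)
  have hex : ∀ x : Option V, ∃ y : Option V, (x = none → y = none) ∧ ∀ v, x = some v →
      rk y < rk x ∧ ∀ u, G.Adj v u → r u < r v →
        ∃ w, y = some w ∧ C u w ∧ ∀ w', r w' < r v → C u w' → r w' ≤ r w := by
    rintro (_ | v)
    · exact ⟨none, fun _ => rfl, by simp⟩
    by_cases h : ∃ u, G.Adj v u ∧ r u < r v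
    · obtain ⟨u, hu, hru⟩ := h
      obtain ⟨w, hw, hmax⟩ := Set.exists_max_image {w | r w < r v ∧ C u w} r (Set.toFinite _)
        ⟨u, hru, Or.inl rfl⟩
      refine ⟨some w, by simp, ?_⟩
      rintro _ ⟨⟩
      refine ⟨by simpa [rk] using hw.1, fun u' hu' hru' => ?_⟩
      obtain rfl := hlow hu hu' hru.le hru'.le
      exact ⟨w, rfl, hw.2, fun w' h1 h2 => hmax w' ⟨h1, h2⟩⟩
    · refine ⟨none, by simp, ?_⟩
      rintro _ ⟨⟩
      exact ⟨by simp [rk], fun u hu hru => (h ⟨u, hu, hru⟩).elim⟩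
  choose par hpar0 hpar using hex
  have hroot : par none = none := hpar0 none rfl
  have hrk : ∀ x, x ≠ none → rk (par x) < rk x := by
    rintro (_ | v) h
    · exact absurd rfl h
    · exact (hpar _ v rfl).1
  let bag : Option V → Set V := fun x => {u | ∃ w, x = some w ∧ C u w}
  have hstep : ∀ v w, G.Adj w v → r v < r w → ∃ z, par (some w) = some z ∧ C v z ∧ r z < r w ∧
      ∀ w', r w' < r w → C v w' → r w' ≤ r z := by
    intro v w h1 h2
    obtain ⟨z, hz, hC, hm⟩ := (hpar _ w rfl).2 v h1 h2
    have := (hpar _ w rfl).1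
    rw [hz] at this
    exact ⟨z, hz, hC, by simpa [rk] using this, hm⟩
  have hconn : ∀ v, ((parentGraph par).induce {x | v ∈ bag x}).Connected := by
    intro v
    have hv : some v ∈ {x | v ∈ bag x} := ⟨v, rfl, Or.inl rfl⟩
    have key : ∀ n w (hw : some w ∈ {x | v ∈ bag x}), r w = n →
        ((parentGraph par).induce {x | v ∈ bag x}).Reachable ⟨some w, hw⟩ ⟨some v, hv⟩ := by
      intro n
      induction n using Nat.strong_induction_on with
      | _ n ih =>
        rintro w hw rfl
        obtain ⟨_, ⟨⟩, rfl | ⟨h1, h2⟩⟩ := id hw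
        · rfl
        · obtain ⟨z, hz, hC, hlt, -⟩ := hstep v w h1 h2
          have hz' : some z ∈ {x | v ∈ bag x} := ⟨z, rfl, hC⟩
          refine Reachable.trans (Adj.reachable ?_) (ih _ hlt z hz' rfl)
          have := parentGraph_adj_par hrk (x := some w) (by simp)
          rw [hz] at this
          exact this
    have : Nonempty {x | v ∈ bag x} := ⟨⟨_, hv⟩⟩
    refine ⟨?_⟩
    rintro ⟨x, hx⟩ ⟨y, hy⟩
    obtain ⟨w, rfl, -⟩ := id hx
    obtain ⟨w', rfl, -⟩ := id hy
    exact (key _ w hx rfl).trans (key _ w' hy rfl).symm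
  have hup : ∀ v x, {y | y ∈ {x | v ∈ bag x} ∧ par y = x ∧ x ∈ {x | v ∈ bag x}}.ncard ≤ 1 := by
    intro v x
    rw [Set.ncard_le_one (Set.toFinite _)]
    rintro _ ⟨⟨w, rfl, hw⟩, h1, z, rfl, hz⟩ _ ⟨⟨w', rfl, hw'⟩, h2, -⟩
    have key : ∀ w, C v w → par (some w) = some z → r z < r w ∧
        ∀ w', r w' < r w → C v w' → r w' ≤ r z := by
      intro w hw hp
      rcases hw with rfl | ⟨h1, h2⟩
      · have := (hpar _ w rfl).1
        rw [hp] at this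
        have hlt : r z < r w := by simpa [rk] using this
        rcases hz with rfl | h
        · omega
        · omega
      · obtain ⟨z', hz', -, hlt, hm⟩ := hstep v w h1 h2
        rw [hp] at hz'
        cases hz'
        exact ⟨hlt, hm⟩
    have k1 := key w hw h1
    have k2 := key w' hw' h2
    rcases lt_trichotomy (r w) (r w') with h | h | h
    · have := k2.2 w h hw; omega
    · rw [hinj h]
    · have := k1.2 w' h hw'; omega
  have hdown : ∀ (s : Set (Option V)) x, {y | y ∈ s ∧ par x = y}.ncard ≤ 1 := by
    intro s x
    rw [Set.ncard_le_one (Set.toFinite _)]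
    rintro _ ⟨-, rfl⟩ _ ⟨-, rfl⟩
    rfl
  refine ⟨
    { ι := Option V
      finι := inferInstance
      tree := parentGraph par
      isTree := parentGraph_isTree hroot hrk
      bag := bag
      bag_cover := fun v => ⟨some v, v, rfl, Or.inl rfl⟩
      bag_edge := fun u v h => ?_
      bag_conn := hconn
      root := none
      bag_vertical := fun v => ⟨⟨hconn v, fun x hx => ?_⟩, fun x hx => ?_, fun x hx => ?_⟩ }, ?_⟩
  · rcases lt_trichotomy (r u) (r v) with hlt | heq | hlt
    · exact ⟨some v, ⟨v, rfl, Or.inr ⟨h.symm, hlt⟩⟩, v, rfl, Or.inl rfl⟩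
    · exact absurd (hinj heq) h.ne
    · exact ⟨some u, ⟨u, rfl, Or.inl rfl⟩, u, rfl, Or.inr ⟨h, hlt⟩⟩
  · refine (Set.ncard_le_ncard (t := {y | y ∈ {x | v ∈ bag x} ∧ par x = y} ∪
      {y | y ∈ {x | v ∈ bag x} ∧ par y = x ∧ x ∈ {x | v ∈ bag x}}) ?_ (Set.toFinite _)).trans
      ((Set.ncard_union_le _ _).trans (add_le_add (hdown _ x) (hup v x)))
    rintro y ⟨hy, hadj⟩
    obtain ⟨-, h | h⟩ := (SimpleGraph.fromRel_adj _ _ _).1 hadj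
    · exact Or.inl ⟨hy, h⟩
    · exact Or.inr ⟨hy, h, hx⟩
  · refine (Set.ncard_le_ncard ?_ (Set.toFinite _)).trans (hdown {x | v ∈ bag x} x)
    rintro y ⟨hy, hadj, hd⟩
    exact ⟨hy, parentGraph_par_eq_of_dist_lt hroot hrk hadj hd⟩
  · refine (Set.ncard_le_ncard ?_ (Set.toFinite _)).trans (hup v x)
    rintro y ⟨hy, hadj, hd⟩
    exact ⟨hy, parentGraph_par_eq_of_dist_lt hroot hrk hadj hd, hx⟩
  · rintro (_ | w)
    · simp [bag]
    · change (bag (some w)).ncard ≤ 2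
      have : bag (some w) = {w} ∪ {u | G.Adj w u ∧ r u < r w} := by
        ext u
        simp [bag, C, eq_comm]
      rw [this]
      refine (Set.ncard_union_le _ _).trans ?_
      have : {u | G.Adj w u ∧ r u < r w}.ncard ≤ 1 := by
        rw [Set.ncard_le_one (Set.toFinite _)]
        exact fun a ha b hb => hlow ha.1 hb.1 ha.2.le hb.2.le
      rw [Set.ncard_singleton]
      omega

lemma UniqueLowerNeighbor.lt_of_isPath {V : Type} {G : SimpleGraph V} {r : V → ℕ}
    (h : UniqueLowerNeighbor G r) {y t : V} (p : G.Walk y t) :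
    ∀ x, G.Adj x y → r x < r y → x ∉ p.support → p.IsPath → r x < r t := by
  induction p with
  | nil => exact fun x _ hlt _ _ => hlt
  | @cons y w t hyw p ih =>
    intro x hxy hlt hx hp
    rw [Walk.cons_isPath_iff] at hp
    have hyw' : r y < r w := by
      by_contra hcon
      have := h hxy.symm hyw hlt.le (not_lt.1 hcon)
      subst this
      exact hx (by simp)
    exact hlt.trans (ih y hyw hyw' hp.2 hp.1)

lemma UniqueLowerNeighbor.exists_adj_lt {V : Type} {G : SimpleGraph V} {r : V → ℕ}
    (h : UniqueLowerNeighbor G r) (hinj : Function.Injective r) {s : Set V}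
    (hs : (G.induce s).Connected) {x t : V} (hx : x ∈ s) (ht : t ∈ s) (hne : x ≠ t)
    (hmin : ∀ y ∈ s, r t ≤ r y) : ∃ y ∈ s, G.Adj x y ∧ r y < r x := by
  have h' : UniqueLowerNeighbor (G.induce s) (fun y => r y) :=
    fun v u w hu hw h1 h2 => Subtype.ext (h hu hw h1 h2)
  obtain ⟨p, hp, -⟩ := hs.exists_path_of_dist ⟨x, hx⟩ ⟨t, ht⟩
  cases p with
  | nil => exact absurd rfl hne
  | @cons _ y _ hxy p =>
    rw [Walk.cons_isPath_iff] at hp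
    refine ⟨y, y.2, hxy, ?_⟩
    by_contra hcon
    have hxy' : r x ≠ r y := fun he => hxy.ne (Subtype.ext (hinj he))
    have := h'.lt_of_isPath p ⟨x, hx⟩ hxy (by simp only; omega) hp.2 hp.1
    have h2 := hmin x hx
    simp only at this
    omega

/-- If two connected node sets of a tree meet, then the lowest node of one set which is not lower
than the lowest node of the other set belongs to both. -/
lemma UniqueLowerNeighbor.mem_of_connected {V : Type} {G : SimpleGraph V} {r : V → ℕ}
    (h : UniqueLowerNeighbor G r) (hinj : Function.Injective r) {s s' : Set V}
    (hs : (G.induce s).Connected) (hs' : (G.induce s').Connected) {t t' : V} (ht : t ∈ s)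
    (ht' : t' ∈ s') (hmin : ∀ y ∈ s, r t ≤ r y) (hmin' : ∀ y ∈ s', r t' ≤ r y)
    (hle : r t' ≤ r t) : ∀ n z, z ∈ s → z ∈ s' → r z = n → t ∈ s' := by
  intro n
  induction n using Nat.strong_induction_on with
  | _ n ih =>
    rintro z hz hz' rfl
    by_cases hzt : z = t
    · exact hzt ▸ hz'
    have hzt' : z ≠ t' := by
      rintro rfl
      exact hzt (hinj (le_antisymm hle (hmin z hz)))
    obtain ⟨y, hy, hzy, hlt⟩ := h.exists_adj_lt hinj hs hz ht hzt hmin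
    obtain ⟨y', hy', hzy', hlt'⟩ := h.exists_adj_lt hinj hs' hz' ht' hzt' hmin'
    obtain rfl := h hzy hzy' hlt.le hlt'.le
    exact ih _ hlt y hy hy' rfl

lemma TreeDecomp.isAcyclic {V : Type} [Finite V] {G : SimpleGraph V} (td : TreeDecomp G)
    (hw : ∀ x, (td.bag x).ncard ≤ 2) : G.IsAcyclic := by
  have := td.finι
  obtain ⟨r, hinj, hlow⟩ := td.isTree.2.exists_uniqueLowerNeighbor
  have hex : ∀ v, ∃ t, v ∈ td.bag t ∧ ∀ y, v ∈ td.bag y → r t ≤ r y := by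
    intro v
    obtain ⟨t, ht, hmin⟩ := Set.exists_min_image {x | v ∈ td.bag x} r (Set.toFinite _)
      (td.bag_cover v)
    exact ⟨t, ht, hmin⟩
  choose t ht hmin using hex
  have key : ∀ v u, G.Adj v u → r (t u) ≤ r (t v) → u ∈ td.bag (t v) := by
    intro v u h hle
    obtain ⟨z, hz, hz'⟩ := td.bag_edge h
    exact hlow.mem_of_connected hinj (td.bag_conn v) (td.bag_conn u) (ht v) (ht u) (hmin v)
      (hmin u) hle _ z hz hz' rfl
  refine UniqueLowerNeighbor.isAcyclic (r := fun v => r (t v)) ?_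
  intro v u w hu hw' h1 h2
  by_contra hne
  have hsub : ({v, u, w} : Set V) ⊆ td.bag (t v) := by
    rintro a (rfl | rfl | rfl)
    · exact ht _
    · exact key v _ hu h1
    · exact key v _ hw' h2
  have h3 : ({v, u, w} : Set V).ncard = 3 :=
    Set.ncard_eq_three.2 ⟨v, u, w, hu.ne, hw'.ne, hne, rfl⟩
  have := (Set.ncard_le_ncard hsub (Set.toFinite _)).trans (hw (t v))
  omega

/-- A special tree decomposition is a directed one, every edge pointing towards the root. -/
def SpecialTD.toDirSpaghettiTD {V : Type} {G : SimpleGraph V} (td : SpecialTD G) :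
    DirSpaghettiTD G where
  toTreeDecomp := td.toTreeDecomp
  orient x y := td.tree.Adj x y ∧ td.tree.dist y td.root < td.tree.dist x td.root
  orient_iff x y := by
    constructor
    · intro h
      have hne := td.isTree.dist_ne_of_adj td.root h
      rw [dist_comm, dist_comm (v := y)] at hne
      rcases hne.lt_or_gt with hlt | hlt
      · exact Or.inr ⟨h.symm, hlt⟩
      · exact Or.inl ⟨h, hlt⟩
    · rintro (h | h)
      · exact h.1
      · exact h.1.symm
  orient_asymm x y h h' := h.2.asymm h'.2
  bag_dirpath := td.bag_vertical

/-- A directed spaghetti tree decomposition is a spaghetti tree decomposition. -/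
def DirSpaghettiTD.toSpaghettiTD {V : Type} {G : SimpleGraph V} (td : DirSpaghettiTD G) :
    SpaghettiTD G where
  toTreeDecomp := td.toTreeDecomp
  bag_path v := (td.bag_dirpath v).1

/-- The special tree decomposition with a single node. -/
def SpecialTD.single {V : Type} (G : SimpleGraph V) : SpecialTD G where
  ι := Unit
  finι := inferInstance
  tree := ⊥
  isTree := IsTree.of_subsingleton
  bag _ := Set.univ
  bag_cover _ := ⟨(), trivial⟩
  bag_edge _ _ _ := ⟨(), trivial, trivial⟩
  bag_conn _ :=
    have : Nonempty {x : Unit | True} := ⟨⟨(), trivial⟩⟩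
    (IsTree.of_subsingleton (V := {x : Unit | True})).1
  root := ()
  bag_vertical _ :=
    have : Nonempty {x : Unit | True} := ⟨⟨(), trivial⟩⟩
    ⟨⟨(IsTree.of_subsingleton (V := {x : Unit | True})).1, by simp⟩, by simp, by simp⟩

lemma cycGraph_not_adj_zero_two {n : ℕ} (hn : 4 ≤ n) :
    (0 : ZMod n) ≠ 2 ∧ ¬ (cycGraph n).Adj 0 2 := by
  have key : ∀ k : ℕ, 0 < k → k < n → (k : ZMod n) ≠ 0 := fun k h1 h2 h => by
    rw [ZMod.natCast_eq_zero_iff] at h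
    exact absurd (Nat.le_of_dvd h1 h) (by omega)
  have h1 := key 1 (by omega) (by omega)
  have h2 := key 2 (by omega) (by omega)
  have h3 := key 3 (by omega) (by omega)
  push_cast at h1 h2 h3
  refine ⟨h2.symm, ?_⟩
  rw [cycGraph, SimpleGraph.fromRel_adj]
  rintro ⟨-, h | h⟩
  · exact h3 (by linear_combination -h)
  · exact h1 (by linear_combination h)

lemma isStronglyChordal_top (V : Type) : IsStronglyChordal (⊤ : SimpleGraph V) := by
  refine ⟨fun S n hn ⟨e⟩ => ?_, fun n hn _ f hf _ => ?_⟩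
  · obtain ⟨h1, h2⟩ := cycGraph_not_adj_zero_two hn
    refine h2 (e.symm.map_adj_iff.1 ?_)
    exact fun h => h1 (e.symm.injective (Subtype.ext h))
  · refine ⟨0, 3, by decide, le_rfl, by omega, fun h => ?_⟩
    have := hf h
    rw [zero_add, eq_comm, ZMod.natCast_eq_zero_iff] at this
    exact absurd (Nat.le_of_dvd (by norm_num) this) (by omega)

lemma SimpleGraph.IsAcyclic.not_cycle {V : Type} {G : SimpleGraph V} [Finite V]
    (hG : G.IsAcyclic) {n : ℕ} (hn : 3 ≤ n) {f : ZMod n → V} (hf : Function.Injective f)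
    (hadj : ∀ i, G.Adj (f i) (f (i + 1))) : False := by
  obtain ⟨r, -, hlow⟩ := hG.exists_uniqueLowerNeighbor
  have : NeZero n := ⟨by omega⟩
  obtain ⟨i, hi⟩ := Finite.exists_max (fun i => r (f i))
  have h1 := hadj (i - 1)
  rw [sub_add_cancel] at h1
  have h2 := hf (hlow (hadj i) h1.symm (hi _) (hi _))
  have h3 : ((2 : ℕ) : ZMod n) = 0 := by push_cast; linear_combination h2
  rw [ZMod.natCast_eq_zero_iff] at h3
  exact absurd (Nat.le_of_dvd (by norm_num) h3) (by omega)

lemma SimpleGraph.IsAcyclic.isStronglyChordal {V : Type} {G : SimpleGraph V} [Finite V]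
    (hG : G.IsAcyclic) : IsStronglyChordal G := by
  refine ⟨fun S n hn ⟨e⟩ => ?_, fun n hn _ f hf hadj => (hG.not_cycle (by omega) hf hadj).elim⟩
  refine hG.not_cycle (n := n) (f := fun i => (e.symm i : V)) (by omega)
    (Subtype.val_injective.comp e.symm.injective) fun i => ?_
  refine (e.symm.map_adj_iff (v := i) (w := i + 1)).2 ?_
  rw [cycGraph, SimpleGraph.fromRel_adj]
  refine ⟨fun h => ?_, Or.inr rfl⟩
  have h3 : ((1 : ℕ) : ZMod n) = 0 := by push_cast; linear_combination -h
  rw [ZMod.natCast_eq_zero_iff] at h3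
  exact absurd (Nat.le_of_dvd (by norm_num) h3) (by omega)

lemma cycGraph_succ_adj_iff {L : ℕ} (hL : 2 ≤ L) (i j : Fin (L + 1)) :
    (cycGraph (L + 1)).Adj i j ↔ (i : ℕ) + 1 = j ∨ (j : ℕ) + 1 = i ∨
      ((i : ℕ) = 0 ∧ (j : ℕ) = L) ∨ ((j : ℕ) = 0 ∧ (i : ℕ) = L) := by
  have key : ∀ i j : Fin (L + 1), i = j + 1 ↔ (j : ℕ) + 1 = i ∨ ((i : ℕ) = 0 ∧ (j : ℕ) = L) := by
    intro i j
    rw [Fin.ext_iff, Fin.val_add_one]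
    have := j.2
    have := i.2
    split_ifs with h
    · rw [h, Fin.val_last]; omega
    · have : (j : ℕ) ≠ L := fun h' => h (Fin.ext h')
      omega
  refine (SimpleGraph.fromRel_adj (V := Fin (L + 1)) (fun x y => x = y + 1) i j).trans ?_
  have h1 := key i j
  have h2 := key j i
  constructor
  · rintro ⟨-, h | h⟩
    · have := h1.1 h; omega
    · have := h2.1 h; omega
  · intro h
    refine ⟨fun he => ?_, ?_⟩
    · have := congrArg Fin.val he
      omega
    · by_cases h3 : i = j + 1
      · exact Or.inl h3
      · refine Or.inr (h2.2 ?_)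
        have := mt h1.2 h3
        omega

lemma IsChordal.isAcyclic {V : Type} {G : SimpleGraph V} (hG : IsChordal G)
    (hcf : G.CliqueFree 3) : G.IsAcyclic := by
  classical
  rw [isAcyclic_iff_forall_adj_isBridge]
  intro u v huv
  rw [isBridge_iff]
  intro hreach
  set K := G.deleteEdges {s(u, v)} with hK
  have hKadj : ∀ a b, K.Adj a b ↔ G.Adj a b ∧ s(a, b) ≠ s(u, v) := by
    intro a b
    simp [hK]
  obtain ⟨p, hpd⟩ := Reachable.exists_walk_length_eq_dist hreach
  set L := p.length with hL
  have hdist : ∀ i ≤ L, K.dist u (p.getVert i) = i := by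
    intro i hi
    have h1 := dist_le (p.take i)
    have h2 := dist_le (p.drop i)
    have h3 := (p.drop i).reachable.dist_triangle_right u
    rw [Walk.take_length] at h1
    rw [Walk.drop_length] at h2
    omega
  have hL2 : 2 ≤ L := by
    by_contra hcon
    have hne : L ≠ 0 := fun h => huv.ne (Walk.eq_of_length_eq_zero h)
    have h1 : K.Adj u v := p.adj_of_length_eq_one (by omega)
    exact ((hKadj _ _).1 h1).2 rfl
  have hadjK : ∀ i < L, K.Adj (p.getVert i) (p.getVert (i + 1)) :=
    fun i hi => p.adj_getVert_succ hi
  have hinj : ∀ i j, i ≤ L → j ≤ L → p.getVert i = p.getVert j → i = j := by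
    intro i j hi hj h
    rw [← hdist i hi, ← hdist j hj, h]
  have h0 : p.getVert 0 = u := p.getVert_zero
  have hLv : p.getVert L = v := p.getVert_length
  have hadj : ∀ i j, i ≤ L → j ≤ L → (G.Adj (p.getVert i) (p.getVert j) ↔
      i + 1 = j ∨ j + 1 = i ∨ (i = 0 ∧ j = L) ∨ (j = 0 ∧ i = L)) := by
    intro i j hi hj
    constructor
    · intro h
      by_cases he : s(p.getVert i, p.getVert j) = s(u, v)
      · rcases Sym2.eq_iff.1 he with ⟨h1, h2⟩ | ⟨h1, h2⟩
        · have := hinj _ _ hi (Nat.zero_le _) (h1.trans h0.symm)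
          have := hinj _ _ hj le_rfl (h2.trans hLv.symm)
          omega
        · have := hinj _ _ hi le_rfl (h1.trans hLv.symm)
          have := hinj _ _ hj (Nat.zero_le _) (h2.trans h0.symm)
          omega
      · have hk : K.Adj (p.getVert i) (p.getVert j) := (hKadj _ _).2 ⟨h, he⟩
        have hne : i ≠ j := fun h' => hk.ne (by rw [h'])
        have h1 := hk.reachable.dist_triangle_right u
        have h2 := hk.symm.reachable.dist_triangle_right u
        rw [hdist i hi, hdist j hj, dist_eq_one_iff_adj.2 hk] at h1
        rw [hdist i hi, hdist j hj, dist_eq_one_iff_adj.2 hk.symm] at h2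
        omega
    · rintro (rfl | rfl | ⟨rfl, rfl⟩ | ⟨rfl, rfl⟩)
      · exact ((hKadj _ _).1 (hadjK i (by omega))).1
      · exact ((hKadj _ _).1 (hadjK j (by omega))).1.symm
      · rwa [h0, hLv]
      · rw [h0, hLv]; exact huv.symm
  rcases hL2.eq_or_lt with h2 | h3
  · refine hcf {p.getVert 0, p.getVert 1, p.getVert 2} ?_
    rw [is3Clique_triple_iff]
    refine ⟨(hadj _ _ ?_ ?_).2 ?_, (hadj _ _ ?_ ?_).2 ?_, (hadj _ _ ?_ ?_).2 ?_⟩ <;> omega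
  · let f : Fin (L + 1) → V := fun i => p.getVert i
    have hf : Function.Injective f := fun i j h =>
      Fin.ext (hinj _ _ (Nat.lt_succ_iff.1 i.2) (Nat.lt_succ_iff.1 j.2) h)
    refine hG (Set.range f) (L + 1) (by omega) ⟨RelIso.symm ⟨Equiv.ofInjective f hf, ?_⟩⟩
    intro i j
    exact (hadj _ _ (Nat.lt_succ_iff.1 (Fin.is_lt i)) (Nat.lt_succ_iff.1 (Fin.is_lt j))).trans
      (cycGraph_succ_adj_iff hL2 i j).symm

lemma Nat.exists_mem_le_of_sInf_le {p : ℕ → Prop} (hp : ∃ k, p k) {n : ℕ}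
    (h : sInf {k | p k} ≤ n) : ∃ k, p k ∧ k ≤ n :=
  ⟨sInf {k | p k}, Nat.sInf_mem hp, h⟩

/-- TFAE for a finite simple graph `G`: `G` is a forest; `G` has treewidth at most
one; spaghetti treewidth at most one; strongly chordal treewidth at most one;
directed spaghetti treewidth at most one; special treewidth at most one. -/
theorem statement6 {V : Type} [Fintype V] (G : SimpleGraph V) :
    List.TFAE
      [G.IsAcyclic, treewidth G ≤ 1, sptw G ≤ 1, sctw G ≤ 1, dptw G ≤ 1, spctw G ≤ 1] := by
  have hs : ∀ x, ((SpecialTD.single G).bag x).ncard ≤ Nat.card V + 1 :=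
    fun x => (Set.ncard_le_card _).trans (Nat.le_succ _)
  tfae_have 1 → 6 := fun h => Nat.sInf_le h.exists_specialTD
  tfae_have 6 → 5 := fun h => by
    obtain ⟨k, ⟨td, htd⟩, hk⟩ := Nat.exists_mem_le_of_sInf_le
      ⟨_, SpecialTD.single G, hs⟩ h
    exact le_trans (b := k) (Nat.sInf_le ⟨td.toDirSpaghettiTD, htd⟩) hk
  tfae_have 5 → 3 := fun h => by
    obtain ⟨k, ⟨td, htd⟩, hk⟩ := Nat.exists_mem_le_of_sInf_le
      ⟨_, (SpecialTD.single G).toDirSpaghettiTD, hs⟩ h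
    exact le_trans (b := k) (Nat.sInf_le ⟨td.toSpaghettiTD, htd⟩) hk
  tfae_have 3 → 2 := fun h => by
    obtain ⟨k, ⟨td, htd⟩, hk⟩ := Nat.exists_mem_le_of_sInf_le
      ⟨_, (SpecialTD.single G).toDirSpaghettiTD.toSpaghettiTD, hs⟩ h
    exact le_trans (b := k) (Nat.sInf_le ⟨td.toTreeDecomp, htd⟩) hk
  tfae_have 2 → 1 := fun h => by
    obtain ⟨k, ⟨td, htd⟩, hk⟩ := Nat.exists_mem_le_of_sInf_le
      ⟨_, (SpecialTD.single G).toTreeDecomp, hs⟩ h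
    exact td.isAcyclic fun x => (htd x).trans (by omega)
  tfae_have 1 → 4 := fun h => Nat.sInf_le ⟨G, le_rfl, h.isStronglyChordal, h.cliqueFree le_rfl⟩
  tfae_have 4 → 1 := fun h => by
    obtain ⟨k, ⟨H, hle, hH, hcf⟩, hk⟩ := Nat.exists_mem_le_of_sInf_le
      ⟨Fintype.card V, ⊤, le_top, isStronglyChordal_top V,
        cliqueFree_of_card_lt (by omega)⟩ h
    exact (hH.1.isAcyclic (hcf.mono (by omega))).anti hle
  tfae_finish
end

section
/- Let G be a 2-connected finite simple graph. Then G has strongly chordal treewidth equal to two if and only if the cell completion G̃ of G is a tree of two-boundaried cycles. -/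
open SimpleGraph

lemma cycGraph_adj_natCast {n a b : ℕ} (hab : a < b) (hb : b < n) :
    (a : ZMod n) ≠ (b : ZMod n) ∧
      ((cycGraph n).Adj (a : ZMod n) (b : ZMod n) ↔ b = a + 1 ∨ (a = 0 ∧ b + 1 = n)) := by
  have key : ∀ x y : ℕ, ((x : ZMod n) = (y : ZMod n)) ↔ x % n = y % n := fun x y =>
    ZMod.natCast_eq_natCast_iff' x y n
  have ha : a % n = a := Nat.mod_eq_of_lt (by omega)
  have hb' : b % n = b := Nat.mod_eq_of_lt hb
  have ha1 : (a + 1) % n = a + 1 := Nat.mod_eq_of_lt (by omega)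
  have hne : (a : ZMod n) ≠ (b : ZMod n) := by
    rw [Ne, key, ha, hb']; omega
  refine ⟨hne, ?_⟩
  have h1 : ((a : ZMod n) = (b : ZMod n) + 1) ↔ (a = 0 ∧ b + 1 = n) := by
    have : ((b : ZMod n) + 1) = ((b + 1 : ℕ) : ZMod n) := by push_cast; ring
    rw [this, key, ha]
    rcases eq_or_lt_of_le (Nat.succ_le_of_lt hb) with h | h
    · have : b + 1 = n := h
      rw [this, Nat.mod_self]; omega
    · rw [Nat.mod_eq_of_lt (show b + 1 < n from h)]; omega
  have h2 : ((b : ZMod n) = (a : ZMod n) + 1) ↔ b = a + 1 := by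
    have : ((a : ZMod n) + 1) = ((a + 1 : ℕ) : ZMod n) := by push_cast; ring
    rw [this, key, hb', ha1]
  rw [cycGraph, SimpleGraph.fromRel_adj, h1, h2]
  tauto

/-- The vertices `c 0, …, c (n - 1)` form, in this order, a chordless cycle of length `n`. -/
def CycSeq {V : Type} (T : SimpleGraph V) (n : ℕ) (c : ℕ → V) : Prop :=
  3 ≤ n ∧ ∀ i j, i < j → j < n →
    c i ≠ c j ∧ (T.Adj (c i) (c j) ↔ j = i + 1 ∨ (i = 0 ∧ j + 1 = n))

lemma CycSeq.injOn {V : Type} {T : SimpleGraph V} {n : ℕ} {c : ℕ → V} (h : CycSeq T n c)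
    {i j : ℕ} (hi : i < n) (hj : j < n) (hij : c i = c j) : i = j := by
  rcases lt_trichotomy i j with h1 | h1 | h1
  · exact absurd hij (h.2 i j h1 hj).1
  · exact h1
  · exact absurd hij.symm (h.2 j i h1 hi).1

lemma CycSeq.adj_succ {V : Type} {T : SimpleGraph V} {n : ℕ} {c : ℕ → V} (h : CycSeq T n c)
    {i : ℕ} (hi : i + 1 < n) : T.Adj (c i) (c (i + 1)) :=
  ((h.2 i (i + 1) (by omega) hi).2).2 (Or.inl rfl)

lemma CycSeq.adj_last {V : Type} {T : SimpleGraph V} {n : ℕ} {c : ℕ → V} (h : CycSeq T n c) :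
    T.Adj (c 0) (c (n - 1)) := by
  have := h.1
  exact ((h.2 0 (n - 1) (by omega) (by omega)).2).2 (Or.inr ⟨rfl, by omega⟩)

lemma CycSeq.nonempty_iso {V : Type} {T : SimpleGraph V} {n : ℕ} {c : ℕ → V} (h : CycSeq T n c) :
    Nonempty ((T.induce (c '' {i | i < n})) ≃g cycGraph n) := by
  have hn := h.1
  have : NeZero n := ⟨by omega⟩
  let f : ZMod n → (c '' {i | i < n} : Set V) := fun i => ⟨c i.val, i.val, ZMod.val_lt i, rfl⟩
  have hf : Function.Bijective f := by
    constructor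
    · intro i j hij
      exact ZMod.val_injective n (h.injOn (ZMod.val_lt i) (ZMod.val_lt j) (congrArg Subtype.val hij))
    · rintro ⟨x, i, hi, rfl⟩
      refine ⟨(i : ZMod n), Subtype.ext ?_⟩
      change c (ZMod.val (i : ZMod n)) = c i
      rw [ZMod.val_cast_of_lt hi]
  refine ⟨RelIso.symm ⟨Equiv.ofBijective f hf, ?_⟩⟩
  intro i j
  change T.Adj (c i.val) (c j.val) ↔ _
  have cast : ∀ k : ZMod n, ((k.val : ℕ) : ZMod n) = k := fun k => ZMod.natCast_zmod_val k
  rcases lt_trichotomy i.val j.val with h1 | h1 | h1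
  · rw [(h.2 _ _ h1 (ZMod.val_lt j)).2, ← (cycGraph_adj_natCast h1 (ZMod.val_lt j)).2, cast, cast]
  · have := ZMod.val_injective n h1
    subst this; simp
  · rw [SimpleGraph.adj_comm, (cycGraph n).adj_comm,
      (h.2 _ _ h1 (ZMod.val_lt i)).2, ← (cycGraph_adj_natCast h1 (ZMod.val_lt i)).2, cast, cast]

/-- The cycle graph on `ZMod n` has an automorphism carrying a given edge to the edge `{0, n - 1}`. -/
lemma cycGraph_exists_iso {n : ℕ} {i j : ZMod n} (hij : (cycGraph n).Adj i j) :
    ∃ e : cycGraph n ≃g cycGraph n, e 0 = i ∧ e (-1) = j := by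
  rw [cycGraph, SimpleGraph.fromRel_adj] at hij
  obtain ⟨hne, h | h⟩ := hij
  · refine ⟨⟨Equiv.addLeft i, ?_⟩, ?_, ?_⟩
    · intro a b
      simp [cycGraph, SimpleGraph.fromRel_adj, add_assoc]
    · change i + 0 = i; simp
    · change i + -1 = j; rw [h]; ring
  · refine ⟨⟨Equiv.subLeft i, ?_⟩, ?_, ?_⟩
    · intro a b
      have e1 : (i - a = i - b + 1) ↔ b = a + 1 := by
        constructor <;> intro hh
        · linear_combination hh
        · rw [hh]; ring
      have e2 : (i - b = i - a + 1) ↔ a = b + 1 := by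
        constructor <;> intro hh
        · linear_combination hh
        · rw [hh]; ring
      simp only [cycGraph, SimpleGraph.fromRel_adj, Equiv.subLeft_apply, e1, e2, ne_eq,
        sub_right_inj]
      tauto
    · change i - 0 = i; simp
    · change i - -1 = j; rw [h]; ring

lemma cycSeq_of_iso {V : Type} {T : SimpleGraph V} {S : Set V} {n : ℕ} (hn : 3 ≤ n)
    (e : (T.induce S) ≃g cycGraph n) :
    CycSeq T n (fun i => (e.symm (i : ZMod n)).1) ∧
      S = (fun i : ℕ => (e.symm (i : ZMod n)).1) '' {i | i < n} := by
  have : NeZero n := ⟨by omega⟩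
  refine ⟨⟨hn, fun i j hij hj => ?_⟩, ?_⟩
  · obtain ⟨h1, h2⟩ := cycGraph_adj_natCast hij hj
    refine ⟨fun h => h1 (e.symm.injective (Subtype.ext h)), ?_⟩
    rw [← h2, ← e.symm.map_adj_iff]; rfl
  · ext x
    constructor
    · intro hx
      refine ⟨(e ⟨x, hx⟩).val, ZMod.val_lt _, ?_⟩
      simp
    · rintro ⟨i, -, rfl⟩
      exact (e.symm _).2

lemma isChordlessCycle_iff {V : Type} {T : SimpleGraph V} {S : Set V} :
    IsChordlessCycle T S ↔ ∃ n c, CycSeq T n c ∧ S = c '' {i | i < n} := by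
  constructor
  · rintro ⟨n, hn, ⟨e⟩⟩
    exact ⟨n, _, cycSeq_of_iso hn e⟩
  · rintro ⟨n, c, hc, rfl⟩
    exact ⟨n, hc.1, hc.nonempty_iso⟩

lemma exists_cycSeq_of_iso {V : Type} {T : SimpleGraph V} {S : Set V} {n : ℕ} (hn : 3 ≤ n)
    (e : (T.induce S) ≃g cycGraph n) {u v : V}
    (hu : u ∈ S) (hv : v ∈ S) (huv : T.Adj u v) :
    ∃ c, CycSeq T n c ∧ S = c '' {i | i < n} ∧ c 0 = u ∧ c (n - 1) = v := by
  have hadj : (cycGraph n).Adj (e ⟨u, hu⟩) (e ⟨v, hv⟩) := by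
    rw [e.map_adj_iff]; exact huv
  obtain ⟨g, h0, h1⟩ := cycGraph_exists_iso hadj
  obtain ⟨h2, h3⟩ := cycSeq_of_iso hn (e.trans g.symm)
  refine ⟨_, h2, h3, ?_, ?_⟩
  · change (e.symm (g ((0 : ℕ) : ZMod n))).1 = u
    simp [h0]
  · change (e.symm (g ((n - 1 : ℕ) : ZMod n))).1 = v
    have : ((n - 1 : ℕ) : ZMod n) = -1 := by
      rw [Nat.cast_sub (by omega)]; simp
    rw [this, h1]; simp

lemma IsChordlessCycle.exists_cycSeq {V : Type} {T : SimpleGraph V} {S : Set V}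
    (hS : IsChordlessCycle T S) {u v : V} (hu : u ∈ S) (hv : v ∈ S) (huv : T.Adj u v) :
    ∃ n c, CycSeq T n c ∧ S = c '' {i | i < n} ∧ c 0 = u ∧ c (n - 1) = v := by
  obtain ⟨n, hn, ⟨e⟩⟩ := hS
  exact ⟨n, exists_cycSeq_of_iso hn e hu hv huv⟩

lemma isChordal_iff {V : Type} {H : SimpleGraph V} :
    IsChordal H ↔ ∀ n c, 4 ≤ n → ¬ CycSeq H n c := by
  constructor
  · intro h n c hn hc
    exact h _ n hn hc.nonempty_iso
  · rintro h S n hn ⟨e⟩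
    exact h n _ hn (cycSeq_of_iso (by omega) e).1

/-- The induced subgraph `G[S]` is connected, phrased via sets closed under adjacency. -/
def ConnOn {V : Type} (G : SimpleGraph V) (S : Set V) : Prop :=
  S.Nonempty ∧ ∀ A : Set V, (∀ x ∈ S, ∀ y ∈ S, G.Adj x y → x ∈ A → y ∈ A) →
    ∀ x ∈ S, ∀ y ∈ S, x ∈ A → y ∈ A

lemma connOn_iff {V : Type} {G : SimpleGraph V} {S : Set V} :
    (G.induce S).Connected ↔ ConnOn G S := by
  constructor
  · intro h
    refine ⟨Set.nonempty_coe_sort.1 h.nonempty, fun A hA x hx y hy hxA => ?_⟩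
    obtain ⟨p⟩ := h.preconnected ⟨x, hx⟩ ⟨y, hy⟩
    have : ∀ (u v : S), (G.induce S).Walk u v → u.1 ∈ A → v.1 ∈ A := by
      intro u v p
      induction p with
      | nil => exact id
      | @cons u v w hadj _ ih => exact fun hu => ih (hA _ u.2 _ v.2 hadj hu)
    exact this _ _ p hxA
  · rintro ⟨hne, h⟩
    rw [SimpleGraph.connected_iff]
    refine ⟨fun x y => ?_, hne.to_subtype⟩
    have := h {z | ∃ hz : z ∈ S, (G.induce S).Reachable x ⟨z, hz⟩} ?_ x.1 x.2 y.1 y.2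
      ⟨x.2, SimpleGraph.Reachable.refl _⟩
    · obtain ⟨_, h'⟩ := this; exact h'
    · rintro a ha b hb hab ⟨_, h1⟩
      exact ⟨hb, h1.trans (SimpleGraph.Adj.reachable (show (G.induce S).Adj ⟨a, ha⟩ ⟨b, hb⟩ from hab))⟩

/-- `q 0, …, q m` is a walk inside `D` from a neighbour of `u` to a neighbour of `v`. -/
def LinksVia {V : Type} (H : SimpleGraph V) (u v : V) (D : Set V) (m : ℕ) (q : ℕ → V) : Prop :=
  (∀ i, i ≤ m → q i ∈ D) ∧ H.Adj u (q 0) ∧ H.Adj v (q m) ∧ ∀ i, i < m → H.Adj (q i) (q (i + 1))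

lemma ConnOn.exists_linksVia {V : Type} {H : SimpleGraph V} {u v : V} {D : Set V}
    (hD : ConnOn H D) (hu : ∃ x ∈ D, H.Adj u x) (hv : ∃ x ∈ D, H.Adj v x) :
    ∃ m q, LinksVia H u v D m q := by
  obtain ⟨x, hx, hux⟩ := hu
  obtain ⟨y, hy, hvy⟩ := hv
  have := hD.2 {z | ∃ (m : ℕ) (q : ℕ → V), (∀ i, i ≤ m → q i ∈ D) ∧ H.Adj u (q 0) ∧ q m = z ∧
    ∀ i, i < m → H.Adj (q i) (q (i + 1))} ?_ x hx y hy
    ⟨0, fun _ => x, fun _ _ => hx, hux, rfl, fun i hi => absurd hi (by omega)⟩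
  · obtain ⟨m, q, h1, h2, h3, h4⟩ := this
    exact ⟨m, q, h1, h2, h3 ▸ hvy, h4⟩
  · rintro a ha b hb hab ⟨m, q, h1, h2, h3, h4⟩
    refine ⟨m + 1, fun i => if i ≤ m then q i else b, fun i _ => ?_, ?_, ?_, fun i hi => ?_⟩
    · by_cases h : i ≤ m <;> simp only [h, if_true, if_false]
      · exact h1 i h
      · exact hb
    · simpa using h2
    · simp
    · by_cases h : i + 1 ≤ m
      · simpa only [show i ≤ m by omega, h, if_true] using h4 i (by omega)
      · have : i = m := by omega
        subst this
        simpa [h3] using hab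

/-- In a chordal graph, the ends of an edge that are both attached to a connected set `D`
avoiding them have a common neighbour in `D`. -/
lemma IsChordal.exists_common_neighbor {V : Type} {H : SimpleGraph V} (hH : IsChordal H)
    {u v : V} {D : Set V} (huv : H.Adj u v) (hD : ConnOn H D) (huD : u ∉ D) (hvD : v ∉ D)
    (hu : ∃ x ∈ D, H.Adj u x) (hv : ∃ x ∈ D, H.Adj v x) :
    ∃ x ∈ D, H.Adj u x ∧ H.Adj v x := by
  classical
  have hex := hD.exists_linksVia hu hv
  obtain ⟨m, ⟨q, h1, h2, h3, h4⟩, hmin⟩ : ∃ m, (∃ q, LinksVia H u v D m q) ∧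
      ∀ k < m, ∀ r, ¬ LinksVia H u v D k r :=
    ⟨Nat.find hex, Nat.find_spec hex, fun k hk r hr => Nat.find_min hex hk ⟨r, hr⟩⟩
  rcases Nat.eq_zero_or_pos m with hm | hm
  · exact ⟨q 0, h1 0 (by omega), h2, by rw [hm] at h3; exact h3⟩
  exfalso
  have hu' : ∀ i, i ≤ m → H.Adj (q i) u → i = 0 := by
    intro i hi hadj
    by_contra h0
    refine hmin (m - i) (by omega) (fun t => q (t + i))
      ⟨fun t ht => h1 _ (by omega), by simpa using hadj.symm, ?_, fun t ht => ?_⟩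
    · simpa [Nat.sub_add_cancel hi] using h3
    · have := h4 (t + i) (by omega)
      rwa [show t + i + 1 = t + 1 + i by ring] at this
  have hv' : ∀ i, i ≤ m → H.Adj (q i) v → i = m := by
    intro i hi hadj
    by_contra h0
    exact hmin i (by omega) q
      ⟨fun t ht => h1 _ (by omega), h2, hadj.symm, fun t ht => h4 t (by omega)⟩
  have hadj' : ∀ i j, i < j → j ≤ m → H.Adj (q i) (q j) → j = i + 1 := by
    intro i j hij hj hadj
    by_contra h0
    refine hmin (m - (j - i - 1)) (by omega)
      (fun t => if t ≤ i then q t else q (t + (j - i - 1)))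
      ⟨fun t ht => ?_, by simpa using h2, ?_, fun t ht => ?_⟩
    · dsimp only; split_ifs <;> exact h1 _ (by omega)
    · dsimp only
      rw [if_neg (by omega), Nat.sub_add_cancel (by omega)]; exact h3
    · dsimp only
      rcases lt_trichotomy t i with h | h | h
      · rw [if_pos (by omega), if_pos (by omega)]; exact h4 t (by omega)
      · subst h
        rw [if_pos le_rfl, if_neg (by omega), show t + 1 + (j - t - 1) = j by omega]; exact hadj
      · rw [if_neg (by omega), if_neg (by omega),
          show t + 1 + (j - i - 1) = t + (j - i - 1) + 1 by omega]
        exact h4 _ (by omega)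
  have hne : ∀ i j, i < j → j ≤ m → q i ≠ q j := by
    intro i j hij hj heq
    refine hmin (m - (j - i)) (by omega)
      (fun t => if t ≤ i then q t else q (t + (j - i)))
      ⟨fun t ht => ?_, by simpa using h2, ?_, fun t ht => ?_⟩
    · dsimp only; split_ifs <;> exact h1 _ (by omega)
    · dsimp only
      by_cases h : m - (j - i) ≤ i
      · rw [if_pos h, show m - (j - i) = i by omega, heq, show j = m by omega]; exact h3
      · rw [if_neg h, Nat.sub_add_cancel (by omega)]; exact h3
    · dsimp only
      rcases lt_trichotomy t i with h | h | h
      · rw [if_pos (by omega), if_pos (by omega)]; exact h4 t (by omega)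
      · subst h
        rw [if_pos le_rfl, if_neg (by omega), show t + 1 + (j - t) = j + 1 by omega, heq]
        exact h4 _ (by omega)
      · rw [if_neg (by omega), if_neg (by omega),
          show t + 1 + (j - i) = t + (j - i) + 1 by omega]
        exact h4 _ (by omega)
  refine isChordal_iff.1 hH (m + 3) (fun i => if i ≤ m then q i else if i = m + 1 then v else u)
    (by omega) ⟨by omega, fun i j hij hj => ?_⟩
  have hquv : ∀ i, i ≤ m → q i ≠ u ∧ q i ≠ v := fun i hi =>
    ⟨fun h => huD (h ▸ h1 i hi), fun h => hvD (h ▸ h1 i hi)⟩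
  by_cases hjm : j ≤ m
  · simp only [hjm, show i ≤ m by omega, if_true]
    refine ⟨hne i j hij hjm, fun h => Or.inl (hadj' i j hij hjm h), fun h => ?_⟩
    rcases h with rfl | h
    · exact h4 i (by omega)
    · omega
  by_cases hjv : j = m + 1
  · subst hjv
    simp only [show i ≤ m by omega, if_true, show ¬ (m + 1 ≤ m) by omega, if_false]
    refine ⟨(hquv i (by omega)).2, fun h => Or.inl (by rw [hv' i (by omega) h]), fun h => ?_⟩
    rcases h with h | h
    · obtain rfl : i = m := by omega
      exact h3.symm
    · omega
  obtain rfl : j = m + 2 := by omega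
  by_cases hiv : i = m + 1
  · subst hiv
    simp [huv.symm, huv.ne.symm]
  · have him : i ≤ m := by omega
    simp only [him, if_true, show ¬ (m + 2 ≤ m) by omega, if_false,
      show ¬ (m + 2 = m + 1) by omega]
    refine ⟨(hquv i (by omega)).1, fun h => Or.inr ⟨hu' i (by omega) h, trivial⟩, fun h => ?_⟩
    rcases h with h | h
    · omega
    · rw [h.1]; exact h2.symm

lemma ConnOn.insert {V : Type} {H : SimpleGraph V} {A : Set V} (hA : ConnOn H A) {c : V}
    (hc : ∃ x ∈ A, H.Adj c x) : ConnOn H (insert c A) := by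
  obtain ⟨x, hx, hcx⟩ := hc
  refine ⟨⟨c, Set.mem_insert _ _⟩, fun B hB => ?_⟩
  have hB' := hA.2 B fun y hy z hz => hB y (Or.inr hy) z (Or.inr hz)
  have h1 : c ∈ B → x ∈ B := hB c (Or.inl rfl) x (Or.inr hx) hcx
  have h2 : x ∈ B → c ∈ B := hB x (Or.inr hx) c (Or.inl rfl) hcx.symm
  rintro y (rfl | hy) z (rfl | hz) hyB
  · exact hyB
  · exact hB' x hx z hz (h1 hyB)
  · exact h2 (hB' y hy x hx hyB)
  · exact hB' y hy z hz hyB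

lemma connOn_singleton {V : Type} (H : SimpleGraph V) (x : V) : ConnOn H {x} :=
  ⟨⟨x, rfl⟩, by rintro A - y rfl z rfl h; exact h⟩

/-- Dirac's theorem: every nonempty induced subgraph of a chordal graph has a simplicial vertex. -/
lemma IsChordal.exists_simplicial {V : Type} [Finite V] {H : SimpleGraph V} (hH : IsChordal H) :
    ∀ (k : ℕ) (B : Set V), B.ncard = k → B.Nonempty →
      ∃ p ∈ B, ∀ x ∈ B, ∀ y ∈ B, H.Adj p x → H.Adj p y → x ≠ y → H.Adj x y := by
  intro k
  induction k using Nat.strong_induction_on with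
  | _ k ih =>
  intro B hk hB
  by_cases hcomp : ∀ x ∈ B, ∀ z ∈ B, x ≠ z → H.Adj x z
  · obtain ⟨p, hp⟩ := hB
    exact ⟨p, hp, fun x hx y hy _ _ hxy => hcomp x hx y hy hxy⟩
  push Not at hcomp
  obtain ⟨x, hx, z, hz, hxz, hnadj⟩ := hcomp
  let P : Set V → Prop := fun A => A ⊆ B ∧ ConnOn H A ∧ ∃ b ∈ B, b ∉ A ∧ ∀ a ∈ A, ¬ H.Adj b a
  have hP : P {x} := by
    refine ⟨by simpa using hx, connOn_singleton H x, z, hz, fun h => hxz h.symm, ?_⟩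
    rintro a rfl h
    exact hnadj h.symm
  obtain ⟨A, hAP, hAmax⟩ := (Set.toFinite {A | P A}).exists_maximal ⟨_, hP⟩
  obtain ⟨hAB, hAconn, b, hb, hbA, hbadj⟩ := hAP
  let B' : Set V := {b | b ∈ B ∧ b ∉ A ∧ ∀ a ∈ A, ¬ H.Adj b a}
  have hB'lt : B'.ncard < k := by
    rw [← hk]
    refine Set.ncard_lt_ncard ⟨fun y hy => hy.1, fun h => ?_⟩ (Set.toFinite _)
    obtain ⟨a, ha⟩ := hAconn.1
    exact (h (hAB ha)).2.1 ha
  obtain ⟨p, hp, hsimp⟩ := ih _ hB'lt B' rfl ⟨b, hb, hbA, hbadj⟩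
  have hCB : ∀ c ∈ B, c ∉ A → (∃ a ∈ A, H.Adj c a) → ∀ y ∈ B', H.Adj c y := by
    intro c hc hcA hca y hy
    by_contra hcy
    have : P (insert c A) := by
      refine ⟨Set.insert_subset hc hAB, hAconn.insert hca, y, hy.1, ?_, ?_⟩
      · rintro (rfl | h)
        · obtain ⟨a, ha, hya⟩ := hca
          exact hy.2.2 a ha hya
        · exact hy.2.1 h
      · rintro a (rfl | ha) hya
        · exact hcy hya.symm
        · exact hy.2.2 a ha hya
    exact hcA (hAmax this (Set.subset_insert c A) (Set.mem_insert c A))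
  have hCC : ∀ c ∈ B, c ∉ A → (∃ a ∈ A, H.Adj c a) → ∀ d ∈ B, d ∉ A → (∃ a ∈ A, H.Adj d a) →
      c ≠ d → H.Adj c d := by
    intro c hc hcA hca d hd hdA hda hcd
    by_contra hncd
    have hcp := hCB c hc hcA hca p hp
    have hdp := hCB d hd hdA hda p hp
    obtain ⟨w, hw, hcw, hpw⟩ := hH.exists_common_neighbor hcp (hAconn.insert hda)
      (by rintro (h | h); exacts [hcd h, hcA h])
      (by rintro (h | h); exacts [hdp.ne h.symm, hp.2.1 h])
      (by obtain ⟨a, ha, h⟩ := hca; exact ⟨a, Or.inr ha, h⟩) ⟨d, Or.inl rfl, hdp.symm⟩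
    rcases hw with rfl | hw
    · exact hncd hcw
    · exact hp.2.2 w hw hpw
  refine ⟨p, hp.1, fun y hy z hz hpy hpz hyz => ?_⟩
  have hnA : ∀ y, H.Adj p y → y ∉ A := fun y h hyA => hp.2.2 y hyA h
  by_cases h1 : ∃ a ∈ A, H.Adj y a <;> by_cases h2 : ∃ a ∈ A, H.Adj z a
  · exact hCC y hy (hnA y hpy) h1 z hz (hnA z hpz) h2 hyz
  · push Not at h2
    exact hCB y hy (hnA y hpy) h1 z ⟨hz, hnA z hpz, h2⟩
  · push Not at h1
    exact (hCB z hz (hnA z hpz) h2 y ⟨hy, hnA y hpy, h1⟩).symm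
  · push Not at h1 h2
    exact hsimp y ⟨hy, hnA y hpy, h1⟩ z ⟨hz, hnA z hpz, h2⟩ hpy hpz hyz

lemma cliqueFree_four_iff {V : Type} {H : SimpleGraph V} :
    H.CliqueFree 4 ↔ ∀ a b c d, H.Adj a b → H.Adj a c → H.Adj a d → H.Adj b c → H.Adj b d →
      H.Adj c d → False := by
  classical
  constructor
  · intro h a b c d hab hac had hbc hbd hcd
    refine h {a, b, c, d} ⟨?_, ?_⟩
    · simp [SimpleGraph.isClique_iff, Set.pairwise_insert, hab, hac, had, hbc, hbd, hcd,
        hab.symm, hac.symm, had.symm, hbc.symm, hbd.symm, hcd.symm]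
    · simp [hab.ne, hac.ne, had.ne, hbc.ne, hbd.ne, hcd.ne]
  · intro h s hs
    obtain ⟨a, t, hat, rfl, ht⟩ := Finset.card_eq_succ.1 hs.2
    obtain ⟨b, c, d, hbc, hbd, hcd, rfl⟩ := Finset.card_eq_three.1 ht
    simp only [Finset.mem_insert, Finset.mem_singleton, not_or] at hat
    have hc := hs.1
    exact h a b c d (hc (by simp) (by simp) hat.1) (hc (by simp) (by simp) hat.2.1)
      (hc (by simp) (by simp) hat.2.2) (hc (by simp) (by simp) hbc) (hc (by simp) (by simp) hbd)
      (hc (by simp) (by simp) hcd)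

/-- A 2-connected subgraph of a chordal graph without `K₄` has a vertex `p` whose neighbours,
in both graphs, are exactly two adjacent vertices `a` and `b`. -/
lemma exists_ear_vertex {V : Type} [Finite V] {G H : SimpleGraph V} (hGH : G ≤ H)
    (hcard : 3 ≤ Nat.card V) (hG : ∀ v, ConnOn G {x | x ≠ v}) (hH : IsChordal H)
    (hK : H.CliqueFree 4) :
    ∃ p a b, a ≠ b ∧ G.Adj p a ∧ G.Adj p b ∧ H.Adj a b ∧ ∀ x, H.Adj p x → x = a ∨ x = b := by
  have : Nonempty V := (Nat.card_pos_iff.1 (by omega)).1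
  obtain ⟨p, -, hp⟩ := hH.exists_simplicial _ Set.univ rfl Set.univ_nonempty
  have key : ∀ v, v ≠ p → ∃ a, a ≠ v ∧ G.Adj p a := by
    intro v hv
    by_contra hcon
    push Not at hcon
    obtain ⟨w, hw1, hw2⟩ : ∃ w, w ≠ v ∧ w ≠ p := by
      by_contra hall
      push Not at hall
      have : (Set.univ : Set V) ⊆ {v, p} := fun w _ => by
        by_cases h : w = v
        · exact Or.inl h
        · exact Or.inr (hall w h)
      have h2 := Set.ncard_le_ncard this (Set.toFinite _)
      rw [Set.ncard_univ, Set.ncard_pair hv] at h2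
      omega
    refine hw2 ((hG v).2 {p} ?_ p hv.symm w hw1 rfl)
    rintro x - y hy hxy rfl
    exact absurd hxy (hcon y hy)
  obtain ⟨v, hv⟩ : ∃ v, v ≠ p := by
    have : Nontrivial V := by
      rw [← Finite.one_lt_card_iff_nontrivial]; omega
    exact exists_ne p
  obtain ⟨a, -, ha⟩ := key v hv
  obtain ⟨b, hba, hb⟩ := key a ha.ne.symm
  have hadj : ∀ x y, H.Adj p x → H.Adj p y → x ≠ y → H.Adj x y := fun x y =>
    hp x trivial y trivial
  refine ⟨p, a, b, hba.symm, ha, hb, hadj a b (hGH ha) (hGH hb) hba.symm, fun x hx => ?_⟩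
  by_contra hcon
  push Not at hcon
  exact cliqueFree_four_iff.1 hK p a b x (hGH ha) (hGH hb) hx
    (hadj a b (hGH ha) (hGH hb) hba.symm) (hadj a x (hGH ha) hx hcon.1.symm)
    (hadj b x (hGH hb) hx hcon.2.symm)

/-- Every triangle of `H` has a side with no common neighbour besides the third vertex. -/
def SunFree {V : Type} (H : SimpleGraph V) : Prop :=
  ∀ x y z u₁ u₂ u₃, H.Adj x y → H.Adj y z → H.Adj x z → H.Adj u₁ x → H.Adj u₁ y →
    H.Adj u₂ y → H.Adj u₂ z → H.Adj u₃ x → H.Adj u₃ z → u₁ ≠ z → u₂ ≠ x → u₃ ≠ y → False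

lemma IsStronglyChordal.sunFree {V : Type} {H : SimpleGraph V} (hH : IsStronglyChordal H)
    (hK : H.CliqueFree 4) : SunFree H := by
  rw [cliqueFree_four_iff] at hK
  intro x y z u₁ u₂ u₃ hxy hyz hxz h1x h1y h2y h2z h3x h3z n1 n2 n3
  have n12 : u₁ ≠ u₂ := by
    rintro rfl; exact hK x y z u₁ hxy hxz h1x.symm hyz h1y.symm h2z.symm
  have n13 : u₁ ≠ u₃ := by
    rintro rfl; exact hK x y z u₁ hxy hxz h1x.symm hyz h1y.symm h3z.symm
  have n23 : u₂ ≠ u₃ := by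
    rintro rfl; exact hK x y z u₂ hxy hxz h3x.symm hyz h2y.symm h3z.symm
  let f : Fin 6 → V := ![x, u₁, y, u₂, z, u₃]
  have hf : Function.Injective f := by
    have e1 := hxy.ne; have e2 := hyz.ne; have e3 := hxz.ne
    have e4 := h1x.ne; have e5 := h1y.ne; have e6 := h2y.ne; have e7 := h2z.ne
    have e8 := h3x.ne; have e9 := h3z.ne
    intro i j hij
    fin_cases i <;> fin_cases j <;> simp [f] at hij ⊢ <;> simp_all
  obtain ⟨i, d, hd, hd3, hd6, hadj⟩ := hH.2 6 le_rfl (by decide) f hf (by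
    intro i
    change Fin 6 at i
    fin_cases i
    · exact h1x.symm
    · exact h1y
    · exact h2y.symm
    · exact h2z
    · exact h3z.symm
    · exact h3x)
  obtain rfl : d = 3 := by omega
  change Fin 6 at i
  have k1 : ¬ H.Adj x u₂ := fun h => hK x y z u₂ hxy hxz h hyz h2y.symm h2z.symm
  have k2 : ¬ H.Adj u₁ z := fun h => hK x y z u₁ hxy hxz h1x.symm hyz h1y.symm h.symm
  have k3 : ¬ H.Adj y u₃ := fun h => hK x y z u₃ hxy hxz h3x.symm hyz h h3z.symm
  fin_cases i
  · exact k1 hadj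
  · exact k2 hadj
  · exact k3 hadj
  · exact k1 hadj.symm
  · exact k2 hadj.symm
  · exact k3 hadj.symm

lemma connOn_image_Ioo {V : Type} {H : SimpleGraph V} {n : ℕ} {c : ℕ → V}
    (hadj : ∀ i, i + 1 < n → H.Adj (c i) (c (i + 1))) {l r : ℕ} (hlr : l + 2 ≤ r) (hr : r < n) :
    ConnOn H (c '' {i | l < i ∧ i < r}) := by
  refine ⟨⟨c (l + 1), l + 1, ⟨by omega, by omega⟩, rfl⟩, fun A hA => ?_⟩
  have key : ∀ k, l + 1 + k < r → (c (l + 1 + k) ∈ A ↔ c (l + 1) ∈ A) := by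
    intro k
    induction k with
    | zero => simp
    | succ k ih =>
      intro hk
      rw [← ih (by omega)]
      have h1 : c (l + 1 + k) ∈ c '' {i | l < i ∧ i < r} := ⟨_, ⟨by omega, by omega⟩, rfl⟩
      have h2 : c (l + 1 + (k + 1)) ∈ c '' {i | l < i ∧ i < r} := ⟨_, ⟨by omega, by omega⟩, rfl⟩
      have h3 := hadj (l + 1 + k) (by omega)
      exact ⟨hA _ h2 _ h1 h3.symm, hA _ h1 _ h2 h3⟩
  rintro _ ⟨i, ⟨hi, hi'⟩, rfl⟩ _ ⟨j, ⟨hj, hj'⟩, rfl⟩ h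
  have e1 := key (i - (l + 1)) (by omega)
  have e2 := key (j - (l + 1)) (by omega)
  rw [show l + 1 + (i - (l + 1)) = i by omega] at e1
  rw [show l + 1 + (j - (l + 1)) = j by omega] at e2
  exact e2.2 (e1.1 h)

/-- A chord of a path in a chordal graph lies in a triangle with an inner vertex of the path. -/
lemma IsChordal.exists_split {V : Type} {H : SimpleGraph V} (hH : IsChordal H) {n : ℕ} {c : ℕ → V}
    (hinj : ∀ i j, i < j → j < n → c i ≠ c j) (hadj : ∀ i, i + 1 < n → H.Adj (c i) (c (i + 1)))
    {l r : ℕ} (hlr : l + 2 ≤ r) (hr : r < n) (h : H.Adj (c l) (c r)) :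
    ∃ m, l < m ∧ m < r ∧ H.Adj (c l) (c m) ∧ H.Adj (c m) (c r) := by
  obtain ⟨_, ⟨m, ⟨h1, h2⟩, rfl⟩, h3, h4⟩ :=
    hH.exists_common_neighbor h (connOn_image_Ioo hadj hlr hr)
    (by rintro ⟨i, ⟨hi, hi'⟩, heq⟩; exact hinj l i hi (by omega) heq.symm)
    (by rintro ⟨i, ⟨hi, hi'⟩, heq⟩; exact hinj i r hi' (by omega) heq)
    ⟨c (l + 1), ⟨l + 1, ⟨by omega, by omega⟩, rfl⟩, hadj l (by omega)⟩
    ⟨c (r - 1), ⟨r - 1, ⟨by omega, by omega⟩, rfl⟩, by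
      have := hadj (r - 1) (by omega)
      rw [Nat.sub_add_cancel (by omega)] at this
      exact this.symm⟩
  exact ⟨m, h1, h2, h3, h4.symm⟩

lemma SunFree.not_two_outer {V : Type} {H : SimpleGraph V} (hS : SunFree H) (hH : IsChordal H)
    {n : ℕ} {c : ℕ → V}
    (hinj : ∀ i j, i < j → j < n → c i ≠ c j) (hadj : ∀ i, i + 1 < n → H.Adj (c i) (c (i + 1))) :
    ∀ k l r : ℕ, r - l ≤ k → r < n → H.Adj (c l) (c r) →
      (∃ w, H.Adj w (c l) ∧ H.Adj w (c r) ∧ ∀ i, l ≤ i → i ≤ r → w ≠ c i) →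
      ∀ i j, l ≤ i → i < j → j < r →
      (∃ w, H.Adj w (c i) ∧ H.Adj w (c (i + 1)) ∧ ∀ t < n, w ≠ c t) →
      (∃ w, H.Adj w (c j) ∧ H.Adj w (c (j + 1)) ∧ ∀ t < n, w ≠ c t) → False := by
  intro k
  induction k with
  | zero => intros; omega
  | succ k ih =>
    rintro l r hk hr hlr ⟨w, hwl, hwr, hw⟩ i j hi hij hj mi mj
    obtain ⟨m, hm1, hm2, hm3, hm4⟩ := hH.exists_split hinj hadj (by omega) hr hlr
    rcases le_or_gt m i with h | h
    · exact ih m r (by omega) hr hm4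
        ⟨c l, hm3, hlr, fun t h1 h2 => hinj l t (by omega) (by omega)⟩ i j h hij hj mi mj
    rcases lt_or_ge j m with h' | h'
    · exact ih l m (by omega) (by omega) hm3
        ⟨c r, hlr.symm, hm4.symm, fun t h1 h2 => (hinj t r (by omega) (by omega)).symm⟩
        i j hi hij h' mi mj
    have side : ∀ a b, a < b → b ≤ r → l ≤ a → H.Adj (c a) (c b) →
        (∃ t, a ≤ t ∧ t < b ∧ ∃ w, H.Adj w (c t) ∧ H.Adj w (c (t + 1)) ∧ ∀ s < n, w ≠ c s) →
        ∃ u, H.Adj u (c a) ∧ H.Adj u (c b) ∧ ∀ s < n, (s < a ∨ b < s) → u ≠ c s := by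
      rintro a b hab hb ha hadj' ⟨t, ht, ht', u, h1, h2, h3⟩
      by_cases hb1 : b = a + 1
      · obtain rfl : t = a := by omega
        subst hb1
        exact ⟨u, h1, h2, fun s hs _ => h3 s hs⟩
      · obtain ⟨m', h4, h5, h6, h7⟩ := hH.exists_split hinj hadj (by omega) (by omega) hadj'
        refine ⟨c m', h6.symm, h7, fun s hs h => ?_⟩
        rcases h with h | h
        · exact (hinj s m' (by omega) (by omega)).symm
        · exact hinj m' s (by omega) hs
    obtain ⟨u, h1, h2, h3⟩ := side l m hm1 hm2.le le_rfl hm3 ⟨i, hi, h, mi⟩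
    obtain ⟨v, h4, h5, h6⟩ := side m r hm2 le_rfl hm1.le hm4 ⟨j, h', hj, mj⟩
    exact hS (c l) (c m) (c r) u v w hm3 hm4 hlr h1 h2 h4 h5 hwl hwr (h3 r hr (Or.inr hm2))
      (h6 l (by omega) (Or.inl hm1)) (hw m hm1.le hm2.le)

lemma SunFree.no_even_interval {V : Type} {H : SimpleGraph V} (hS : SunFree H) (hH : IsChordal H)
    {n : ℕ} {c : ℕ → V}
    (hinj : ∀ i j, i < j → j < n → c i ≠ c j) (hadj : ∀ i, i + 1 < n → H.Adj (c i) (c (i + 1)))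
    (hodd : ∀ l r, l < r → r < n → H.Adj (c l) (c r) → Odd (r - l) →
      r = l + 1 ∨ (l = 0 ∧ r + 1 = n)) :
    ∀ k l r : ℕ, r - l ≤ k → l + 4 ≤ r → r < n → Even (r - l) → H.Adj (c l) (c r) →
      (∃ w, H.Adj w (c l) ∧ H.Adj w (c r) ∧ ∀ i, l ≤ i → i ≤ r → w ≠ c i) → False := by
  intro k
  induction k with
  | zero => intros; omega
  | succ k ih =>
    rintro l r hk h4 hr he hlr ⟨w, hwl, hwr, hw⟩
    obtain ⟨m, hm1, hm2, hm3, hm4⟩ := hH.exists_split hinj hadj (by omega) hr hlr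
    rcases Nat.even_or_odd (m - l) with h | h
    · have h' : Even (r - m) := by grind
      by_cases h1 : l + 4 ≤ m
      · exact ih l m (by omega) h1 (by omega) h hm3
          ⟨c r, hlr.symm, hm4.symm, fun t h1 h2 => (hinj t r (by omega) (by omega)).symm⟩
      by_cases h2 : m + 4 ≤ r
      · exact ih m r (by omega) h2 hr h' hm4
          ⟨c l, hm3, hlr, fun t h1 h2 => hinj l t (by omega) (by omega)⟩
      obtain rfl : m = l + 1 + 1 := by grind
      obtain rfl : r = l + 1 + 1 + 1 + 1 := by grind
      exact hS (c l) (c (l + 1 + 1)) (c (l + 1 + 1 + 1 + 1)) (c (l + 1)) (c (l + 1 + 1 + 1)) w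
        hm3 hm4 hlr (hadj l (by omega)).symm (hadj (l + 1) (by omega))
        (hadj (l + 1 + 1) (by omega)).symm (hadj (l + 1 + 1 + 1) (by omega)) hwl hwr
        (hinj _ _ (by omega) (by omega)) (hinj _ _ (by omega) (by omega)).symm
        (hw _ (by omega) (by omega))
    · have h' : Odd (r - m) := by grind
      have e1 := hodd l m hm1 (by omega) hm3 h
      have e2 := hodd m r hm2 hr hm4 h'
      omega

lemma SunFree.isStronglyChordal {V : Type} {H : SimpleGraph V} (hS : SunFree H)
    (hH : IsChordal H) : IsStronglyChordal H := by
  refine ⟨hH, fun n hn he f hf hf' => ?_⟩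
  by_contra hno
  push Not at hno
  have : NeZero n := ⟨by omega⟩
  set c : ℕ → V := fun i => f (i : ZMod n) with hc
  have hinj : ∀ i j, i < j → j < n → c i ≠ c j := fun i j hij hj h =>
    (cycGraph_adj_natCast hij hj).1 (hf h)
  have hadj : ∀ i, H.Adj (c i) (c (i + 1)) := fun i => by
    have := hf' (i : ZMod n)
    simp only [hc, Nat.cast_add, Nat.cast_one]
    exact this
  have hclose : H.Adj (c (n - 1)) (c 0) := by
    have := hadj (n - 1)
    rw [Nat.sub_add_cancel (by omega)] at this
    simpa [hc] using this
  have hodd : ∀ l r, l < r → r < n → H.Adj (c l) (c r) → Odd (r - l) →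
      r = l + 1 ∨ (l = 0 ∧ r + 1 = n) := by
    intro l r hlr hr h ho
    by_contra hcon
    refine hno (l : ZMod n) (r - l) ho (by grind) (by grind) ?_
    have : ((l : ZMod n) + ((r - l : ℕ) : ZMod n)) = (r : ZMod n) := by
      rw [← Nat.cast_add, Nat.add_sub_cancel' hlr.le]
    rw [this]; exact h
  have int := hS.no_even_interval hH hinj (fun i _ => hadj i) hodd n
  obtain ⟨m, hm1, hm2, hm3, hm4⟩ := hH.exists_split hinj (fun i _ => hadj i)
    (l := 0) (r := n - 1) (by omega) (by omega) hclose.symm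
  rcases Nat.even_or_odd m with h | h
  · have e := hodd m (n - 1) hm2 (by omega) hm4 (by grind)
    obtain rfl : m = n - 2 := by omega
    exact int 0 (n - 2) (by omega) (by omega) (by omega) (by grind) hm3
      ⟨c (n - 1), hclose, hm4.symm, fun i h1 h2 => (hinj i _ (by omega) (by omega)).symm⟩
  · have e := hodd 0 m hm1 (by omega) hm3 (by grind)
    obtain rfl : m = 1 := by omega
    exact int 1 (n - 1) (by omega) (by omega) (by omega) (by grind) hm4
      ⟨c 0, hm3, hclose.symm, fun i h1 h2 => hinj _ _ (by omega) (by omega)⟩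

lemma CycSeq.connOn {V : Type} {T : SimpleGraph V} {n : ℕ} {c : ℕ → V} (h : CycSeq T n c) :
    ConnOn T (c '' {i | i < n}) := by
  have hn := h.1
  refine ⟨⟨c 0, 0, show 0 < n by omega, rfl⟩, fun A hA => ?_⟩
  have key : ∀ k, k < n → (c k ∈ A ↔ c 0 ∈ A) := by
    intro k
    induction k with
    | zero => simp
    | succ k ih =>
      intro hk
      rw [← ih (by omega)]
      have h1 : c k ∈ c '' {i | i < n} := ⟨_, by change k < n; omega, rfl⟩
      have h2 : c (k + 1) ∈ c '' {i | i < n} := ⟨_, hk, rfl⟩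
      have h3 := h.adj_succ hk
      exact ⟨hA _ h2 _ h1 h3.symm, hA _ h1 _ h2 h3⟩
  rintro _ ⟨i, hi, rfl⟩ _ ⟨j, hj, rfl⟩ hiA
  exact (key j hj).2 ((key i hi).1 hiA)

lemma IsChordlessCycle.connOn {V : Type} {T : SimpleGraph V} {S : Set V}
    (hS : IsChordlessCycle T S) : ConnOn T S := by
  obtain ⟨n, c, hc, rfl⟩ := isChordlessCycle_iff.1 hS
  exact hc.connOn

/-- Every vertex of a chordless cycle has exactly two neighbours on it. -/
lemma IsChordlessCycle.exists_two_neighbors {V : Type} {T : SimpleGraph V} {S : Set V}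
    (hS : IsChordlessCycle T S) {x : V} (hx : x ∈ S) :
    ∃ y ∈ S, ∃ z ∈ S, y ≠ z ∧ T.Adj x y ∧ T.Adj x z ∧ ∀ w ∈ S, T.Adj x w → w = y ∨ w = z := by
  obtain ⟨n, c, hc, rfl⟩ := isChordlessCycle_iff.1 hS
  obtain ⟨i, hi, rfl⟩ := hx
  have hi : i < n := hi
  have hn := hc.1
  have main : ∀ y z, y < n → z < n → y ≠ z → T.Adj (c i) (c y) → T.Adj (c i) (c z) →
      (∀ w < n, T.Adj (c i) (c w) → w = y ∨ w = z) →
      ∃ y ∈ c '' {i | i < n}, ∃ z ∈ c '' {i | i < n}, y ≠ z ∧ T.Adj (c i) y ∧ T.Adj (c i) z ∧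
        ∀ w ∈ c '' {i | i < n}, T.Adj (c i) w → w = y ∨ w = z := by
    intro y z hy hz hyz h1 h2 h3
    refine ⟨c y, ⟨y, hy, rfl⟩, c z, ⟨z, hz, rfl⟩, fun h => hyz (hc.injOn hy hz h), h1, h2, ?_⟩
    rintro _ ⟨w, hw, rfl⟩ h
    rcases h3 w hw h with rfl | rfl
    · exact Or.inl rfl
    · exact Or.inr rfl
  have adj : ∀ w < n, T.Adj (c i) (c w) →
      (w = i + 1 ∨ (i = 0 ∧ w + 1 = n)) ∨ (i = w + 1 ∨ (w = 0 ∧ i + 1 = n)) := by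
    intro w hw h
    rcases lt_trichotomy i w with h1 | h1 | h1
    · exact Or.inl ((hc.2 i w h1 hw).2.1 h)
    · subst h1; exact absurd rfl h.ne
    · exact Or.inr ((hc.2 w i h1 hi).2.1 h.symm)
  by_cases h0 : i = 0
  · subst h0
    exact main 1 (n - 1) (by omega) (by omega) (by omega) (hc.adj_succ (i := 0) (by omega))
      hc.adj_last (fun w hw h => by have := adj w hw h; omega)
  have hpred : T.Adj (c i) (c (i - 1)) := by
    have := hc.adj_succ (i := i - 1) (by omega)
    rw [Nat.sub_add_cancel (by omega)] at this
    exact this.symm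
  by_cases h1 : i = n - 1
  · refine main 0 (i - 1) (by omega) (by omega) (by omega) ?_ hpred
      (fun w hw h => by have := adj w hw h; omega)
    rw [h1]; exact hc.adj_last.symm
  · exact main (i + 1) (i - 1) (by omega) (by omega) (by omega) (hc.adj_succ (by omega)) hpred
      (fun w hw h => by have := adj w hw h; omega)

/-- If `R` is a chordless cycle, and `x ∈ R` has all its `R`-neighbours in the chordless cycle `S`,
then all `S`-neighbours of `x` are in `R`. -/
lemma IsChordlessCycle.mem_of_adj {V : Type} {T : SimpleGraph V} {R S : Set V}
    (hR : IsChordlessCycle T R) (hS : IsChordlessCycle T S) {x : V} (hxR : x ∈ R) (hxS : x ∈ S)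
    (h : ∀ y ∈ R, T.Adj x y → y ∈ S) {y : V} (hy : y ∈ S) (hxy : T.Adj x y) : y ∈ R := by
  obtain ⟨p, hp, q, hq, hpq, hxp, hxq, -⟩ := hR.exists_two_neighbors hxR
  obtain ⟨s, -, t, -, -, -, -, h'⟩ := hS.exists_two_neighbors hxS
  rcases h' p (h p hp hxp) hxp with rfl | rfl <;> rcases h' q (h q hq hxq) hxq with rfl | rfl <;>
    rcases h' y hy hxy with rfl | rfl <;> first | assumption | exact absurd rfl hpq

lemma IsChordlessCycle.eq_of_subset {V : Type} {T : SimpleGraph V} {R S : Set V}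
    (hR : IsChordlessCycle T R) (hS : IsChordlessCycle T S) (h : R ⊆ S) : R = S := by
  refine h.antisymm fun y hy => ?_
  obtain ⟨x, hx⟩ := hR.connOn.1
  exact hS.connOn.2 R (fun u hu v hv huv huR =>
    hR.mem_of_adj hS huR hu (fun z hz _ => h hz) hv huv) x (h hx) y hy hx

lemma IsChordlessCycle.image {V W : Type} {T : SimpleGraph V} {T' : SimpleGraph W} {S : Set V}
    (hS : IsChordlessCycle T S) (φ : V → W) (hφ : Set.InjOn φ S)
    (hadj : ∀ x ∈ S, ∀ y ∈ S, T'.Adj (φ x) (φ y) ↔ T.Adj x y) : IsChordlessCycle T' (φ '' S) := by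
  obtain ⟨n, c, hc, rfl⟩ := isChordlessCycle_iff.1 hS
  refine isChordlessCycle_iff.2 ⟨n, φ ∘ c, ⟨hc.1, fun i j hij hj => ?_⟩, by rw [Set.image_comp]⟩
  have hi' : c i ∈ c '' {i | i < n} := ⟨i, by change i < n; omega, rfl⟩
  have hj' : c j ∈ c '' {i | i < n} := ⟨j, hj, rfl⟩
  exact ⟨fun h => (hc.2 i j hij hj).1 (hφ hi' hj' h), (hadj _ hi' _ hj').trans (hc.2 i j hij hj).2⟩

/-- `T[K]` is a single edge, or is built from an edge by successively gluing chordless cycles along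
edges. -/
inductive TreeOn {V : Type} (T : SimpleGraph V) : Set V → Prop
  | edge (a b : V) (hab : T.Adj a b) : TreeOn T {a, b}
  | ear (K S : Set V) (a b : V) (hK : TreeOn T K) (hS : IsChordlessCycle T S)
      (hKS : K ∩ S = {a, b}) (hab : T.Adj a b)
      (hsep : ∀ z ∈ S, z ∉ K → ∀ w ∈ K, T.Adj z w → w = a ∨ w = b) : TreeOn T (K ∪ S)

lemma IsChordlessCycle.treeOn {V : Type} {T : SimpleGraph V} {S : Set V}
    (hS : IsChordlessCycle T S) : TreeOn T S := by
  obtain ⟨x, hx⟩ := hS.connOn.1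
  obtain ⟨y, hy, -, -, -, hxy, -, -⟩ := hS.exists_two_neighbors hx
  have hsub : ({x, y} : Set V) ⊆ S := by
    rintro z (rfl | rfl) <;> assumption
  have := TreeOn.ear {x, y} S x y (.edge x y hxy) hS (Set.inter_eq_left.2 hsub) hxy
    (fun z _ _ w hw _ => hw)
  rwa [Set.union_eq_right.2 hsub] at this

lemma TreeOn.image {V W : Type} {T : SimpleGraph V} {T' : SimpleGraph W} {K : Set V}
    (hK : TreeOn T K) (φ : V → W) (hφ : Set.InjOn φ K)
    (hadj : ∀ x ∈ K, ∀ y ∈ K, T'.Adj (φ x) (φ y) ↔ T.Adj x y) : TreeOn T' (φ '' K) := by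
  induction hK with
  | edge a b hab =>
    rw [Set.image_pair]
    exact .edge _ _ ((hadj a (by simp) b (by simp)).2 hab)
  | ear K S a b hK hS hKS hab hsep ih =>
    have hKu : K ⊆ K ∪ S := Set.subset_union_left
    have hSu : S ⊆ K ∪ S := Set.subset_union_right
    have ha : a ∈ K ∩ S := by rw [hKS]; simp
    have hb : b ∈ K ∩ S := by rw [hKS]; simp
    rw [Set.image_union]
    refine .ear _ _ (φ a) (φ b)
      (ih (hφ.mono hKu) fun x hx y hy => hadj x (hKu hx) y (hKu hy))
      (hS.image φ (hφ.mono hSu) fun x hx y hy => hadj x (hSu hx) y (hSu hy)) ?_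
      ((hadj a (hKu ha.1) b (hKu hb.1)).2 hab) ?_
    · rw [← hφ.image_inter hKu hSu, hKS, Set.image_pair]
    · rintro _ ⟨z, hz, rfl⟩ hzK _ ⟨w, hw, rfl⟩ h
      rcases hsep z hz (fun h => hzK ⟨z, h, rfl⟩) w hw ((hadj z (hSu hz) w (hKu hw)).1 h)
        with rfl | rfl
      · exact Or.inl rfl
      · exact Or.inr rfl

lemma IsChordlessCycle.congr {V : Type} {T T' : SimpleGraph V} {S : Set V}
    (hS : IsChordlessCycle T S) (h : ∀ x ∈ S, ∀ y ∈ S, T'.Adj x y ↔ T.Adj x y) :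
    IsChordlessCycle T' S := by
  simpa using hS.image id (Set.injOn_id _) h

lemma TreeOn.congr {V : Type} {T T' : SimpleGraph V} {K : Set V}
    (hK : TreeOn T K) (h : ∀ x ∈ K, ∀ y ∈ K, T'.Adj x y ↔ T.Adj x y) : TreeOn T' K := by
  simpa using hK.image id (Set.injOn_id _) h

lemma IsChordlessCycle.subset_or_eq_of_ear {V : Type} {T : SimpleGraph V} {K S R : Set V} {a b : V}
    (hS : IsChordlessCycle T S) (hKS : K ∩ S = {a, b}) (hab : T.Adj a b)
    (hsep : ∀ z ∈ S, z ∉ K → ∀ w ∈ K, T.Adj z w → w = a ∨ w = b)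
    (hR : IsChordlessCycle T R) (hRKS : R ⊆ K ∪ S) : R ⊆ K ∨ R = S := by
  by_contra! hcon
  obtain ⟨hRK, hRS⟩ := hcon
  obtain ⟨z, hzR, hzK⟩ := Set.not_subset.1 hRK
  have ha : a ∈ K ∩ S := by rw [hKS]; simp
  have hb : b ∈ K ∩ S := by rw [hKS]; simp
  have hzS : z ∈ S := (hRKS hzR).resolve_left hzK
  have step : ∀ x ∈ S, x ∉ K → x ∈ R → ∀ y ∈ S, T.Adj x y → y ∈ R := by
    intro x hxS hxK hxR y hy hxy
    refine hR.mem_of_adj hS hxR hxS (fun w hw hxw => ?_) hy hxy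
    rcases hRKS hw with h | h
    · rcases hsep x hxS hxK w h hxw with rfl | rfl
      · exact ha.2
      · exact hb.2
    · exact h
  obtain ⟨n, c, hc, rfl, hc0, hcn⟩ := hS.exists_cycSeq ha.2 hb.2 hab
  have hn := hc.1
  have hK : ∀ i < n, c i ∈ K → i = 0 ∨ i = n - 1 := by
    intro i hi h
    have : c i ∈ ({a, b} : Set V) := hKS ▸ ⟨h, ⟨i, hi, rfl⟩⟩
    rcases this with h | h
    · exact Or.inl (hc.injOn hi (by omega) (h.trans hc0.symm))
    · exact Or.inr (hc.injOn hi (by omega) (h.trans hcn.symm))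
  obtain ⟨m, hm, rfl⟩ := hzS
  have hm : m < n := hm
  have hm0 : m ≠ 0 := by rintro rfl; exact hzK (hc0 ▸ ha.1)
  have hmn : m ≠ n - 1 := by rintro rfl; exact hzK (hcn ▸ hb.1)
  have hmem : ∀ i < n, c i ∈ c '' {i | i < n} := fun i hi => ⟨i, hi, rfl⟩
  have inner : ∀ i, 0 < i → i < n - 1 → c i ∈ R := by
    intro i hi hi'
    refine (connOn_image_Ioo (c := c) (l := 0) (r := n - 1) (n := n) (fun i hi => hc.adj_succ hi) (by omega)
      (by omega)).2 R ?_ (c m) ⟨m, ⟨by omega, by omega⟩, rfl⟩ (c i) ⟨i, ⟨hi, hi'⟩, rfl⟩ hzR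
    rintro _ ⟨s, ⟨hs, hs'⟩, rfl⟩ _ ⟨t, ⟨ht, ht'⟩, rfl⟩ hst h
    exact step _ (hmem s (by omega)) (fun hh => by have := hK s (by omega) hh; omega) h _
      (hmem t (by omega)) hst
  have hmore : ∀ s t, 0 < s → s < n - 1 → t < n → T.Adj (c s) (c t) → c t ∈ R := by
    intro s t hs hs' ht h
    exact step _ (hmem s (by omega)) (fun hh => by have := hK s (by omega) hh; omega)
      (inner s hs hs') _ (hmem t ht) h
  refine hRS (hS.eq_of_subset hR ?_).symm
  rintro _ ⟨i, hi, rfl⟩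
  have hi : i < n := hi
  by_cases h0 : i = 0
  · subst h0
    exact hmore 1 0 (by omega) (by omega) hi (hc.adj_succ (i := 0) (by omega)).symm
  by_cases h1 : i = n - 1
  · subst h1
    refine hmore (n - 2) (n - 1) (by omega) (by omega) hi ?_
    have := hc.adj_succ (i := n - 2) (by omega)
    rwa [show n - 2 + 1 = n - 1 by omega] at this
  · exact inner i (by omega) (by omega)

/-- Two chordless cycles of a tree of cycles that share three vertices are equal. -/
lemma TreeOn.eq_of_three {V : Type} {T : SimpleGraph V} {K : Set V} (hK : TreeOn T K) :
    ∀ R S : Set V, IsChordlessCycle T R → IsChordlessCycle T S → R ⊆ K → S ⊆ K →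
      ∀ x y z, x ≠ y → y ≠ z → x ≠ z → x ∈ R → x ∈ S → y ∈ R → y ∈ S → z ∈ R → z ∈ S →
      R = S := by
  induction hK with
  | edge a b hab =>
    intro R S hR hS hRK hSK x y z hxy hyz hxz hxR hxS hyR hyS hzR hzS
    have := hRK hxR; have := hRK hyR; have := hRK hzR
    simp only [Set.mem_insert_iff, Set.mem_singleton_iff] at *
    grind
  | ear K Q a b hK hQ hKQ hab hsep ih =>
    intro R S hR hS hRK hSK x y z hxy hyz hxz hxR hxS hyR hyS hzR hzS
    have mem : ∀ w, w ∈ K → w ∈ Q → w = a ∨ w = b := fun w h1 h2 => by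
      have : w ∈ ({a, b} : Set V) := hKQ ▸ ⟨h1, h2⟩
      exact this
    rcases hQ.subset_or_eq_of_ear hKQ hab hsep hR hRK with h1 | h1 <;>
      rcases hQ.subset_or_eq_of_ear hKQ hab hsep hS hSK with h2 | h2
    · exact ih R S hR hS h1 h2 x y z hxy hyz hxz hxR hxS hyR hyS hzR hzS
    · subst h2
      have := mem x (h1 hxR) hxS; have := mem y (h1 hyR) hyS; have := mem z (h1 hzR) hzS
      grind
    · subst h1
      have := mem x (h2 hxS) hxR; have := mem y (h2 hyS) hyR; have := mem z (h2 hzS) hzR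
      grind
    · rw [h1, h2]

lemma TreeOn.edge_or_exists_cycle {V : Type} {T : SimpleGraph V} {K : Set V} (hK : TreeOn T K) :
    (∃ a b, T.Adj a b ∧ K = {a, b}) ∨ ∀ x ∈ K, ∀ y ∈ K, T.Adj x y →
      ∃ S, IsChordlessCycle T S ∧ S ⊆ K ∧ x ∈ S ∧ y ∈ S := by
  induction hK with
  | edge a b hab => exact Or.inl ⟨a, b, hab, rfl⟩
  | ear K Q a b hK hQ hKQ hab hsep ih =>
    right
    have ha : a ∈ K ∩ Q := by rw [hKQ]; simp
    have hb : b ∈ K ∩ Q := by rw [hKQ]; simp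
    have cross : ∀ z ∈ Q, z ∉ K → ∀ w ∈ K, T.Adj z w → w ∈ Q := by
      intro z hz hzK w hw h
      rcases hsep z hz hzK w hw h with rfl | rfl
      · exact ha.2
      · exact hb.2
    intro x hx y hy hxy
    by_cases hQ' : x ∈ Q ∧ y ∈ Q
    · exact ⟨Q, hQ, Set.subset_union_right, hQ'⟩
    have hxK : x ∈ K := by
      by_contra hxK
      have hxQ := hx.resolve_left hxK
      exact hQ' ⟨hxQ, hy.elim (fun h => cross x hxQ hxK y h hxy) id⟩
    have hyK : y ∈ K := by
      by_contra hyK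
      have hyQ := hy.resolve_left hyK
      exact hQ' ⟨hx.elim (fun h => cross y hyQ hyK x h hxy.symm) id, hyQ⟩
    rcases ih with ⟨a', b', -, rfl⟩ | ih
    · exfalso
      have hsub : ∀ w ∈ ({a', b'} : Set V), w ∈ Q := by
        have h1 := ha.1; have h2 := hb.1; have h3 := hab.ne; have h4 := ha.2; have h5 := hb.2
        simp only [Set.mem_insert_iff, Set.mem_singleton_iff] at h1 h2 ⊢
        grind
      exact hQ' ⟨hsub x hxK, hsub y hyK⟩
    · obtain ⟨S, h1, h2, h3⟩ := ih x hxK y hyK hxy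
      exact ⟨S, h1, h2.trans Set.subset_union_left, h3⟩

lemma IsTreeOfCycles.of_iso {V W : Type} {G : SimpleGraph V} {H : SimpleGraph W}
    (hG : IsTreeOfCycles G) (e : H ≃g G) : IsTreeOfCycles H := by
  cases hG with
  | cycle _ n hn e' => exact .cycle H n hn (e'.map fun f => e.trans f)
  | glue G₀ hG₀ n hn a b hab _ e' =>
    exact .glue G₀ hG₀ n hn a b hab H (e'.map fun f => e.trans f)

section glueCycle

variable {V : Type} (G : SimpleGraph V) (n : ℕ) (a b : V)

lemma glueCycle_inl_inl (u v : V) :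
    (glueCycle G n a b).Adj (Sum.inl u) (Sum.inl v) ↔ G.Adj u v := by
  simp only [glueCycle, SimpleGraph.fromRel_adj]
  exact ⟨fun h => h.2.elim id fun h => h.symm,
    fun h => ⟨fun h' => h.ne (Sum.inl_injective h'), Or.inl h⟩⟩

lemma glueCycle_inl_inr (u : V) (x : {x : ZMod n // x ≠ 0 ∧ x ≠ 1}) :
    (glueCycle G n a b).Adj (Sum.inl u) (Sum.inr x) ↔
      (u = a ∧ (cycGraph n).Adj 0 x.1) ∨ (u = b ∧ (cycGraph n).Adj 1 x.1) := by
  simp [glueCycle, SimpleGraph.fromRel_adj]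

lemma glueCycle_inr_inr (x y : {x : ZMod n // x ≠ 0 ∧ x ≠ 1}) :
    (glueCycle G n a b).Adj (Sum.inr x) (Sum.inr y) ↔ (cycGraph n).Adj x.1 y.1 := by
  simp only [glueCycle, SimpleGraph.fromRel_adj]
  exact ⟨fun h => h.2.elim id fun h => h.symm,
    fun h => ⟨fun h' => h.ne (congrArg Subtype.val (Sum.inr_injective h')), Or.inl h⟩⟩

end glueCycle

lemma cycGraph_zero_adj_one {n : ℕ} (hn : 3 ≤ n) : (cycGraph n).Adj 0 1 := by
  have := ((cycGraph_adj_natCast (n := n) (a := 0) (b := 1) (by omega) (by omega)).2).2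
    (Or.inl rfl)
  simpa using this

lemma isChordlessCycle_univ {V : Type} {G : SimpleGraph V} {n : ℕ} (hn : 3 ≤ n)
    (e : G ≃g cycGraph n) : IsChordlessCycle G Set.univ :=
  ⟨n, hn, ⟨(SimpleGraph.induceUnivIso G).trans e⟩⟩

lemma TreeOn.univ_of_iso {V W : Type} {G : SimpleGraph V} {H : SimpleGraph W} (hG : TreeOn G Set.univ)
    (e : G ≃g H) : TreeOn H Set.univ := by
  have := hG.image (T' := H) e e.injective.injOn (fun x _ y _ => e.map_adj_iff)
  rwa [Set.image_univ, e.surjective.range_eq] at this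

lemma IsTreeOfCycles.treeOn {V : Type} {G : SimpleGraph V} (hG : IsTreeOfCycles G) :
    TreeOn G Set.univ := by
  classical
  induction hG with
  | cycle G n hn e =>
    obtain ⟨e⟩ := e
    exact (isChordlessCycle_univ hn e).treeOn
  | @glue V W G hG n hn a b hab H e ih =>
    obtain ⟨e⟩ := e
    refine TreeOn.univ_of_iso (G := glueCycle G n a b) ?_ e.symm
    have h01 := cycGraph_zero_adj_one hn
    let φ : ZMod n → V ⊕ {x : ZMod n // x ≠ 0 ∧ x ≠ 1} := fun x =>
      if h0 : x = 0 then Sum.inl a else if h1 : x = 1 then Sum.inl b else Sum.inr ⟨x, h0, h1⟩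
    have φ0 : φ 0 = Sum.inl a := by simp [φ]
    have φ1 : φ 1 = Sum.inl b := by simp [φ, h01.ne.symm]
    have φx : ∀ x (hx : x ≠ 0 ∧ x ≠ 1), φ x = Sum.inr ⟨x, hx⟩ := fun x hx => by
      simp [φ, hx.1, hx.2]
    have cases3 : ∀ x : ZMod n, x = 0 ∨ x = 1 ∨ (x ≠ 0 ∧ x ≠ 1) := fun x => by tauto
    have adj0 : ∀ x, (glueCycle G n a b).Adj (Sum.inl a) (Sum.inr x) ↔ (cycGraph n).Adj 0 x.1 :=
      fun x => by simp [glueCycle_inl_inr, hab.ne]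
    have adj1 : ∀ x, (glueCycle G n a b).Adj (Sum.inl b) (Sum.inr x) ↔ (cycGraph n).Adj 1 x.1 :=
      fun x => by simp [glueCycle_inl_inr, hab.ne.symm]
    have hK : TreeOn (glueCycle G n a b) (Sum.inl '' Set.univ) :=
      ih.image _ Sum.inl_injective.injOn fun x _ y _ => glueCycle_inl_inl G n a b x y
    have hS : IsChordlessCycle (glueCycle G n a b) (φ '' Set.univ) := by
      refine (isChordlessCycle_univ hn (RelIso.refl _)).image φ ?_ ?_
      · intro x _ y _ hxy
        rcases cases3 x with rfl | rfl | hx <;> rcases cases3 y with rfl | rfl | hy <;>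
          simp_all [hab.ne, hab.ne.symm]
      · intro x _ y _
        rcases cases3 x with rfl | rfl | hx
        · rcases cases3 y with rfl | rfl | hy
          · simp
          · simp [φ0, φ1, glueCycle_inl_inl, hab, h01]
          · rw [φ0, φx y hy]; exact adj0 _
        · rcases cases3 y with rfl | rfl | hy
          · simp [φ0, φ1, glueCycle_inl_inl, hab.symm, h01.symm]
          · simp
          · rw [φ1, φx y hy]; exact adj1 _
        · rw [φx x hx]
          rcases cases3 y with rfl | rfl | hy
          · rw [φ0, SimpleGraph.adj_comm, (cycGraph n).adj_comm]; exact adj0 _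
          · rw [φ1, SimpleGraph.adj_comm, (cycGraph n).adj_comm]; exact adj1 _
          · rw [φx y hy]; exact glueCycle_inr_inr G n a b _ _
    have huniv : Set.univ = Sum.inl '' Set.univ ∪ φ '' Set.univ := by
      ext z
      rcases z with u | x
      · simp
      · simp only [Set.mem_univ, Set.mem_union, true_iff]
        exact Or.inr ⟨x.1, trivial, φx _ x.2⟩
    rw [huniv]
    refine .ear _ _ (Sum.inl a) (Sum.inl b) hK hS ?_ ((glueCycle_inl_inl G n a b a b).2 hab) ?_
    · ext z
      constructor
      · rintro ⟨⟨u, -, rfl⟩, x, -, hx⟩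
        rcases cases3 x with rfl | rfl | hx'
        · rw [← hx, φ0]; exact Or.inl rfl
        · rw [← hx, φ1]; exact Or.inr rfl
        · rw [φx _ hx'] at hx; cases hx
      · rintro (rfl | rfl)
        · exact ⟨⟨a, trivial, rfl⟩, 0, trivial, φ0⟩
        · exact ⟨⟨b, trivial, rfl⟩, 1, trivial, φ1⟩
    · rintro z - hz _ ⟨w, -, rfl⟩ h
      rcases z with u | x
      · exact absurd ⟨u, trivial, rfl⟩ hz
      · rcases (glueCycle_inl_inr G n a b w x).1 h.symm with h | h
        · exact Or.inl (by rw [h.1])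
        · exact Or.inr (by rw [h.1])

lemma IsChordlessCycle.exists_iso {V : Type} {T : SimpleGraph V} {S : Set V}
    (hS : IsChordlessCycle T S) {a b : V} (ha : a ∈ S) (hb : b ∈ S) (hab : T.Adj a b) :
    ∃ n, 3 ≤ n ∧ ∃ e : cycGraph n ≃g T.induce S, e 0 = ⟨a, ha⟩ ∧ e 1 = ⟨b, hb⟩ := by
  obtain ⟨n, hn, ⟨e⟩⟩ := hS
  have hadj : (cycGraph n).Adj (e ⟨b, hb⟩) (e ⟨a, ha⟩) := by
    rw [e.map_adj_iff]; exact hab.symm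
  obtain ⟨g, h0, h1⟩ := cycGraph_exists_iso hadj
  let s : cycGraph n ≃g cycGraph n := ⟨Equiv.subRight 1, by
    intro x y
    simp only [cycGraph, SimpleGraph.fromRel_adj, Equiv.subRight_apply, ne_eq,
      sub_add_cancel, sub_eq_iff_eq_add]⟩
  refine ⟨n, hn, (s.trans g).trans e.symm, ?_, ?_⟩
  · change e.symm (g (0 - 1)) = _
    simp [h1]
  · change e.symm (g (1 - 1)) = _
    simp [h0]

lemma TreeOn.eq_pair_or_isTreeOfCycles {V : Type} {T : SimpleGraph V} {K : Set V}
    (hK : TreeOn T K) : (∃ a b, K = {a, b}) ∨ IsTreeOfCycles (T.induce K) := by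
  induction hK with
  | edge a b hab => exact Or.inl ⟨a, b, rfl⟩
  | ear K S a b hK hS hKS hab hsep ih =>
    right
    have ha : a ∈ K ∩ S := by rw [hKS]; simp
    have hb : b ∈ K ∩ S := by rw [hKS]; simp
    rcases ih with ⟨a', b', rfl⟩ | ih
    · have hsub : ({a', b'} : Set V) ⊆ S := by
        have h1 := ha.1; have h2 := hb.1; have h3 := hab.ne; have h4 := ha.2; have h5 := hb.2
        simp only [Set.mem_insert_iff, Set.mem_singleton_iff] at h1 h2
        rintro w (rfl | rfl) <;> grind
      rw [Set.union_eq_right.2 hsub]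
      obtain ⟨n, hn, e⟩ := hS
      exact .cycle _ n hn e
    obtain ⟨n, hn, ψ, h0, h1⟩ := hS.exists_iso ha.2 hb.2 hab
    have hψ0 : (ψ 0).1 = a := by rw [h0]
    have hψ1 : (ψ 1).1 = b := by rw [h1]
    have hψadj : ∀ x y, T.Adj (ψ x).1 (ψ y).1 ↔ (cycGraph n).Adj x y := fun x y =>
      ψ.map_adj_iff (v := x) (w := y)
    have hψK : ∀ x, (ψ x).1 ∈ K → x = 0 ∨ x = 1 := by
      intro x hx
      have : (ψ x).1 ∈ ({a, b} : Set V) := hKS ▸ ⟨hx, (ψ x).2⟩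
      rcases this with h | h
      · exact Or.inl (ψ.injective (Subtype.ext (h.trans hψ0.symm)))
      · exact Or.inr (ψ.injective (Subtype.ext (h.trans hψ1.symm)))
    let F : K ⊕ {x : ZMod n // x ≠ 0 ∧ x ≠ 1} → (K ∪ S : Set V) := fun z =>
      match z with
      | Sum.inl u => ⟨u.1, Or.inl u.2⟩
      | Sum.inr x => ⟨(ψ x.1).1, Or.inr (ψ x.1).2⟩
    have hF : Function.Bijective F := by
      constructor
      · rintro (u | x) (v | y) h
        · have h : u.1 = v.1 := congrArg (fun z : (K ∪ S : Set V) => z.1) h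
          rw [Subtype.ext h]
        · have h : u.1 = (ψ y.1).1 := congrArg Subtype.val h
          have := hψK y.1 (h ▸ u.2)
          have := y.2
          tauto
        · have h : (ψ x.1).1 = v.1 := congrArg Subtype.val h
          have := hψK x.1 (h ▸ v.2)
          have := x.2
          tauto
        · have h : (ψ x.1).1 = (ψ y.1).1 := congrArg (fun z : (K ∪ S : Set V) => z.1) h
          rw [Subtype.ext (ψ.injective (Subtype.ext h))]
      · rintro ⟨z, hz⟩
        by_cases hzK : z ∈ K
        · exact ⟨Sum.inl ⟨z, hzK⟩, rfl⟩
        · have hzS := hz.resolve_left hzK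
          have e1 : (ψ (ψ.symm ⟨z, hzS⟩)).1 = z := by simp
          refine ⟨Sum.inr ⟨ψ.symm ⟨z, hzS⟩, fun h => ?_, fun h => ?_⟩, Subtype.ext e1⟩
          · rw [h, hψ0] at e1; exact hzK (e1 ▸ ha.1)
          · rw [h, hψ1] at e1; exact hzK (e1 ▸ hb.1)
    have hcross : ∀ (u : K) (x : {x : ZMod n // x ≠ 0 ∧ x ≠ 1}),
        T.Adj u.1 (ψ x.1).1 ↔ (glueCycle (T.induce K) n ⟨a, ha.1⟩ ⟨b, hb.1⟩).Adj
          (Sum.inl u) (Sum.inr x) := by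
      intro u x
      rw [glueCycle_inl_inr, ← hψadj, ← hψadj, hψ0, hψ1]
      constructor
      · intro h
        rcases hsep _ (ψ x.1).2 (fun hh => by have := hψK _ hh; have := x.2; tauto) u.1 u.2 h.symm
          with h' | h'
        · exact Or.inl ⟨Subtype.ext h', h' ▸ h⟩
        · exact Or.inr ⟨Subtype.ext h', h' ▸ h⟩
      · rintro (⟨rfl, h⟩ | ⟨rfl, h⟩) <;> exact h
    refine .glue (T.induce K) ih n hn ⟨a, ha.1⟩ ⟨b, hb.1⟩ hab _
      ⟨RelIso.symm ⟨Equiv.ofBijective F hF, ?_⟩⟩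
    rintro (u | x) (v | y)
    · rw [glueCycle_inl_inl]
      exact Iff.rfl
    · exact hcross u y
    · rw [SimpleGraph.adj_comm, (glueCycle (T.induce K) n _ _).adj_comm]
      exact hcross v x
    · rw [glueCycle_inr_inr]
      exact hψadj _ _

lemma TreeOn.isTreeOfCycles {V : Type} {T : SimpleGraph V}
    (hT : TreeOn T Set.univ) (hcard : 3 ≤ Nat.card V) : IsTreeOfCycles T := by
  rcases hT.eq_pair_or_isTreeOfCycles with ⟨a, b, h⟩ | h
  · have : Nat.card V ≤ 2 := by
      rw [← Set.ncard_univ, h]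
      exact (Set.ncard_insert_le a {b}).trans (by rw [Set.ncard_singleton])
    omega
  · exact h.of_iso (SimpleGraph.induceUnivIso T).symm

/-- `T₁` arises from `T₀` by replacing the edge `xy` with a path through `p`. -/
def Subdivides {V : Type} (T₀ T₁ : SimpleGraph V) (x y p : V) : Prop :=
  (∀ u v, u ≠ p → v ≠ p → (T₁.Adj u v ↔ T₀.Adj u v ∧ ¬(u = x ∧ v = y) ∧ ¬(u = y ∧ v = x))) ∧
    ∀ u, T₁.Adj p u ↔ u = x ∨ u = y

lemma Subdivides.isChordlessCycle {V : Type} {T₀ T₁ : SimpleGraph V} {x y p : V}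
    (h : Subdivides T₀ T₁ x y p) (hxy : T₀.Adj x y) {S : Set V} (hS : IsChordlessCycle T₀ S)
    (hp : p ∉ S) (hx : x ∈ S) (hy : y ∈ S) : IsChordlessCycle T₁ (insert p S) := by
  obtain ⟨n, c, hc, rfl, rfl, rfl⟩ := hS.exists_cycSeq hx hy hxy
  have hn := hc.1
  have hcp : ∀ i < n, c i ≠ p := fun i hi hh => hp ⟨i, hi, hh⟩
  have hiff : ∀ i j, i < n → j < n → (c i = c j ↔ i = j) := fun i j hi hj =>
    ⟨hc.injOn hi hj, fun h => by rw [h]⟩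
  refine isChordlessCycle_iff.2 ⟨n + 1, fun i => if i < n then c i else p, ⟨by omega, ?_⟩, ?_⟩
  · intro i j hij hj
    have hi : i < n := by omega
    by_cases hjn : j < n
    · simp only [hi, hjn, if_true]
      refine ⟨(hc.2 i j hij hjn).1, ?_⟩
      rw [h.1 _ _ (hcp i hi) (hcp j hjn), (hc.2 i j hij hjn).2, hiff i _ hi (by omega),
        hiff j _ hjn (by omega), hiff i _ hi (by omega), hiff j _ hjn (by omega)]
      omega
    · simp only [hi, hjn, if_true, if_false]
      refine ⟨hcp i hi, ?_⟩
      rw [T₁.adj_comm, h.2, hiff i _ hi (by omega), hiff i _ hi (by omega)]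
      omega
  · ext z
    constructor
    · rintro (rfl | ⟨i, hi, rfl⟩)
      · exact ⟨n, Nat.lt_succ_self n, if_neg (lt_irrefl n)⟩
      · have hi : i < n := hi
        exact ⟨i, by change i < n + 1; omega, if_pos hi⟩
    · rintro ⟨i, hi, rfl⟩
      dsimp only
      split_ifs with h'
      · exact Or.inr ⟨i, h', rfl⟩
      · exact Or.inl rfl

lemma connOn_of_ear {V : Type} {T : SimpleGraph V} {K S P : Set V} {a b : V}
    (hab : T.Adj a b) (ha : a ∈ K) (hb : b ∈ K)
    (hsep : ∀ z ∈ S, z ∉ K → ∀ w ∈ K, T.Adj z w → w = a ∨ w = b)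
    (hne : (K \ P).Nonempty) (hconn : ConnOn T ((K ∪ S) \ P)) :
    ConnOn T (K \ P) := by
  refine ⟨hne, fun A hA z hz w hw hzA => ?_⟩
  let A' : Set V := {z | z ∈ K ∧ z ∈ A ∨ z ∉ K ∧ ((a ∉ P ∧ a ∈ A) ∨ (b ∉ P ∧ b ∈ A))}
  have hA' : w ∈ A' := by
    refine hconn.2 A' ?_ z ⟨Or.inl hz.1, hz.2⟩ w ⟨Or.inl hw.1, hw.2⟩ (Or.inl ⟨hz.1, hzA⟩)
    rintro u ⟨hu, huP⟩ v ⟨hv, hvP⟩ huv h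
    by_cases huK : u ∈ K
    · have huA : u ∈ A := by
        rcases h with h | h
        · exact h.2
        · exact absurd huK h.1
      by_cases hvK : v ∈ K
      · exact Or.inl ⟨hvK, hA u ⟨huK, huP⟩ v ⟨hvK, hvP⟩ huv huA⟩
      · refine Or.inr ⟨hvK, ?_⟩
        rcases hsep v (hv.resolve_left hvK) hvK u huK huv.symm with rfl | rfl
        · exact Or.inl ⟨huP, huA⟩
        · exact Or.inr ⟨huP, huA⟩
    · have h' := (h.resolve_left fun hh => huK hh.1).2
      by_cases hvK : v ∈ K
      · refine Or.inl ⟨hvK, ?_⟩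
        rcases hsep u (hu.resolve_left huK) huK v hvK huv with rfl | rfl
        · rcases h' with h' | h'
          · exact h'.2
          · exact hA b ⟨hb, h'.1⟩ v ⟨ha, hvP⟩ hab.symm h'.2
        · rcases h' with h' | h'
          · exact hA a ⟨ha, h'.1⟩ v ⟨hb, hvP⟩ hab h'.2
          · exact h'.2
      · exact Or.inr ⟨hvK, h'⟩
  rcases hA' with h | h
  · exact h.2
  · exact absurd hw.1 h.1

lemma TreeOn.subdivide {V : Type} {T₀ T₁ : SimpleGraph V} {x y p : V}
    (h : Subdivides T₀ T₁ x y p) (hxy : T₀.Adj x y) {K : Set V} (hK : TreeOn T₀ K) (hp : p ∉ K)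
    (hx : x ∈ K) (hy : y ∈ K) (hconn : ConnOn T₀ (K \ {x, y})) : TreeOn T₁ (insert p K) := by
  induction hK with
  | edge a b hab =>
    exfalso
    obtain ⟨z, hz, hz'⟩ := hconn.1
    have := hxy.ne
    simp only [Set.mem_insert_iff, Set.mem_singleton_iff] at hx hy hz hz'
    grind
  | ear K S a b hK hS hKS hab hsep ih =>
    have ha : a ∈ K ∩ S := by rw [hKS]; simp
    have hb : b ∈ K ∩ S := by rw [hKS]; simp
    have hpK : p ∉ K := fun h => hp (Or.inl h)
    have hpS : p ∉ S := fun h => hp (Or.inr h)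
    have mem : ∀ w, w ∈ K → w ∈ S → w = a ∨ w = b := fun w h1 h2 => by
      have : w ∈ ({a, b} : Set V) := hKS ▸ ⟨h1, h2⟩
      exact this
    have hT : ∀ Q : Set V, p ∉ Q → ¬ (x ∈ Q ∧ y ∈ Q) →
        ∀ u ∈ Q, ∀ v ∈ Q, T₁.Adj u v ↔ T₀.Adj u v := by
      intro Q hpQ hQ u hu v hv
      rw [h.1 u v (fun hh => hpQ (hh ▸ hu)) (fun hh => hpQ (hh ▸ hv))]
      refine ⟨fun hh => hh.1, fun hh => ⟨hh, ?_, ?_⟩⟩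
      · rintro ⟨rfl, rfl⟩; exact hQ ⟨hu, hv⟩
      · rintro ⟨rfl, rfl⟩; exact hQ ⟨hv, hu⟩
    by_cases hxyK : x ∈ K ∧ y ∈ K
    · by_cases hxyS : x ∈ S ∧ y ∈ S
      · have hpair : ∀ w, w = a ∨ w = b ↔ w = x ∨ w = y := by
          have h1 := mem x hxyK.1 hxyS.1
          have h2 := mem y hxyK.2 hxyS.2
          have h3 := hxy.ne
          grind
        have hsub : K ⊆ S := by
          by_contra hcon
          obtain ⟨u, huK, huS⟩ := Set.not_subset.1 hcon
          obtain ⟨n, c, hc, rfl, hc0, hcn⟩ := hS.exists_cycSeq ha.2 hb.2 hab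
          have hn := hc.1
          have hw : c 1 ∈ c '' {i | i < n} := ⟨1, by change 1 < n; omega, rfl⟩
          have hwa : c 1 ≠ a := fun hh => by
            have := hc.injOn (by omega) (by omega) (hh.trans hc0.symm); omega
          have hwb : c 1 ≠ b := fun hh => by
            have := hc.injOn (by omega) (by omega) (hh.trans hcn.symm); omega
          have hnot : ∀ w, w ∉ ({x, y} : Set V) ↔ ¬ (w = a ∨ w = b) := fun w => by
            rw [hpair]; rfl
          refine huS (hconn.2 (c '' {i | i < n}) ?_ (c 1)
            ⟨Or.inr hw, (hnot _).2 (by tauto)⟩ u ⟨Or.inl huK, (hnot _).2 ?_⟩ hw)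
          · rintro s ⟨hs, hs'⟩ t ⟨ht, ht'⟩ hst hsS
            refine ht.elim (fun htK => ?_) id
            have hsK : s ∉ K := fun hh => (hnot s).1 hs' (mem s hh hsS)
            exact absurd (hsep s hsS hsK t htK hst) ((hnot t).1 ht')
          · rintro (rfl | rfl)
            · exact huS ha.2
            · exact huS hb.2
        rw [Set.union_eq_right.2 hsub]
        exact (h.isChordlessCycle hxy hS hpS hxyS.1 hxyS.2).treeOn
      · have hne : (K \ {x, y}).Nonempty := by
          by_contra hcon
          rw [Set.not_nonempty_iff_eq_empty, Set.sdiff_eq_empty] at hcon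
          have h1 : a = x ∨ a = y := hcon ha.1
          have h2 : b = x ∨ b = y := hcon hb.1
          have h3 := hab.ne
          have h4 := ha.2
          have h5 := hb.2
          grind
        have ih' := ih hpK hxyK.1 hxyK.2
          (connOn_of_ear hab ha.1 hb.1 hsep hne hconn)
        rw [← Set.insert_union]
        refine .ear _ S a b ih' (hS.congr (hT S hpS hxyS)) ?_
          ((hT S hpS hxyS a ha.2 b hb.2).2 hab) ?_
        · rw [Set.insert_inter_of_notMem hpS, hKS]
        · rintro z hz hzK w (rfl | hw) hzw
          · exfalso
            rcases (h.2 z).1 hzw.symm with rfl | rfl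
            · exact hzK (Or.inr hxyK.1)
            · exact hzK (Or.inr hxyK.2)
          · exact hsep z hz (fun hh => hzK (Or.inr hh)) w hw
              ((h.1 z w (fun hh => hpS (hh ▸ hz)) (fun hh => hpK (hh ▸ hw))).1 hzw).1
    · have hxyS : x ∈ S ∧ y ∈ S := by
        have e1 := hsep x
        have e2 := hsep y
        have e3 := hxy.symm
        have := ha.2
        have := hb.2
        grind
      rw [← Set.union_insert]
      refine .ear K _ a b (hK.congr (hT K hpK hxyK))
        (h.isChordlessCycle hxy hS hpS hxyS.1 hxyS.2) ?_ ((hT K hpK hxyK a ha.1 b hb.1).2 hab) ?_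
      · rw [Set.inter_insert_of_notMem hpK, hKS]
      · rintro z (rfl | hz) hzK w hw hzw
        · rcases (h.2 w).1 hzw with rfl | rfl
          · exact mem _ hw hxyS.1
          · exact mem _ hw hxyS.2
        · exact hsep z hz hzK w hw
            ((h.1 z w (fun hh => hpS (hh ▸ hz)) (fun hh => hpK (hh ▸ hw))).1 hzw).1

/-- Deleting `v` and `w` from `G` leaves at least three components: the remaining vertices can be
coloured with exactly three colours such that adjacent vertices get the same colour. -/
def Sep3 {V : Type} (G : SimpleGraph V) (v w : V) : Prop :=
  ∃ φ : V → Fin 3, (∀ x y, x ≠ v → x ≠ w → y ≠ v → y ≠ w → G.Adj x y → φ x = φ y) ∧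
    ∀ k, ∃ x, x ≠ v ∧ x ≠ w ∧ φ x = k

lemma sep3_iff {V : Type} [Finite V] {G : SimpleGraph V} {v w : V} :
    3 ≤ Nat.card ((G.induce {x | x ≠ v ∧ x ≠ w}).ConnectedComponent) ↔ Sep3 G v w := by
  classical
  set G' := G.induce {x | x ≠ v ∧ x ≠ w}
  have : Finite G'.ConnectedComponent := Quot.finite _
  constructor
  · intro h
    have := Fintype.ofFinite G'.ConnectedComponent
    have hcard : Fintype.card (Fin 3) ≤ Fintype.card G'.ConnectedComponent := by
      rwa [Fintype.card_fin, ← Nat.card_eq_fintype_card]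
    obtain ⟨g⟩ := Function.Embedding.nonempty_of_card_le hcard
    refine ⟨fun x => if h : x ≠ v ∧ x ≠ w then
      Function.invFun g (G'.connectedComponentMk ⟨x, h⟩) else 0, ?_, ?_⟩
    · intro x y hx hx' hy hy' hxy
      simp only [dif_pos (And.intro hx hx'), dif_pos (And.intro hy hy')]
      congr 1
      exact SimpleGraph.ConnectedComponent.sound
        (SimpleGraph.Adj.reachable (show G'.Adj ⟨x, hx, hx'⟩ ⟨y, hy, hy'⟩ from hxy))
    · intro k
      obtain ⟨⟨x, hx⟩, hxk⟩ := (g k).exists_rep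
      refine ⟨x, hx.1, hx.2, ?_⟩
      dsimp only
      rw [dif_pos (show x ≠ v ∧ x ≠ w from hx)]
      have : G'.connectedComponentMk ⟨x, hx⟩ = g k := hxk
      rw [this, Function.leftInverse_invFun g.injective]
  · rintro ⟨φ, h1, h2⟩
    have hw : ∀ (x y : {x | x ≠ v ∧ x ≠ w}), G'.Walk x y → φ x.1 = φ y.1 := by
      intro x y p
      induction p with
      | nil => rfl
      | @cons x y z hxy _ ih => exact (h1 _ _ x.2.1 x.2.2 y.2.1 y.2.2 hxy).trans ih
    let g : G'.ConnectedComponent → Fin 3 :=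
      SimpleGraph.ConnectedComponent.lift (fun x => φ x.1) fun x y p _ => hw x y p
    have hg : Function.Surjective g := fun k => by
      obtain ⟨x, hx, hx', hk⟩ := h2 k
      exact ⟨G'.connectedComponentMk ⟨x, hx, hx'⟩, hk⟩
    have := Nat.card_le_card_of_surjective g hg
    rwa [Nat.card_eq_fintype_card, Fintype.card_fin] at this

lemma Sep3.symm {V : Type} {G : SimpleGraph V} {v w : V} (h : Sep3 G v w) : Sep3 G w v := by
  obtain ⟨φ, h1, h2⟩ := h
  refine ⟨φ, fun x y a b c d => h1 x y b a d c, fun k => ?_⟩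
  obtain ⟨x, a, b, c⟩ := h2 k
  exact ⟨x, b, a, c⟩

lemma cellCompletion_adj {V : Type} [Finite V] {G : SimpleGraph V} {v w : V} :
    (cellCompletion G).Adj v w ↔ v ≠ w ∧ (G.Adj v w ∨ Sep3 G v w) := by
  rw [cellCompletion, SimpleGraph.fromRel_adj, sep3_iff, sep3_iff]
  have h1 : Sep3 G w v ↔ Sep3 G v w := ⟨Sep3.symm, Sep3.symm⟩
  rw [h1, G.adj_comm w v]
  tauto

lemma twoConnected_iff {V : Type} {G : SimpleGraph V} :
    TwoConnected G ↔ 3 ≤ Nat.card V ∧ ∀ v, ConnOn G {x | x ≠ v} := by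
  simp only [TwoConnected, connOn_iff]

lemma isChordlessCycle_triangle {V : Type} {T : SimpleGraph V} {a b p : V} (hab : T.Adj a b)
    (hpa : T.Adj p a) (hpb : T.Adj p b) : IsChordlessCycle T {a, b, p} := by
  refine isChordlessCycle_iff.2 ⟨3, fun i => if i = 0 then a else if i = 1 then b else p,
    ⟨le_rfl, fun i j hij hj => ?_⟩, ?_⟩
  · obtain ⟨rfl, rfl⟩ | ⟨rfl, rfl⟩ | ⟨rfl, rfl⟩ :
        (i = 0 ∧ j = 1) ∨ (i = 0 ∧ j = 2) ∨ (i = 1 ∧ j = 2) := by omega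
    · simp [hab, hab.ne]
    · simp [hpa.symm, hpa.ne.symm]
    · simp [hpb.symm, hpb.ne.symm]
  · ext z
    constructor
    · rintro (rfl | rfl | rfl)
      · exact ⟨0, by simp, by simp⟩
      · exact ⟨1, by simp, by simp⟩
      · exact ⟨2, by simp, by simp⟩
    · rintro ⟨i, hi, rfl⟩
      dsimp only
      split_ifs <;> simp

/-- Delete the vertex `p` of degree two and join its two neighbours `a` and `b`. -/
def suppress {V : Type} (G : SimpleGraph V) (p a b : V) : SimpleGraph {x // x ≠ p} :=
  (G ⊔ SimpleGraph.edge a b).comap Subtype.val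

lemma suppress_adj {V : Type} {G : SimpleGraph V} {p a b : V} {x y : {x // x ≠ p}} :
    (suppress G p a b).Adj x y ↔
      G.Adj x y ∨ (x.1 = a ∧ y.1 = b ∨ x.1 = b ∧ y.1 = a) ∧ x.1 ≠ y.1 := by
  simp [suppress, SimpleGraph.edge_adj]

lemma suppress_connOn {V : Type} {G : SimpleGraph V} {p a b : V} (hab : a ≠ b)
    (hpa : G.Adj p a) (hpb : G.Adj p b) (hp : ∀ x, G.Adj p x → x = a ∨ x = b)
    (hG : ∀ v, ConnOn G {x | x ≠ v}) (v : {x // x ≠ p}) :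
    ConnOn (suppress G p a b) {x | x ≠ v} := by
  let a' : {x // x ≠ p} := ⟨a, hpa.ne.symm⟩
  let b' : {x // x ≠ p} := ⟨b, hpb.ne.symm⟩
  have hab' : (suppress G p a b).Adj a' b' :=
    suppress_adj.2 (Or.inr ⟨Or.inl ⟨rfl, rfl⟩, hab⟩)
  refine ⟨?_, fun A hA x hx y hy hxA => ?_⟩
  · by_cases h : a' = v
    · exact ⟨b', fun h' => hab'.ne (h.trans h'.symm)⟩
    · exact ⟨a', h⟩
  let A' : Set V := {z | (∃ h : z ≠ p, (⟨z, h⟩ : {x // x ≠ p}) ∈ A) ∨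
    z = p ∧ ((a' ≠ v ∧ a' ∈ A) ∨ (b' ≠ v ∧ b' ∈ A))}
  have key : y.1 ∈ A' := by
    refine (hG v.1).2 A' ?_ x.1 (fun h => hx (Subtype.ext h)) y.1 (fun h => hy (Subtype.ext h))
      (Or.inl ⟨x.2, hxA⟩)
    intro u hu w hw huw h
    by_cases hup : u = p
    · subst hup
      have h' := (h.resolve_left fun ⟨hh, _⟩ => hh rfl).2
      have hwp : w ≠ u := huw.ne.symm
      refine Or.inl ⟨hwp, ?_⟩
      rcases hp w huw with rfl | rfl
      · rcases h' with h' | h'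
        · exact h'.2
        · exact hA b' h'.1 a' (fun hh => hw (congrArg Subtype.val hh)) hab'.symm h'.2
      · rcases h' with h' | h'
        · exact hA a' h'.1 b' (fun hh => hw (congrArg Subtype.val hh)) hab' h'.2
        · exact h'.2
    · obtain ⟨_, h'⟩ := h.resolve_right fun hh => hup hh.1
      by_cases hwp : w = p
      · subst hwp
        refine Or.inr ⟨rfl, ?_⟩
        rcases hp u huw.symm with rfl | rfl
        · exact Or.inl ⟨fun hh => hu (congrArg Subtype.val hh), h'⟩
        · exact Or.inr ⟨fun hh => hu (congrArg Subtype.val hh), h'⟩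
      · exact Or.inl ⟨hwp, hA ⟨u, hup⟩ (fun hh => hu (congrArg Subtype.val hh)) ⟨w, hwp⟩
          (fun hh => hw (congrArg Subtype.val hh)) (suppress_adj.2 (Or.inl huw)) h'⟩
  rcases key with ⟨_, h⟩ | h
  · exact h
  · exact absurd h.1 y.2

lemma not_sep3_earVertex {V : Type} {G : SimpleGraph V} {p a b : V}
    (hp : ∀ x, G.Adj p x → x = a ∨ x = b) (hG : ∀ v, ConnOn G {x | x ≠ v}) (w : V) : ¬ Sep3 G p w := by
  rintro ⟨φ, h1, h2⟩
  obtain ⟨k, hka, hkb⟩ : ∃ k : Fin 3, k ≠ φ a ∧ k ≠ φ b := by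
    have : ∀ s t : Fin 3, ∃ k, k ≠ s ∧ k ≠ t := by decide
    exact this _ _
  obtain ⟨x, hxp, hxw, hxk⟩ := h2 k
  obtain ⟨y, hyp, hyw, hyk⟩ := h2 (k + 1)
  have hmem := (hG w).2 {z | z ≠ p ∧ φ z = k} ?_ x hxw y hyw ⟨hxp, hxk⟩
  · have h3 := hmem.2
    rw [hyk] at h3
    have : ∀ s : Fin 3, s + 1 ≠ s := by decide
    exact this k h3
  · rintro u hu v hv huv ⟨hup, huk⟩
    have hvp : v ≠ p := by
      rintro rfl
      rcases hp u huv.symm with rfl | rfl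
      · exact hka huk.symm
      · exact hkb huk.symm
    exact ⟨hvp, (h1 u v hup hu hvp hv huv).symm.trans huk⟩

lemma sep3_suppress_iff {V : Type} {G : SimpleGraph V} {p a b : V} (hab : a ≠ b)
    (hpa : G.Adj p a) (hpb : G.Adj p b) (hp : ∀ x, G.Adj p x → x = a ∨ x = b)
    {u w : {x // x ≠ p}} (huw : ¬ (u.1 = a ∧ w.1 = b ∨ u.1 = b ∧ w.1 = a)) :
    Sep3 (suppress G p a b) u w ↔ Sep3 G u w := by
  classical
  let a' : {x // x ≠ p} := ⟨a, hpa.ne.symm⟩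
  let b' : {x // x ≠ p} := ⟨b, hpb.ne.symm⟩
  have hab' : (suppress G p a b).Adj a' b' :=
    suppress_adj.2 (Or.inr ⟨Or.inl ⟨rfl, rfl⟩, hab⟩)
  have hnot : (a ≠ u.1 ∧ a ≠ w.1) ∨ (b ≠ u.1 ∧ b ≠ w.1) := by grind
  constructor
  · rintro ⟨φ, h1, h2⟩
    let ψ : V → Fin 3 := fun x => if h : x ≠ p then φ ⟨x, h⟩ else
      if a ≠ u.1 ∧ a ≠ w.1 then φ a' else φ b'
    have ψp : ψ p = if a ≠ u.1 ∧ a ≠ w.1 then φ a' else φ b' := by simp [ψ]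
    have ψn : ∀ x (h : x ≠ p), ψ x = φ ⟨x, h⟩ := fun x h => by simp [ψ, h]
    have hψ : ∀ y, y ≠ u.1 → y ≠ w.1 → G.Adj p y → ψ p = ψ y := by
      intro y hyu hyw hpy
      rw [ψp, ψn y hpy.ne.symm]
      rcases hp y hpy with rfl | rfl
      · rw [if_pos ⟨hyu, hyw⟩]
      · split_ifs with h
        · exact h1 a' b' (fun hh => h.1 (congrArg Subtype.val hh))
            (fun hh => h.2 (congrArg Subtype.val hh)) (fun hh => hyu (congrArg Subtype.val hh))
            (fun hh => hyw (congrArg Subtype.val hh)) hab'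
        · rfl
    refine ⟨ψ, fun x y hxu hxw hyu hyw hxy => ?_, fun k => ?_⟩
    · by_cases hxp : x = p
      · subst hxp; exact hψ y hyu hyw hxy
      by_cases hyp : y = p
      · subst hyp; exact (hψ x hxu hxw hxy.symm).symm
      rw [ψn x hxp, ψn y hyp]
      exact h1 _ _ (fun hh => hxu (congrArg Subtype.val hh))
        (fun hh => hxw (congrArg Subtype.val hh)) (fun hh => hyu (congrArg Subtype.val hh))
        (fun hh => hyw (congrArg Subtype.val hh)) (suppress_adj.2 (Or.inl hxy))
    · obtain ⟨x, hxu, hxw, hxk⟩ := h2 k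
      exact ⟨x.1, fun hh => hxu (Subtype.ext hh), fun hh => hxw (Subtype.ext hh),
        (ψn x.1 x.2).trans hxk⟩
  · rintro ⟨φ, h1, h2⟩
    refine ⟨fun x => φ x.1, fun x y hxu hxw hyu hyw hxy => ?_, fun k => ?_⟩
    · have hxu' : x.1 ≠ u.1 := fun hh => hxu (Subtype.ext hh)
      have hxw' : x.1 ≠ w.1 := fun hh => hxw (Subtype.ext hh)
      have hyu' : y.1 ≠ u.1 := fun hh => hyu (Subtype.ext hh)
      have hyw' : y.1 ≠ w.1 := fun hh => hyw (Subtype.ext hh)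
      have hxy' : G.Adj x.1 y.1 ∨ G.Adj p x.1 ∧ G.Adj p y.1 := by
        rcases suppress_adj.1 hxy with h | ⟨⟨h, h'⟩ | ⟨h, h'⟩, -⟩
        · exact Or.inl h
        · exact Or.inr ⟨h ▸ hpa, h' ▸ hpb⟩
        · exact Or.inr ⟨h ▸ hpb, h' ▸ hpa⟩
      rcases hxy' with h | ⟨h, h'⟩
      · exact h1 _ _ hxu' hxw' hyu' hyw' h
      · exact (h1 p _ u.2.symm w.2.symm hxu' hxw' h).symm.trans
          (h1 p _ u.2.symm w.2.symm hyu' hyw' h')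
    · obtain ⟨x, hxu, hxw, hxk⟩ := h2 k
      by_cases hxp : x = p
      · subst hxp
        rcases hnot with h | h
        · exact ⟨a', fun hh => h.1 (congrArg Subtype.val hh),
            fun hh => h.2 (congrArg Subtype.val hh),
            (h1 x a hxu hxw h.1 h.2 hpa).symm.trans hxk⟩
        · exact ⟨b', fun hh => h.1 (congrArg Subtype.val hh),
            fun hh => h.2 (congrArg Subtype.val hh),
            (h1 x b hxu hxw h.1 h.2 hpb).symm.trans hxk⟩
      · exact ⟨⟨x, hxp⟩, fun hh => hxu (congrArg Subtype.val hh),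
          fun hh => hxw (congrArg Subtype.val hh), hxk⟩

lemma cellCompletion_suppress_adj {V : Type} [Finite V] {G : SimpleGraph V} {p a b : V} (hab : a ≠ b)
    (hpa : G.Adj p a) (hpb : G.Adj p b) (hp : ∀ x, G.Adj p x → x = a ∨ x = b)
    {u w : {x // x ≠ p}}
    (huw : ¬ (u.1 = a ∧ w.1 = b ∨ u.1 = b ∧ w.1 = a)) :
    (cellCompletion (suppress G p a b)).Adj u w ↔ (cellCompletion G).Adj u w := by
  rw [cellCompletion_adj, cellCompletion_adj, sep3_suppress_iff hab hpa hpb hp huw, suppress_adj]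
  have : u ≠ w ↔ u.1 ≠ w.1 := Subtype.ext_iff.not
  tauto

lemma cellCompletion_earVertex_adj {V : Type} [Finite V] {G : SimpleGraph V} {p a b : V}
    (hpa : G.Adj p a) (hpb : G.Adj p b) (hp : ∀ x, G.Adj p x → x = a ∨ x = b)
    (hG : ∀ v, ConnOn G {x | x ≠ v}) {w : V} :
    (cellCompletion G).Adj p w ↔ w = a ∨ w = b := by
  rw [cellCompletion_adj]
  constructor
  · rintro ⟨-, h | h⟩
    · exact hp w h
    · exact absurd h (not_sep3_earVertex hp hG w)
  · rintro (rfl | rfl)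
    · exact ⟨hpa.ne, Or.inl hpa⟩
    · exact ⟨hpb.ne, Or.inl hpb⟩

lemma IsChordal.comap_val {V : Type} {H : SimpleGraph V} (hH : IsChordal H) (P : V → Prop) :
    IsChordal (H.comap (Subtype.val : {x // P x} → V)) := by
  rw [isChordal_iff] at hH ⊢
  intro n c hn hc
  exact hH n (fun i => (c i).1) hn
    ⟨hc.1, fun i j hij hj => ⟨fun h => (hc.2 i j hij hj).1 (Subtype.ext h), (hc.2 i j hij hj).2⟩⟩

/-- In a 2-connected graph of treewidth at most two, the cell completion is an edge with
successively attached cycles, and it is contained in every chordal completion. -/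
lemma cellCompletion_treeOn_and_le : ∀ (n : ℕ) (V : Type) [Finite V] (G H : SimpleGraph V),
    Nat.card V = n → G ≤ H → 3 ≤ Nat.card V → (∀ v, ConnOn G {x | x ≠ v}) → IsChordal H →
    H.CliqueFree 4 → TreeOn (cellCompletion G) Set.univ ∧ cellCompletion G ≤ H := by
  intro n
  induction n with
  | zero => intros; omega
  | succ n ih =>
    intro V _ G H hVn hGH hcard hG hH hK
    obtain ⟨p, a, b, hab, hpa, hpb, habH, hpH⟩ := exists_ear_vertex hGH hcard hG hH hK
    have hp : ∀ x, G.Adj p x → x = a ∨ x = b := fun x hx => hpH x (hGH hx)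
    have hTp : ∀ w, (cellCompletion G).Adj p w ↔ w = a ∨ w = b := fun w =>
      cellCompletion_earVertex_adj hpa hpb hp hG
    have hTpa := (hTp a).2 (Or.inl rfl)
    have hTpb := (hTp b).2 (Or.inr rfl)
    have hap := hpa.ne.symm
    have hbp := hpb.ne.symm
    have hcard' : Nat.card {x // x ≠ p} = n := by
      have h1 := Set.ncard_sdiff_singleton_of_mem (Set.mem_univ p)
      rw [Set.ncard_univ, hVn] at h1
      have h2 : (Set.univ \ {p} : Set V) = {x | x ≠ p} := by ext; simp
      rw [h2] at h1
      exact h1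
    by_cases hn : n < 3
    · have hall : ∀ z, z = p ∨ z = a ∨ z = b := by
        intro z
        by_contra hz
        push Not at hz
        have h1 : ({p, a, b, z} : Set V).ncard ≤ Nat.card V := by
          rw [← Set.ncard_univ]; exact Set.ncard_le_ncard (Set.subset_univ _)
        have h2 : ({p, a, b, z} : Set V).ncard = 4 := by
          rw [Set.ncard_insert_of_notMem, Set.ncard_insert_of_notMem, Set.ncard_pair hz.2.2.symm]
          · simp [hab, hz.2.1.symm]
          · simp [hap.symm, hbp.symm, hz.1.symm]
        omega
      have hGab : G.Adj a b := by
        by_contra hcon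
        refine hab ((hG p).2 {z | z = a} ?_ a hap b hbp rfl).symm
        rintro x hx y hy hxy rfl
        rcases hall y with rfl | rfl | rfl
        · exact absurd rfl hy
        · rfl
        · exact absurd hxy hcon
      have hTab : (cellCompletion G).Adj a b := cellCompletion_adj.2 ⟨hab, Or.inl hGab⟩
      have huniv : (Set.univ : Set V) = {a, b, p} := by
        ext z
        have := hall z
        simp only [Set.mem_univ, Set.mem_insert_iff, Set.mem_singleton_iff, true_iff]
        tauto
      refine ⟨?_, fun u w huw => ?_⟩
      · rw [huniv]
        exact (isChordlessCycle_triangle hTab hTpa hTpb).treeOn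
      · have h1 := huw.ne
        have h2 := hGH hpa
        have h3 := hGH hpb
        have := h2.symm
        have := h3.symm
        have := habH.symm
        rcases hall u with rfl | rfl | rfl <;> rcases hall w with rfl | rfl | rfl <;>
          first | assumption | exact absurd rfl h1
    set G' := suppress G p a b with hG'
    have hle : G' ≤ H.comap (Subtype.val : {x // x ≠ p} → V) := by
      intro x y hxy
      rcases suppress_adj.1 hxy with h | ⟨⟨h, h'⟩ | ⟨h, h'⟩, -⟩
      · exact hGH h
      · change H.Adj x.1 y.1
        rw [h, h']; exact habH
      · change H.Adj x.1 y.1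
        rw [h, h']; exact habH.symm
    obtain ⟨hT', hT'H⟩ := ih {x // x ≠ p} G' _ hcard' hle (by omega)
      (suppress_connOn hab hpa hpb hp hG) (hH.comap_val _) (by
        rw [cliqueFree_four_iff] at hK ⊢
        intro w x y z h1 h2 h3 h4 h5 h6
        exact hK w.1 x.1 y.1 z.1 h1 h2 h3 h4 h5 h6)
    have hT'adj : ∀ u w : {x // x ≠ p}, ¬ (u.1 = a ∧ w.1 = b ∨ u.1 = b ∧ w.1 = a) →
        ((cellCompletion G').Adj u w ↔ (cellCompletion G).Adj u w) := fun u w =>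
      cellCompletion_suppress_adj hab hpa hpb hp
    have hT'ab : (cellCompletion G').Adj ⟨a, hap⟩ ⟨b, hbp⟩ :=
      cellCompletion_adj.2 ⟨fun h => hab (congrArg Subtype.val h),
        Or.inl (suppress_adj.2 (Or.inr ⟨Or.inl ⟨rfl, rfl⟩, hab⟩))⟩
    have huniv : (Set.univ : Set V) = insert p {x | x ≠ p} := by
      ext z; simp [em]
    have hrange : (Subtype.val '' (Set.univ : Set {x // x ≠ p})) = {x | x ≠ p} := by
      simp
    constructor
    · by_cases hTab : (cellCompletion G).Adj a b
      · have hKT : TreeOn (cellCompletion G) {x | x ≠ p} := by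
          rw [← hrange]
          refine hT'.image _ Subtype.val_injective.injOn fun u _ w _ => ?_
          by_cases h : u.1 = a ∧ w.1 = b ∨ u.1 = b ∧ w.1 = a
          · rcases h with ⟨h, h'⟩ | ⟨h, h'⟩
            · have e1 : u = ⟨a, hap⟩ := Subtype.ext h
              have e2 : w = ⟨b, hbp⟩ := Subtype.ext h'
              rw [e1, e2]
              exact iff_of_true hTab hT'ab
            · have e1 : u = ⟨b, hbp⟩ := Subtype.ext h
              have e2 : w = ⟨a, hap⟩ := Subtype.ext h'
              rw [e1, e2]
              exact iff_of_true hTab.symm hT'ab.symm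
          · exact (hT'adj u w h).symm
        have := TreeOn.ear _ {a, b, p} a b hKT (isChordlessCycle_triangle hTab hTpa hTpb) (by
          ext z
          simp only [Set.mem_inter_iff, Set.mem_ofPred_eq, Set.mem_insert_iff,
            Set.mem_singleton_iff]
          grind) hTab (by
          intro z hz hzp w hw hzw
          obtain rfl : z = p := by
            by_contra h; exact hzp h
          exact (hTp w).1 hzw)
        convert this using 1
        ext z
        simp only [Set.mem_univ, Set.mem_union, Set.mem_ofPred_eq, Set.mem_insert_iff,
          Set.mem_singleton_iff, true_iff]
        tauto
      · let T₀ : SimpleGraph V := (cellCompletion G').map (Function.Embedding.subtype _)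
        have hT₀ : ∀ u w : {x // x ≠ p}, T₀.Adj u.1 w.1 ↔ (cellCompletion G').Adj u w := fun u w =>
          SimpleGraph.map_adj_apply (f := Function.Embedding.subtype _)
        have hKT : TreeOn T₀ {x | x ≠ p} := by
          rw [← hrange]
          exact hT'.image _ Subtype.val_injective.injOn fun u _ w _ => hT₀ u w
        have hsub : Subdivides T₀ (cellCompletion G) a b p := by
          refine ⟨fun u w hu hw => ?_, hTp⟩
          rw [hT₀ ⟨u, hu⟩ ⟨w, hw⟩]
          by_cases h : u = a ∧ w = b ∨ u = b ∧ w = a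
          · refine iff_of_false (fun hh => ?_) (fun hh => by tauto)
            rcases h with ⟨rfl, rfl⟩ | ⟨rfl, rfl⟩
            · exact hTab hh
            · exact hTab hh.symm
          · rw [hT'adj ⟨u, hu⟩ ⟨w, hw⟩ h]
            tauto
        rw [huniv]
        refine hKT.subdivide hsub ((hT₀ ⟨a, hap⟩ ⟨b, hbp⟩).2 hT'ab) (fun h => h rfl) hap hbp ?_
        by_contra hconn
        refine hTab (cellCompletion_adj.2 ⟨hab, Or.inr ?_⟩)
        have hne : ({x | x ≠ p} \ {a, b} : Set V).Nonempty := by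
          by_contra hcon
          rw [Set.not_nonempty_iff_eq_empty, Set.sdiff_eq_empty] at hcon
          have h1 := Set.ncard_le_ncard hcon
          have h2 : ({a, b} : Set V).ncard = 2 := Set.ncard_pair hab
          have h3 : ({x | x ≠ p} : Set V).ncard = n := hcard'
          omega
        have hnc : ∃ A : Set V, (∀ x ∈ ({x | x ≠ p} \ {a, b} : Set V),
            ∀ y ∈ ({x | x ≠ p} \ {a, b} : Set V), T₀.Adj x y → x ∈ A → y ∈ A) ∧
            ∃ x ∈ ({x | x ≠ p} \ {a, b} : Set V), ∃ y ∈ ({x | x ≠ p} \ {a, b} : Set V),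
              x ∈ A ∧ y ∉ A := by
          by_contra hcon
          refine hconn ⟨hne, fun A hA x hx y hy hxA => ?_⟩
          by_contra hyA
          exact hcon ⟨A, hA, x, hx, y, hy, hxA, hyA⟩
        obtain ⟨A, hA, x, hx, y, hy, hxA, hyA⟩ := hnc
        classical
        refine ⟨fun z => if z = p then 0 else if z ∈ A then 1 else 2, ?_, ?_⟩
        · intro u w hua hub hwa hwb huw
          have hup : u ≠ p := by
            rintro rfl
            rcases hp w huw with h | h
            · exact hwa h
            · exact hwb h
          have hwp : w ≠ p := by
            rintro rfl
            rcases hp u huw.symm with h | h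
            · exact hua h
            · exact hub h
          have hadj : T₀.Adj u w := (hT₀ ⟨u, hup⟩ ⟨w, hwp⟩).2 (cellCompletion_adj.2
            ⟨fun h => huw.ne (congrArg Subtype.val h), Or.inl (suppress_adj.2 (Or.inl huw))⟩)
          have hu : u ∈ ({x | x ≠ p} \ {a, b} : Set V) := ⟨hup, by rintro (h | h) <;> tauto⟩
          have hw : w ∈ ({x | x ≠ p} \ {a, b} : Set V) := ⟨hwp, by rintro (h | h) <;> tauto⟩
          have hiff : u ∈ A ↔ w ∈ A := ⟨hA u hu w hw hadj, hA w hw u hu hadj.symm⟩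
          simp only [hup, hwp, hiff]
        · intro k
          have nab : ∀ z, z ∈ ({x | x ≠ p} \ {a, b} : Set V) → z ≠ a ∧ z ≠ b := fun z hz =>
            ⟨fun h => hz.2 (Or.inl h), fun h => hz.2 (Or.inr h)⟩
          have hxp : x ≠ p := hx.1
          have hyp : y ≠ p := hy.1
          fin_cases k
          · exact ⟨p, hap.symm, hbp.symm, by simp⟩
          · exact ⟨x, (nab x hx).1, (nab x hx).2, by simp [hxp, hxA]⟩
          · exact ⟨y, (nab y hy).1, (nab y hy).2, by simp [hyp, hyA]⟩
    · intro u w huw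
      by_cases hup : u = p
      · subst hup
        rcases (hTp w).1 huw with rfl | rfl
        · exact hGH hpa
        · exact hGH hpb
      by_cases hwp : w = p
      · subst hwp
        rcases (hTp u).1 huw.symm with rfl | rfl
        · exact (hGH hpa).symm
        · exact (hGH hpb).symm
      by_cases h : u = a ∧ w = b ∨ u = b ∧ w = a
      · rcases h with ⟨rfl, rfl⟩ | ⟨rfl, rfl⟩
        · exact habH
        · exact habH.symm
      · exact hT'H ((hT'adj ⟨u, hup⟩ ⟨w, hwp⟩ h).2 huw)

lemma IsEdgeSeparator.exists_common_neighbor {V : Type} [Finite V] {T H : SimpleGraph V}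
    (hT : TreeOn T Set.univ) (hTH : T ≤ H) (hH : IsChordal H) {S : Set V}
    (hS : IsChordlessCycle T S) {u v : V} (hu : u ∈ S) (hv : v ∈ S) (h : IsEdgeSeparator T u v) :
    ∃ w, H.Adj w u ∧ H.Adj w v ∧ w ∉ S := by
  obtain ⟨huv, S₁, S₂, hne, h₁, h₂, hu₁, hv₁, hu₂, hv₂⟩ := h
  obtain ⟨R, hR, hRS, huR, hvR⟩ : ∃ R, IsChordlessCycle T R ∧ R ≠ S ∧ u ∈ R ∧ v ∈ R := by
    by_cases h : S₁ = S
    · exact ⟨S₂, h₂, fun h' => hne (h.trans h'.symm), hu₂, hv₂⟩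
    · exact ⟨S₁, h₁, h, hu₁, hv₁⟩
  obtain ⟨n, c, hc, rfl, rfl, rfl⟩ := hR.exists_cycSeq huR hvR huv
  have hn := hc.1
  have hadj : ∀ i, i + 1 < n → H.Adj (c i) (c (i + 1)) := fun i hi => hTH (hc.adj_succ hi)
  have hne : ∀ i, 0 < i → i < n - 1 → c 0 ≠ c i ∧ c (n - 1) ≠ c i := fun i h0 hi =>
    ⟨(hc.2 0 i h0 (by omega)).1, (hc.2 i (n - 1) hi (by omega)).1.symm⟩
  obtain ⟨w, ⟨i, ⟨hi0, hi⟩, rfl⟩, hw1, hw2⟩ := hH.exists_common_neighbor (hTH huv)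
    (connOn_image_Ioo hadj (l := 0) (r := n - 1) (by omega) (by omega))
    (by rintro ⟨i, ⟨h0, hi⟩, h⟩; exact (hne i h0 hi).1 h.symm)
    (by rintro ⟨i, ⟨h0, hi⟩, h⟩; exact (hne i h0 hi).2 h.symm)
    ⟨c 1, ⟨1, ⟨by omega, by omega⟩, rfl⟩, hadj 0 (by omega)⟩
    ⟨c (n - 2), ⟨n - 2, ⟨by omega, by omega⟩, rfl⟩, by
      have := hadj (n - 2) (by omega)
      rw [show n - 2 + 1 = n - 1 by omega] at this
      exact this.symm⟩
  refine ⟨c i, hw1.symm, hw2.symm, fun hiS => hRS ?_⟩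
  exact hT.eq_of_three _ _ hR hS (Set.subset_univ _) (Set.subset_univ _) _ _ _ huv.ne
    (hne i hi0 hi).2 (hne i hi0 hi).1 huR hu hvR hv
    ⟨i, by simp only [Set.mem_ofPred_eq]; omega, rfl⟩ hiS

/-- If a strongly chordal graph without `K₄` contains a tree of cycles, then every chordless cycle
of the latter has at most two edge separators. -/
lemma TreeOn.ncard_edgeSeparator_le_two {V : Type} [Finite V] {T H : SimpleGraph V}
    (hT : TreeOn T Set.univ) (hTH : T ≤ H) (hH : IsChordal H) (hS : SunFree H) {S : Set V}
    (hC : IsChordlessCycle T S) :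
    {e : Sym2 V | ∃ u v : V, e = s(u, v) ∧ u ∈ S ∧ v ∈ S ∧ IsEdgeSeparator T u v}.ncard ≤ 2 := by
  by_contra hcon
  push Not at hcon
  obtain ⟨_, ⟨u₁, v₁, rfl, hu₁, hv₁, h₁⟩, _, ⟨u₂, v₂, rfl, hu₂, hv₂, h₂⟩,
    _, ⟨u₃, v₃, rfl, hu₃, hv₃, h₃⟩, h12, h13, h23⟩ := (Set.two_lt_ncard).1 hcon
  obtain ⟨w₁, hw₁⟩ := h₁.exists_common_neighbor hT hTH hH hC hu₁ hv₁
  obtain ⟨w₂, hw₂⟩ := h₂.exists_common_neighbor hT hTH hH hC hu₂ hv₂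
  obtain ⟨w₃, hw₃⟩ := h₃.exists_common_neighbor hT hTH hH hC hu₃ hv₃
  obtain ⟨n, c, hc, rfl, rfl, rfl⟩ := hC.exists_cycSeq hu₁ hv₁ h₁.1
  have hn := hc.1
  have hpos : ∀ u v : V, u ∈ c '' {i | i < n} → v ∈ c '' {i | i < n} → T.Adj u v →
      s(c 0, c (n - 1)) ≠ s(u, v) → ∃ i, i + 1 < n ∧ s(u, v) = s(c i, c (i + 1)) := by
    have key : ∀ i j, i < j → j < n → T.Adj (c i) (c j) → s(c 0, c (n - 1)) ≠ s(c i, c j) →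
        ∃ k, k + 1 < n ∧ s(c i, c j) = s(c k, c (k + 1)) := by
      intro i j hij hj hadj hne
      rcases (hc.2 i j hij hj).2.1 hadj with rfl | ⟨rfl, hj'⟩
      · exact ⟨i, hj, rfl⟩
      · obtain rfl : j = n - 1 := by omega
        exact absurd rfl hne
    rintro _ _ ⟨i, hi, rfl⟩ ⟨j, hj, rfl⟩ hadj hne
    rcases lt_trichotomy i j with h | rfl | h
    · exact key i j h hj hadj hne
    · exact absurd rfl hadj.ne
    · rw [Sym2.eq_swap (a := c i)] at hne ⊢
      exact key j i h hi hadj.symm hne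
  obtain ⟨i, hi, hi'⟩ := hpos u₂ v₂ hu₂ hv₂ h₂.1 h12
  obtain ⟨j, hj, hj'⟩ := hpos u₃ v₃ hu₃ hv₃ h₃.1 h13
  have out : ∀ w u v k, (H.Adj w u ∧ H.Adj w v ∧ w ∉ c '' {i | i < n}) →
      s(u, v) = s(c k, c (k + 1)) →
      ∃ w, H.Adj w (c k) ∧ H.Adj w (c (k + 1)) ∧ ∀ t < n, w ≠ c t := by
    rintro w u v k ⟨ha, hb, hw⟩ hk
    refine ⟨w, ?_, ?_, fun t ht h => hw ⟨t, ht, h.symm⟩⟩ <;>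
      rcases Sym2.eq_iff.1 hk with ⟨rfl, rfl⟩ | ⟨rfl, rfl⟩ <;> assumption
  have o₂ := out w₂ u₂ v₂ i hw₂ hi'
  have o₃ := out w₃ u₃ v₃ j hw₃ hj'
  have hfin := hS.not_two_outer hH (fun i j hij hj => (hc.2 i j hij hj).1)
    (fun i hi => hTH (hc.adj_succ hi)) n 0 (n - 1) (by omega) (by omega) (hTH h₁.1)
    ⟨w₁, hw₁.1, hw₁.2.1, fun t _ ht h => hw₁.2.2
      ⟨t, by simp only [Set.mem_ofPred_eq]; omega, h.symm⟩⟩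
  rcases lt_trichotomy i j with h | rfl | h
  · exact hfin i j (by omega) h (by omega) o₂ o₃
  · exact h23 (hi'.trans hj'.symm)
  · exact hfin j i (by omega) h (by omega) o₃ o₂

/-- `H` lives on `K`, is chordal, has no `K₄`, and each of its triangles has an edge which is not
marked by `M` and which lies in no other triangle. -/
structure IsMarkedFill {V : Type} (H : SimpleGraph V) (K : Set V) (M : V → V → Prop) : Prop where
  mem : ∀ u v, H.Adj u v → u ∈ K
  chordal : IsChordal H
  cliqueFree : H.CliqueFree 4
  free : ∀ x y z, H.Adj x y → H.Adj y z → H.Adj x z →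
    (¬ M x y ∧ ∀ w, H.Adj w x → H.Adj w y → w = z) ∨
    (¬ M y z ∧ ∀ w, H.Adj w y → H.Adj w z → w = x) ∨
    (¬ M x z ∧ ∀ w, H.Adj w x → H.Adj w z → w = y)

lemma IsMarkedFill.sunFree {V : Type} {H : SimpleGraph V} {K : Set V} {M : V → V → Prop}
    (h : IsMarkedFill H K M) : SunFree H := by
  intro x y z u₁ u₂ u₃ hxy hyz hxz h1x h1y h2y h2z h3x h3z n1 n2 n3
  rcases h.free x y z hxy hyz hxz with ⟨-, h⟩ | ⟨-, h⟩ | ⟨-, h⟩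
  · exact n1 (h _ h1x h1y)
  · exact n2 (h _ h2y h2z)
  · exact n3 (h _ h3x h3z)

lemma IsMarkedFill.congr {V : Type} {H : SimpleGraph V} {K : Set V} {M M' : V → V → Prop}
    (h : IsMarkedFill H K M) (hM : ∀ x ∈ K, ∀ y ∈ K, M' x y → M x y) : IsMarkedFill H K M' := by
  refine ⟨h.mem, h.chordal, h.cliqueFree, fun x y z hxy hyz hxz => ?_⟩
  have hx := h.mem _ _ hxy
  have hy := h.mem _ _ hyz
  have hz := h.mem _ _ hxz.symm
  exact (h.free x y z hxy hyz hxz).imp (And.imp_left fun hn hm => hn (hM _ hx _ hy hm))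
    (Or.imp (And.imp_left fun hn hm => hn (hM _ hy _ hz hm))
      (And.imp_left fun hn hm => hn (hM _ hx _ hz hm)))

/-- The graph `H` together with edges from `p` to `a` and `b`. -/
def addApex {V : Type} (H : SimpleGraph V) (p a b : V) : SimpleGraph V :=
  SimpleGraph.fromRel (fun u v => H.Adj u v ∨ (u = p ∧ (v = a ∨ v = b)))

lemma addApex_adj_apex {V : Type} {H : SimpleGraph V} {p a b v : V} (hp : ∀ v, ¬ H.Adj p v)
    (ha : p ≠ a) (hb : p ≠ b) : (addApex H p a b).Adj p v ↔ v = a ∨ v = b := by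
  rw [addApex, SimpleGraph.fromRel_adj]
  have := hp v
  have : ¬ H.Adj v p := fun h => hp v h.symm
  constructor
  · tauto
  · rintro (rfl | rfl) <;> tauto

lemma addApex_adj_of_ne {V : Type} {H : SimpleGraph V} {p a b u v : V} (hu : u ≠ p) (hv : v ≠ p) :
    (addApex H p a b).Adj u v ↔ H.Adj u v := by
  rw [addApex, SimpleGraph.fromRel_adj]
  have h1 := H.adj_comm u v
  have h2 : H.Adj u v → u ≠ v := fun h => h.ne
  tauto

lemma IsMarkedFill.addApex {V : Type} {H : SimpleGraph V} {K : Set V} {M : V → V → Prop}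
    (h : IsMarkedFill H K M) (hM : ∀ x y, M x y → M y x) {p a b : V} (hp : p ∉ K)
    (hab : H.Adj a b) (hMab : M a b) (hpM : ¬ M p a ∨ ¬ M p b) :
    H ≤ addApex H p a b ∧ IsMarkedFill (addApex H p a b) (insert p K) M := by
  have hpH : ∀ v, ¬ H.Adj p v := fun v hv => hp (h.mem _ _ hv)
  have hpa : p ≠ a := fun e => hp (e ▸ h.mem _ _ hab)
  have hpb : p ≠ b := fun e => hp (e ▸ h.mem _ _ hab.symm)
  have hA : ∀ v, (_root_.addApex H p a b).Adj p v ↔ v = a ∨ v = b := fun v =>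
    addApex_adj_apex hpH hpa hpb
  have hA' : ∀ u v, u ≠ p → v ≠ p → ((_root_.addApex H p a b).Adj u v ↔ H.Adj u v) := fun u v =>
    addApex_adj_of_ne
  have hle : H ≤ _root_.addApex H p a b := fun u v huv =>
    (hA' u v (fun e => hpH v (e ▸ huv)) (fun e => hpH u (e ▸ huv.symm))).2 huv
  generalize _root_.addApex H p a b = H' at hA hA' hle
  have hpa' := (hA a).2 (Or.inl rfl)
  have hpb' := (hA b).2 (Or.inr rfl)
  have hab' := hle hab
  refine ⟨hle, ⟨fun u v huv => ?_, ?_, ?_, ?_⟩⟩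
  · by_cases hu : u = p
    · exact Or.inl hu
    · right
      by_cases hv : v = p
      · subst hv
        rcases (hA u).1 huv.symm with rfl | rfl
        · exact h.mem _ _ hab
        · exact h.mem _ _ hab.symm
      · exact h.mem _ _ ((hA' u v hu hv).1 huv)
  · rw [isChordal_iff]
    intro n c hn hc
    have hS := isChordlessCycle_iff.2 ⟨n, c, hc, rfl⟩
    by_cases hpS : p ∈ c '' {i | i < n}
    · obtain ⟨y, hy, z, hz, hyz, hpy, hpz, -⟩ := hS.exists_two_neighbors hpS
      have hyz' : H'.Adj y z := by
        rcases (hA y).1 hpy with rfl | rfl <;> rcases (hA z).1 hpz with rfl | rfl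
        · exact absurd rfl hyz
        · exact hab'
        · exact hab'.symm
        · exact absurd rfl hyz
      have heq := (isChordlessCycle_triangle hyz' hpy hpz).eq_of_subset hS (by
        rintro x (rfl | rfl | rfl) <;> assumption)
      have hmem : ∀ i, i < n → c i = y ∨ c i = z ∨ c i = p := fun i hi => by
        have : c i ∈ ({y, z, p} : Set V) := heq ▸ ⟨i, hi, rfl⟩
        exact this
      have h0 := hmem 0 (by omega)
      have h1 := hmem 1 (by omega)
      have h2 := hmem 2 (by omega)
      have h3 := hmem 3 (by omega)
      have := (hc.2 0 1 (by omega) (by omega)).1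
      have := (hc.2 0 2 (by omega) (by omega)).1
      have := (hc.2 0 3 (by omega) (by omega)).1
      have := (hc.2 1 2 (by omega) (by omega)).1
      have := (hc.2 1 3 (by omega) (by omega)).1
      have := (hc.2 2 3 (by omega) (by omega)).1
      grind
    · have hne : ∀ i, i < n → c i ≠ p := fun i hi e => hpS ⟨i, hi, e⟩
      exact isChordal_iff.1 h.chordal n c hn ⟨hc.1, fun i j hij hj =>
        ⟨(hc.2 i j hij hj).1, (hA' _ _ (hne i (by omega)) (hne j hj)).symm.trans
          (hc.2 i j hij hj).2⟩⟩
  · rw [cliqueFree_four_iff]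
    have key : ∀ x y z, H'.Adj p x → H'.Adj p y → H'.Adj p z → H'.Adj x y → H'.Adj y z →
        H'.Adj x z → False := by
      intro x y z hx hy hz hxy hyz hxz
      have h1 := hxy.ne
      have h2 := hyz.ne
      have h3 := hxz.ne
      rw [hA] at hx hy hz
      grind
    intro x y z w hxy hxz hxw hyz hyw hzw
    by_cases hx : x = p
    · subst hx; exact key _ _ _ hxy hxz hxw hyz hzw hyw
    by_cases hy : y = p
    · subst hy; exact key _ _ _ hxy.symm hyz hyw hxz hzw hxw
    by_cases hz : z = p
    · subst hz; exact key _ _ _ hxz.symm hyz.symm hzw hxy hyw hxw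
    by_cases hw : w = p
    · subst hw; exact key _ _ _ hxw.symm hyw.symm hzw.symm hxy hyz hxz
    rw [hA' _ _ ‹_› ‹_›] at hxy hxz hxw hyz hyw hzw
    exact cliqueFree_four_iff.1 h.cliqueFree x y z w hxy hxz hxw hyz hyw hzw
  · have hfree : ∀ x y z, H.Adj x y → (¬ M x y ∧ ∀ w, H.Adj w x → H.Adj w y → w = z) →
        (¬ M x y ∧ ∀ w, H'.Adj w x → H'.Adj w y → w = z) := by
      rintro x y z hxy ⟨hm, hu⟩
      have hx : x ≠ p := fun e => hpH y (e ▸ hxy)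
      have hy : y ≠ p := fun e => hpH x (e ▸ hxy.symm)
      refine ⟨hm, fun w hwx hwy => ?_⟩
      by_cases hw : w = p
      · subst hw
        have := hxy.ne
        rcases (hA x).1 hwx with rfl | rfl <;> rcases (hA y).1 hwy with rfl | rfl
        · exact absurd rfl this
        · exact absurd hMab hm
        · exact absurd (hM _ _ hMab) hm
        · exact absurd rfl this
      · exact hu w ((hA' _ _ hw hx).1 hwx) ((hA' _ _ hw hy).1 hwy)
    have hfreep : ∀ x y, H'.Adj p x → H'.Adj p y → x ≠ y →
        (¬ M p x ∧ ∀ w, H'.Adj w p → H'.Adj w x → w = y) ∨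
        (¬ M p y ∧ ∀ w, H'.Adj w p → H'.Adj w y → w = x) := by
      intro x y hpx hpy hxy
      have u1 : ∀ w, H'.Adj w p → H'.Adj w x → w = y := by
        intro w hwp hwx
        have := hwx.ne
        have := (hA w).1 hwp.symm
        rw [hA] at hpx hpy
        grind
      have u2 : ∀ w, H'.Adj w p → H'.Adj w y → w = x := by
        intro w hwp hwx
        have := hwx.ne
        have := (hA w).1 hwp.symm
        rw [hA] at hpx hpy
        grind
      have : ¬ M p x ∨ ¬ M p y := by
        rw [hA] at hpx hpy
        grind
      exact this.imp (fun h => ⟨h, u1⟩) (fun h => ⟨h, u2⟩)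
    intro x y z hxy hyz hxz
    have sw : ∀ x y z, (¬ M x y ∧ ∀ w, H'.Adj w x → H'.Adj w y → w = z) →
        (¬ M y x ∧ ∀ w, H'.Adj w y → H'.Adj w x → w = z) := fun x y z h =>
      ⟨fun hm => h.1 (hM _ _ hm), fun w h1 h2 => h.2 w h2 h1⟩
    by_cases hx : x = p
    · subst hx
      exact (hfreep y z hxy hxz hyz.ne).imp id Or.inr
    by_cases hy : y = p
    · subst hy
      rcases hfreep x z hxy.symm hyz hxz.ne with h | h
      · exact Or.inl (sw _ _ _ h)
      · exact Or.inr (Or.inl h)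
    by_cases hz : z = p
    · subst hz
      rcases hfreep x y hxz.symm hyz.symm hxy.ne with h | h
      · exact Or.inr (Or.inr (sw _ _ _ h))
      · exact Or.inr (Or.inl (sw _ _ _ h))
    rw [hA' _ _ ‹_› ‹_›] at hxy hxz hyz
    exact (h.free x y z hxy hyz hxz).imp (hfree _ _ _ hxy)
      (Or.imp (hfree _ _ _ hyz) (hfree _ _ _ hxz))

/-- Attaching a path with at most one marked edge along a marked edge of a marked fill. -/
lemma IsMarkedFill.exists_ear {V : Type} : ∀ (k : ℕ) (H : SimpleGraph V) (K : Set V)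
    (M : V → V → Prop) (d : ℕ → V), IsMarkedFill H K M → (∀ x y, M x y → M y x) →
    H.Adj (d 0) (d (k + 1)) → M (d 0) (d (k + 1)) →
    (∀ i j, i < j → j ≤ k + 1 → d i ≠ d j) → (∀ i, 0 < i → i ≤ k → d i ∉ K) →
    (∀ i j, i ≤ k → j ≤ k → M (d i) (d (i + 1)) → M (d j) (d (j + 1)) → i = j) →
    ∃ H', H ≤ H' ∧ IsMarkedFill H' (K ∪ d '' {i | 0 < i ∧ i ≤ k}) M ∧
      ∀ i ≤ k, H'.Adj (d i) (d (i + 1)) := by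
  intro k
  induction k with
  | zero =>
    intro H K M d h hM hadj hm hinj hK huniq
    refine ⟨H, le_rfl, ?_, ?_⟩
    · have : {i | 0 < i ∧ i ≤ 0} = (∅ : Set ℕ) := by
        ext i; simp only [Set.mem_ofPred_eq, Set.mem_empty_iff_false, iff_false]; omega
      rwa [this, Set.image_empty, Set.union_empty]
    · intro i hi
      obtain rfl : i = 0 := by omega
      exact hadj
  | succ k ih =>
    intro H K M d h hM hadj hm hinj hK huniq
    have hd0 : d 0 ∈ K := h.mem _ _ hadj
    have hd2 : d (k + 1 + 1) ∈ K := h.mem _ _ hadj.symm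
    have hne : ∀ i j, i ≤ k + 2 → j ≤ k + 2 → d i = d j → i = j := by
      intro i j hi hj hij
      rcases lt_trichotomy i j with h1 | h1 | h1
      · exact absurd hij (hinj i j h1 hj)
      · exact h1
      · exact absurd hij.symm (hinj j i h1 hi)
    by_cases hlast : M (d (k + 1)) (d (k + 1 + 1))
    · have hfirst : ¬ M (d 0) (d 1) := fun h0 => by
        have := huniq 0 (k + 1) (by omega) le_rfl h0 hlast
        omega
      have hpK : d 1 ∉ K := hK 1 (by omega) (by omega)
      let M' : V → V → Prop := fun x y => M x y ∨ s(x, y) = s(d 1, d (k + 1 + 1))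
      have hM' : ∀ x y, M' x y → M' y x := fun x y hxy =>
        hxy.imp (hM x y) (fun e => Sym2.eq_swap.trans e)
      obtain ⟨hle, h'⟩ := (h.congr (M' := M') fun x hx y hy hxy => hxy.resolve_right fun e => by
        rcases Sym2.eq_iff.1 e with ⟨rfl, -⟩ | ⟨-, rfl⟩
        · exact hpK hx
        · exact hpK hy).addApex hM' hpK hadj (Or.inl hm) (Or.inl (by
          rintro (hh | hh)
          · exact hfirst (hM _ _ hh)
          · rcases Sym2.eq_iff.1 hh with ⟨-, hh⟩ | ⟨hh, -⟩
            · have := hne _ _ (by omega) (by omega) hh; omega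
            · have := hne _ _ (by omega) (by omega) hh; omega))
      have hA := fun v => addApex_adj_apex (H := H) (p := d 1) (a := d 0) (b := d (k + 1 + 1))
        (v := v) (fun w hw => hpK (h.mem _ _ hw)) (fun e => hpK (e ▸ hd0)) (fun e => hpK (e ▸ hd2))
      obtain ⟨H', hle', hfill, hpath⟩ := ih _ _ M' (fun i => d (i + 1)) h' hM'
        ((hA _).2 (Or.inr rfl)) (Or.inr rfl) (fun i j hij hj => hinj _ _ (by omega) (by omega))
        (by
          rintro i hi hik (hh | hh)
          · have := hne _ _ (by omega) (by omega) hh; omega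
          · exact hK _ (by omega) (by omega) hh)
        (by
          have key : ∀ i, i ≤ k → M' (d (i + 1)) (d (i + 1 + 1)) →
              M (d (i + 1)) (d (i + 1 + 1)) ∨ k = 0 := by
            intro i hi hh
            refine hh.imp id fun e => ?_
            rcases Sym2.eq_iff.1 e with ⟨e, e'⟩ | ⟨e, -⟩
            · have := hne _ _ (by omega) (by omega) e
              have := hne _ _ (by omega) (by omega) e'
              omega
            · have := hne _ _ (by omega) (by omega) e; omega
          intro i j hi hj hmi hmj
          rcases key i hi hmi with h1 | h1
          · rcases key j hj hmj with h2 | h2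
            · have := huniq (i + 1) (j + 1) (by omega) (by omega) h1 h2
              omega
            · omega
          · omega)
      refine ⟨H', hle.trans hle', ?_, ?_⟩
      · convert hfill.congr (M' := M) fun _ _ _ _ => Or.inl using 1
        ext x
        simp only [Set.mem_union, Set.mem_insert_iff, Set.mem_image, Set.mem_ofPred_eq]
        constructor
        · rintro (hx | ⟨i, ⟨hi, hik⟩, rfl⟩)
          · exact Or.inl (Or.inr hx)
          · by_cases h1 : i = 1
            · subst h1; exact Or.inl (Or.inl rfl)
            · exact Or.inr ⟨i - 1, ⟨by omega, by omega⟩, by rw [show i - 1 + 1 = i by omega]⟩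
        · rintro ((rfl | hx) | ⟨i, ⟨hi, hik⟩, rfl⟩)
          · exact Or.inr ⟨1, ⟨by omega, by omega⟩, rfl⟩
          · exact Or.inl hx
          · exact Or.inr ⟨i + 1, ⟨by omega, by omega⟩, rfl⟩
      · rintro (_ | i) hi
        · exact hle' ((hA _).2 (Or.inl rfl)).symm
        · exact hpath i (by omega)
    · have hpK : d (k + 1) ∉ K := hK (k + 1) (by omega) (by omega)
      let M' : V → V → Prop := fun x y => M x y ∨ s(x, y) = s(d 0, d (k + 1))
      have hM' : ∀ x y, M' x y → M' y x := fun x y hxy =>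
        hxy.imp (hM x y) (fun e => Sym2.eq_swap.trans e)
      obtain ⟨hle, h'⟩ := (h.congr (M' := M') fun x hx y hy hxy => hxy.resolve_right fun e => by
        rcases Sym2.eq_iff.1 e with ⟨-, rfl⟩ | ⟨rfl, -⟩
        · exact hpK hy
        · exact hpK hx).addApex hM' hpK hadj (Or.inl hm) (Or.inr (by
          rintro (hh | hh)
          · exact hlast hh
          · rcases Sym2.eq_iff.1 hh with ⟨hh, -⟩ | ⟨-, hh⟩
            · have := hne _ _ (by omega) (by omega) hh; omega
            · have := hne _ _ (by omega) (by omega) hh; omega))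
      have hA := fun v => addApex_adj_apex (H := H) (p := d (k + 1)) (a := d 0)
        (b := d (k + 1 + 1)) (v := v) (fun w hw => hpK (h.mem _ _ hw)) (fun e => hpK (e ▸ hd0))
        (fun e => hpK (e ▸ hd2))
      obtain ⟨H', hle', hfill, hpath⟩ := ih _ _ M' d h' hM'
        ((hA _).2 (Or.inl rfl)).symm (Or.inr rfl) (fun i j hij hj => hinj _ _ (by omega) (by omega))
        (by
          rintro i hi hik (hh | hh)
          · have := hne _ _ (by omega) (by omega) hh; omega
          · exact hK _ (by omega) (by omega) hh)
        (by
          have key : ∀ i, i ≤ k → M' (d i) (d (i + 1)) → M (d i) (d (i + 1)) ∨ k = 0 := by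
            intro i hi hh
            refine hh.imp id fun e => ?_
            rcases Sym2.eq_iff.1 e with ⟨e, e'⟩ | ⟨e, -⟩
            · have := hne _ _ (by omega) (by omega) e
              have := hne _ _ (by omega) (by omega) e'
              omega
            · have := hne _ _ (by omega) (by omega) e; omega
          intro i j hi hj hmi hmj
          rcases key i hi hmi with h1 | h1
          · rcases key j hj hmj with h2 | h2
            · exact huniq i j (by omega) (by omega) h1 h2
            · omega
          · omega)
      refine ⟨H', hle.trans hle', ?_, ?_⟩
      · convert hfill.congr (M' := M) fun _ _ _ _ => Or.inl using 1
        ext x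
        simp only [Set.mem_union, Set.mem_insert_iff, Set.mem_image, Set.mem_ofPred_eq]
        constructor
        · rintro (hx | ⟨i, ⟨hi, hik⟩, rfl⟩)
          · exact Or.inl (Or.inr hx)
          · by_cases h1 : i = k + 1
            · subst h1; exact Or.inl (Or.inl rfl)
            · exact Or.inr ⟨i, ⟨by omega, by omega⟩, rfl⟩
        · rintro ((rfl | hx) | ⟨i, ⟨hi, hik⟩, rfl⟩)
          · exact Or.inr ⟨k + 1, ⟨by omega, by omega⟩, rfl⟩
          · exact Or.inl hx
          · exact Or.inr ⟨i, ⟨by omega, by omega⟩, rfl⟩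
      · intro i hi
        by_cases h1 : i = k + 1
        · subst h1
          exact hle' ((hA _).2 (Or.inr rfl))
        · exact hpath i (by omega)

/-- The edge separators in `S` are at most two. -/
def TwoBoundaried {V : Type} (T : SimpleGraph V) (S : Set V) : Prop :=
  {e : Sym2 V | ∃ u v : V, e = s(u, v) ∧ u ∈ S ∧ v ∈ S ∧ IsEdgeSeparator T u v}.ncard ≤ 2

lemma IsEdgeSeparator.symm {V : Type} {T : SimpleGraph V} {u v : V} (h : IsEdgeSeparator T u v) :
    IsEdgeSeparator T v u := by
  obtain ⟨huv, S₁, S₂, hne, h₁, h₂, a, b, c, d⟩ := h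
  exact ⟨huv.symm, S₁, S₂, hne, h₁, h₂, b, a, d, c⟩

lemma CycSeq.sym2_ne {V : Type} {T : SimpleGraph V} {n : ℕ} {c : ℕ → V} (hc : CycSeq T n c)
    {i j : ℕ} (hi : i + 1 < n) (hj : j + 1 < n) (hij : i ≠ j) :
    s(c i, c (i + 1)) ≠ s(c j, c (j + 1)) := by
  intro h
  rcases Sym2.eq_iff.1 h with ⟨h, -⟩ | ⟨h, h'⟩
  · exact hij (hc.injOn (by omega) (by omega) h)
  · have := hc.injOn (by omega) (by omega) h
    have := hc.injOn (by omega) (by omega) h'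
    omega

lemma CycSeq.sym2_last_ne {V : Type} {T : SimpleGraph V} {n : ℕ} {c : ℕ → V} (hc : CycSeq T n c)
    {i : ℕ} (hi : i + 1 < n) : s(c i, c (i + 1)) ≠ s(c 0, c (n - 1)) := by
  have := hc.1
  intro h
  rcases Sym2.eq_iff.1 h with ⟨h, h'⟩ | ⟨h, h'⟩
  · have := hc.injOn (by omega) (by omega) h
    have := hc.injOn (by omega) (by omega) h'
    omega
  · have := hc.injOn (by omega) (by omega) h'
    omega

lemma CycSeq.eq_of_isEdgeSeparator {V : Type} [Finite V] {T : SimpleGraph V} {n : ℕ} {c : ℕ → V}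
    (hc : CycSeq T n c) (hS : TwoBoundaried T (c '' {i | i < n}))
    (h : IsEdgeSeparator T (c 0) (c (n - 1))) {i j : ℕ} (hi : i + 1 < n) (hj : j + 1 < n)
    (hmi : IsEdgeSeparator T (c i) (c (i + 1))) (hmj : IsEdgeSeparator T (c j) (c (j + 1))) :
    i = j := by
  have hn := hc.1
  by_contra hij
  have hmem : ∀ k, k < n → c k ∈ c '' {i | i < n} := fun k hk => ⟨k, hk, rfl⟩
  refine absurd hS (not_le.2 ((Set.two_lt_ncard).2
    ⟨s(c 0, c (n - 1)), ⟨_, _, rfl, hmem _ (by omega), hmem _ (by omega), h⟩,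
    s(c i, c (i + 1)), ⟨_, _, rfl, hmem _ (by omega), hmem _ hi, hmi⟩,
    s(c j, c (j + 1)), ⟨_, _, rfl, hmem _ (by omega), hmem _ hj, hmj⟩,
    (hc.sym2_last_ne hi).symm, (hc.sym2_last_ne hj).symm, hc.sym2_ne hi hj hij⟩))

lemma CycSeq.adj_of_adj {V : Type} {T H : SimpleGraph V} {n : ℕ} {c : ℕ → V} (hc : CycSeq T n c)
    (hsucc : ∀ i, i + 1 < n → H.Adj (c i) (c (i + 1))) (hlast : H.Adj (c 0) (c (n - 1))) :
    ∀ x ∈ c '' {i | i < n}, ∀ y ∈ c '' {i | i < n}, T.Adj x y → H.Adj x y := by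
  have key : ∀ i j, i < j → j < n → T.Adj (c i) (c j) → H.Adj (c i) (c j) := by
    intro i j hij hj h
    rcases (hc.2 i j hij hj).2.1 h with rfl | ⟨rfl, hj'⟩
    · exact hsucc i hj
    · rwa [show j = n - 1 by omega]
  rintro _ ⟨i, hi, rfl⟩ _ ⟨j, hj, rfl⟩ h
  rcases lt_trichotomy i j with hij | rfl | hij
  · exact key i j hij hj h
  · exact absurd rfl h.ne
  · exact (key j i hij hi h.symm).symm

/-- A chordless cycle glued to a marked fill along an edge separator. -/
lemma IsMarkedFill.exists_cycle {V : Type} {T H : SimpleGraph V} {K : Set V}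
    {M : V → V → Prop} (h : IsMarkedFill H K M) (hM : ∀ x y, M x y → M y x) {n : ℕ} {c : ℕ → V}
    (hc : CycSeq T n c) (hadj : H.Adj (c 0) (c (n - 1))) (hm : M (c 0) (c (n - 1)))
    (hK : K ∩ c '' {i | i < n} = {c 0, c (n - 1)})
    (huniq : ∀ i j, i + 1 < n → j + 1 < n → M (c i) (c (i + 1)) → M (c j) (c (j + 1)) → i = j) :
    ∃ H', H ≤ H' ∧ IsMarkedFill H' (K ∪ c '' {i | i < n}) M ∧
      ∀ x ∈ c '' {i | i < n}, ∀ y ∈ c '' {i | i < n}, T.Adj x y → H'.Adj x y := by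
  have hn := hc.1
  have hk : n - 2 + 1 = n - 1 := by omega
  obtain ⟨H', hle, hfill, hpath⟩ := h.exists_ear (n - 2) H K M c hM (by rwa [hk]) (by rwa [hk])
    (fun i j hij hj => (hc.2 i j hij (by omega)).1) (fun i h0 hi hiK => by
      have : c i ∈ K ∩ c '' {i | i < n} := ⟨hiK, i, by simp only [Set.mem_ofPred_eq]; omega, rfl⟩
      rw [hK] at this
      rcases this with h1 | h1
      · have := hc.injOn (by omega) (by omega) h1; omega
      · have := hc.injOn (by omega) (by omega) h1; omega)
    (fun i j hi hj => huniq i j (by omega) (by omega))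
  refine ⟨H', hle, ?_, hc.adj_of_adj (fun i hi => hpath i (by omega)) (hle hadj)⟩
  convert hfill using 1
  ext x
  simp only [Set.mem_union, Set.mem_image, Set.mem_ofPred_eq]
  constructor
  · rintro (hx | ⟨i, hi, rfl⟩)
    · exact Or.inl hx
    · by_cases h0 : i = 0
      · subst h0; exact Or.inl (h.mem _ _ hadj)
      · by_cases h1 : i = n - 1
        · subst h1; exact Or.inl (h.mem _ _ hadj.symm)
        · exact Or.inr ⟨i, ⟨by omega, by omega⟩, rfl⟩
  · rintro (hx | ⟨i, hi, rfl⟩)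
    · exact Or.inl hx
    · exact Or.inr ⟨i, by omega, rfl⟩

lemma isMarkedFill_edge {V : Type} {a b : V} (hab : a ≠ b) (M : V → V → Prop) :
    ∃ H : SimpleGraph V, H.Adj a b ∧ IsMarkedFill H {a, b} M := by
  refine ⟨SimpleGraph.fromRel fun u v => u = a ∧ v = b, ?_, ⟨?_, ?_, ?_, ?_⟩⟩
  · simp [hab]
  · intro u v huv
    rw [SimpleGraph.fromRel_adj] at huv
    simp only [Set.mem_insert_iff, Set.mem_singleton_iff]
    tauto
  · rw [isChordal_iff]
    intro n c hn hc
    have h1 := hc.adj_succ (i := 0) (by omega)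
    have h2 := hc.adj_succ (i := 1) (by omega)
    have h3 := (hc.2 0 2 (by omega) (by omega)).1
    rw [SimpleGraph.fromRel_adj] at h1 h2
    grind
  · rw [cliqueFree_four_iff]
    intro x y z _ hxy hxz _ hyz _ _
    rw [SimpleGraph.fromRel_adj] at hxy hxz hyz
    grind
  · intro x y z hxy hyz hxz
    rw [SimpleGraph.fromRel_adj] at hxy hxz hyz
    grind

lemma IsChordlessCycle.exists_isMarkedFill {V : Type} [Finite V] {T : SimpleGraph V} {S : Set V}
    (hS : IsChordlessCycle T S) (hb : TwoBoundaried T S) :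
    ∃ H, IsMarkedFill H S (IsEdgeSeparator T) ∧
      ∀ x ∈ S, ∀ y ∈ S, T.Adj x y → H.Adj x y := by
  obtain ⟨x, hx, y, hy, hxy, hmark⟩ : ∃ x ∈ S, ∃ y ∈ S, T.Adj x y ∧
      (IsEdgeSeparator T x y ∨ ∀ u ∈ S, ∀ v ∈ S, ¬ IsEdgeSeparator T u v) := by
    by_cases hex : ∃ x ∈ S, ∃ y ∈ S, IsEdgeSeparator T x y
    · obtain ⟨x, hx, y, hy, h⟩ := hex
      exact ⟨x, hx, y, hy, h.1, Or.inl h⟩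
    · obtain ⟨x, hx⟩ := hS.connOn.1
      obtain ⟨y, hy, -, -, -, hxy, -, -⟩ := hS.exists_two_neighbors hx
      exact ⟨x, hx, y, hy, hxy, Or.inr fun u hu v hv h => hex ⟨u, hu, v, hv, h⟩⟩
  obtain ⟨n, c, hc, rfl, rfl, rfl⟩ := hS.exists_cycSeq hx hy hxy
  let M : V → V → Prop := fun u v => IsEdgeSeparator T u v ∨ s(u, v) = s(c 0, c (n - 1))
  have hM : ∀ u v, M u v → M v u := fun u v h =>
    h.imp IsEdgeSeparator.symm (fun e => Sym2.eq_swap.trans e)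
  have hsub : ({c 0, c (n - 1)} : Set V) ⊆ c '' {i | i < n} := by
    rintro z (rfl | rfl) <;> assumption
  have hmem : ∀ k, k < n → c k ∈ c '' {i | i < n} := fun k hk => ⟨k, hk, rfl⟩
  obtain ⟨H₀, hadj, h₀⟩ := isMarkedFill_edge hxy.ne M
  obtain ⟨H, -, hfill, hTH⟩ := h₀.exists_cycle hM hc hadj (Or.inr rfl)
    (Set.inter_eq_left.2 hsub) (by
      intro i j hi hj hmi hmj
      have hmi := hmi.resolve_right (hc.sym2_last_ne hi)
      have hmj := hmj.resolve_right (hc.sym2_last_ne hj)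
      rcases hmark with h | h
      · exact hc.eq_of_isEdgeSeparator hb h hi hj hmi hmj
      · exact absurd hmi (h _ (hmem _ (by omega)) _ (hmem _ hi)))
  rw [Set.union_eq_right.2 hsub] at hfill
  exact ⟨H, hfill.congr fun _ _ _ _ => Or.inl, hTH⟩

/-- A tree of two-boundaried cycles can be filled to a chordal graph without suns and `K₄`. -/
lemma TreeOn.edge_or_exists_isMarkedFill {V : Type} [Finite V] {T : SimpleGraph V} {K : Set V}
    (hK : TreeOn T K) (hb : ∀ S, IsChordlessCycle T S → TwoBoundaried T S) :
    (∃ a b, T.Adj a b ∧ K = {a, b}) ∨ ∃ H, IsMarkedFill H K (IsEdgeSeparator T) ∧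
      ∀ x ∈ K, ∀ y ∈ K, T.Adj x y → H.Adj x y := by
  induction hK with
  | edge a b hab => exact Or.inl ⟨a, b, hab, rfl⟩
  | ear K S a b hK hS hKS hab hsep ih =>
    right
    have hKa : a ∈ K ∩ S := by rw [hKS]; simp
    have hKb : b ∈ K ∩ S := by rw [hKS]; simp
    have hedge : (∃ a b, T.Adj a b ∧ K = {a, b}) → ∃ H,
        IsMarkedFill H (K ∪ S) (IsEdgeSeparator T) ∧
        ∀ x ∈ K ∪ S, ∀ y ∈ K ∪ S, T.Adj x y → H.Adj x y := by
      rintro ⟨a', b', -, hK'⟩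
      have hKsub : K ⊆ S := by
        have h1 : a = a' ∨ a = b' := by
          have := hKa.1; rw [hK'] at this; exact this
        have h2 : b = a' ∨ b = b' := by
          have := hKb.1; rw [hK'] at this; exact this
        have h3 := hab.ne
        have h4 := hKa.2
        have h5 := hKb.2
        intro z hz
        rw [hK'] at hz
        have hz : z = a' ∨ z = b' := hz
        grind
      rw [Set.union_eq_right.2 hKsub]
      exact hS.exists_isMarkedFill (hb S hS)
    rcases ih with h | ⟨H, hH, hTH⟩
    · exact hedge h
    rcases hK.edge_or_exists_cycle with h | h
    · exact hedge h
    obtain ⟨R, hR, hRK, haR, hbR⟩ := h a hKa.1 b hKb.1 hab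
    obtain ⟨n, c, hc, rfl, rfl, rfl⟩ := hS.exists_cycSeq hKa.2 hKb.2 hab
    have hn := hc.1
    have h1K : c 1 ∉ K := by
      intro h1
      have : c 1 ∈ K ∩ c '' {i | i < n} := ⟨h1, 1, by simp only [Set.mem_ofPred_eq]; omega, rfl⟩
      rw [hKS] at this
      rcases this with h1 | h1
      · have := hc.injOn (by omega) (by omega) h1; omega
      · have := hc.injOn (by omega) (by omega) h1; omega
    have hmark : IsEdgeSeparator T (c 0) (c (n - 1)) := by
      refine ⟨hab, R, _, ?_, hR, hS, haR, hbR, hKa.2, hKb.2⟩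
      rintro rfl
      exact h1K (hRK ⟨1, by simp only [Set.mem_ofPred_eq]; omega, rfl⟩)
    obtain ⟨H', hle, hfill, hTH'⟩ := hH.exists_cycle (fun _ _ => IsEdgeSeparator.symm) hc
      (hTH _ hKa.1 _ hKb.1 hab) hmark hKS
      (fun i j hi hj => hc.eq_of_isEdgeSeparator (hb _ hS) hmark hi hj)
    refine ⟨H', hfill, ?_⟩
    have cross : ∀ x ∈ K, ∀ y ∈ c '' {i | i < n}, T.Adj x y → H'.Adj x y := by
      intro x hx y hy hxy
      by_cases hyK : y ∈ K
      · exact hle (hTH x hx y hyK hxy)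
      · rcases hsep y hy hyK x hx hxy.symm with rfl | rfl
        · exact hTH' _ hKa.2 _ hy hxy
        · exact hTH' _ hKb.2 _ hy hxy
    rintro x (hx | hx) y (hy | hy) hxy
    · exact hle (hTH x hx y hy hxy)
    · exact cross x hx y hy hxy
    · exact (cross y hy x hx hxy.symm).symm
    · exact hTH' x hx y hy hxy

lemma exists_triangle_of_isChordal {V : Type} [Finite V] {G H : SimpleGraph V} (hGH : G ≤ H)
    (hG : TwoConnected G) (hH : IsChordal H) : ¬ H.CliqueFree 3 := by
  intro h
  rw [twoConnected_iff] at hG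
  obtain ⟨p, a, b, hab, hpa, hpb, habH, -⟩ :=
    exists_ear_vertex hGH hG.1 hG.2 hH (h.mono (by omega))
  classical
  exact h {p, a, b} (SimpleGraph.is3Clique_triple_iff.2 ⟨hGH hpa, hGH hpb, habH⟩)

lemma sctw_eq_two_iff {V : Type} [Finite V] {G : SimpleGraph V} (hG : TwoConnected G) :
    sctw G = 2 ↔ ∃ H : SimpleGraph V, G ≤ H ∧ IsStronglyChordal H ∧ H.CliqueFree 4 := by
  have hlow : ∀ k ∈ {k | ∃ H : SimpleGraph V, G ≤ H ∧ IsStronglyChordal H ∧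
      H.CliqueFree (k + 2)}, 2 ≤ k := by
    rintro k ⟨H, hGH, hH, hK⟩
    by_contra hk
    exact exists_triangle_of_isChordal hGH hG hH.1 (hK.mono (by omega))
  constructor
  · intro h
    have hne : {k | ∃ H : SimpleGraph V, G ≤ H ∧ IsStronglyChordal H ∧
        H.CliqueFree (k + 2)}.Nonempty := by
      by_contra hcon
      rw [Set.not_nonempty_iff_eq_empty] at hcon
      rw [sctw, hcon, Nat.sInf_empty] at h
      omega
    have := Nat.sInf_mem hne
    rw [show sInf _ = 2 from h] at this
    exact this
  · intro h
    exact le_antisymm (Nat.sInf_le h) (hlow _ (Nat.sInf_mem ⟨2, h⟩))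

lemma le_cellCompletion {V : Type} [Finite V] (G : SimpleGraph V) : G ≤ cellCompletion G :=
  fun _ _ h => cellCompletion_adj.2 ⟨h.ne, Or.inl h⟩

/-- A 2-connected finite simple graph has strongly chordal treewidth equal to two
iff its cell completion is a tree of two-boundaried cycles. -/
theorem statement9 {V : Type} [Fintype V] (G : SimpleGraph V) (hG : TwoConnected G) :
    sctw G = 2 ↔ IsTreeOfTwoBoundariedCycles (cellCompletion G) := by
  have hG' := twoConnected_iff.1 hG
  rw [sctw_eq_two_iff hG]
  constructor
  · rintro ⟨H, hGH, hH, hK⟩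
    obtain ⟨hT, hTH⟩ := cellCompletion_treeOn_and_le _ V G H rfl hGH hG'.1 hG'.2 hH.1 hK
    exact ⟨hT.isTreeOfCycles hG'.1, fun S hS =>
      hT.ncard_edgeSeparator_le_two hTH hH.1 (hH.sunFree hK) hS⟩
  · rintro ⟨hT, hb⟩
    rcases hT.treeOn.edge_or_exists_isMarkedFill hb with ⟨a, b, -, hab⟩ | ⟨H, hH, hTH⟩
    · have h1 := hG'.1
      rw [← Set.ncard_univ, hab] at h1
      have := Set.ncard_insert_le a {b}
      rw [Set.ncard_singleton] at this
      omega
    · exact ⟨H, (le_cellCompletion G).trans fun u v huv =>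
        hTH u (Set.mem_univ u) v (Set.mem_univ v) huv, hH.sunFree.isStronglyChordal hH.chordal,
        hH.cliqueFree⟩
end
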